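/- arXiv:0904.3207 — 2 statements merged into one kernel-verified Lean document; each statement's English description precedes it below -/
import Mathlib

section
/- Basic theorem (Theorem 2). Assume r = 2, i.e. |W(u,v)| ≤ [I_W + J_W(u² + v²)]/2 for all u,v ∈ ℝ, and V(u) ≥ a_V|u|^q − c_V with q > 2 + 2/θ. Set p = 2 + 2/θ, Ω^t = L^p(V,w_α) and 𝒢^t = {μ ∈ 𝒢 : μ(Ω^t) = 1}, where α is such that Θ(α,θ) < ∞. Then: (i) 𝒢^t is non-empty and compact in the weak topology of probability measures on Ω; (ii) for every λ > 0 and every vertex x ∈ V there exists a constant C(λ,x) > 0 such that ∫_Ω exp(λ|ω(x)|^p) μ(dω) ≤ C(λ,x) for all μ ∈ 𝒢^t; (iii) for every λ > 0 there exists a constant C(λ) > 0 such that ∫_Ω exp(λ‖ω‖_{p,α}^p) μ(dω) ≤ C(λ) for all μ ∈ 𝒢^t. -/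
open MeasureTheory Real Filter

noncomputable section

variable {V : Type} [Countable V] [DecidableEq V]

/-- The configuration equal to `σ` on `Λ` and to `ξ` off `Λ`. -/
def comb (Λ : Finset V) (σ : ↥Λ → ℝ) (ξ : V → ℝ) : V → ℝ :=
  fun x => if h : x ∈ Λ then σ ⟨x, h⟩ else ξ x

/-- The relative local Hamiltonian `H_Λ(·|ξ)`, evaluated at the full configuration
`ω = ω_Λ × ξ_{Λᶜ}`: the sum of `W(ω(x),ω(y))` over edges with both ends in `Λ`,
plus the sum of `W(ω(x),ω(y))` over edges with `x ∈ Λ`, `y ∉ Λ`, plus `Σ_{x∈Λ} V(ω(x))`. -/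
def ham (G : SimpleGraph V) [∀ v : V, Fintype (G.neighborSet v)]
    (W : ℝ → ℝ → ℝ) (P : ℝ → ℝ) (Λ : Finset V) (ω : V → ℝ) : ℝ :=
  (∑ x ∈ Λ, ∑ y ∈ G.neighborFinset x ∩ Λ, W (ω x) (ω y)) / 2
    + ∑ x ∈ Λ, ∑ y ∈ G.neighborFinset x \ Λ, W (ω x) (ω y)
    + ∑ x ∈ Λ, P (ω x)

/-- The normalizing constant `Z_Λ(ξ)`. -/
def partZ (G : SimpleGraph V) [∀ v : V, Fintype (G.neighborSet v)]
    (W : ℝ → ℝ → ℝ) (P : ℝ → ℝ) (Λ : Finset V) (ξ : V → ℝ) : ℝ :=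
  ∫ σ : ↥Λ → ℝ, Real.exp (- ham G W P Λ (comb Λ σ ξ))

/-- The local Gibbs specification kernel `π_Λ(·|ξ)`, a measure on `Ω = ℝ^V`. -/
def gibbsKer (G : SimpleGraph V) [∀ v : V, Fintype (G.neighborSet v)]
    (W : ℝ → ℝ → ℝ) (P : ℝ → ℝ) (Λ : Finset V) (ξ : V → ℝ) : Measure (V → ℝ) :=
  (ENNReal.ofReal (partZ G W P Λ ξ))⁻¹ •
    Measure.map (fun σ => comb Λ σ ξ)
      ((volume : Measure (↥Λ → ℝ)).withDensity
        fun σ => ENNReal.ofReal (Real.exp (- ham G W P Λ (comb Λ σ ξ))))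

/-- `μ` is a Gibbs measure: a probability measure solving the DLR equation. -/
def IsGibbsMeasure (G : SimpleGraph V) [∀ v : V, Fintype (G.neighborSet v)]
    (W : ℝ → ℝ → ℝ) (P : ℝ → ℝ) (μ : Measure (V → ℝ)) : Prop :=
  IsProbabilityMeasure μ ∧
    ∀ (Λ : Finset V) (A : Set (V → ℝ)), MeasurableSet A →
      μ A = ∫⁻ ω, gibbsKer G W P Λ ω A ∂μ

/-- The weight `w_α(x) = exp(-α ρ(o,x))`. -/
def wgt (G : SimpleGraph V) (o : V) (α : ℝ) (x : V) : ℝ :=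
  Real.exp (-α * (G.dist o x : ℝ))

/-- `‖ω‖_{p,α}^p = Σ_{x∈V} |ω(x)|^p w_α(x)`. -/
def sNorm (G : SimpleGraph V) (o : V) (p α : ℝ) (ω : V → ℝ) : ℝ :=
  ∑' x : V, |ω x| ^ p * wgt G o α x

/-- The set `L^p(V, w_α)` of tempered configurations. -/
def tempered (G : SimpleGraph V) (o : V) (p α : ℝ) : Set (V → ℝ) :=
  {ω | Summable fun x : V => |ω x| ^ p * wgt G o α x}

/-- The summability `Θ(α,θ) = Σ_x Σ_{y∼x} [n(x)n(y)]^θ w_α(x) < ∞`. -/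
def ThetaFin (G : SimpleGraph V) [∀ v : V, Fintype (G.neighborSet v)]
    (o : V) (α θ : ℝ) : Prop :=
  Summable fun x : V =>
    (∑ y ∈ G.neighborFinset x, ((G.degree x : ℝ) * (G.degree y : ℝ)) ^ θ) * wgt G o α x

set_option linter.unusedSectionVars false

namespace GibbsField

open Topology
open scoped ENNReal NNReal

section RealBounds

/-- Young's inequality for the conjugate exponents `1 + 1/θ` and `θ + 1`, without prefactors. -/
theorem mul_le_rpow_add_rpow {θ a b : ℝ} (hθ : 0 < θ) (ha : 0 ≤ a) (hb : 0 ≤ b) :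
    a * b ≤ a ^ (1 + 1 / θ) + b ^ (θ + 1) := by
  have hpq : (1 + 1 / θ).HolderConjugate (θ + 1) := by
    rw [Real.holderConjugate_iff]
    refine ⟨by linarith [one_div_pos.2 hθ], ?_⟩
    field_simp
  have h := Real.young_inequality_of_nonneg ha hb hpq
  have h1 : a ^ (1 + 1 / θ) / (1 + 1 / θ) ≤ a ^ (1 + 1 / θ) :=
    div_le_self (Real.rpow_nonneg ha _) (by linarith [one_div_pos.2 hθ])
  have h2 : b ^ (θ + 1) / (θ + 1) ≤ b ^ (θ + 1) :=
    div_le_self (Real.rpow_nonneg hb _) (by linarith)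
  linarith

theorem sq_rpow_eq_abs_rpow {θ : ℝ} (u : ℝ) :
    (u ^ 2) ^ (1 + 1 / θ) = |u| ^ (2 + 2 / θ) := by
  rw [← sq_abs, ← Real.rpow_natCast, ← Real.rpow_mul (abs_nonneg u)]
  congr 1
  push_cast
  ring

theorem sq_mul_le {θ : ℝ} (hθ : 0 < θ) (u : ℝ) {b : ℝ} (hb : 0 ≤ b) :
    b * u ^ 2 ≤ |u| ^ (2 + 2 / θ) + b ^ (θ + 1) := by
  rw [mul_comm, ← sq_rpow_eq_abs_rpow]
  exact mul_le_rpow_add_rpow hθ (sq_nonneg u) hb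

/-- Young's inequality with a free weight `s` on the `|u|^p` term, `p = 2 + 2/θ`. -/
theorem sq_mul_le_weighted {θ : ℝ} (hθ : 0 < θ) (u : ℝ) {b s : ℝ} (hb : 0 ≤ b) (hs : 0 < s) :
    b * u ^ 2 ≤ s * |u| ^ (2 + 2 / θ) + b ^ (θ + 1) * s⁻¹ ^ θ := by
  set c : ℝ := s ^ (θ / (θ + 1)) with hc
  have hc0 : 0 < c := Real.rpow_pos_of_pos hs _
  have h := mul_le_rpow_add_rpow hθ (mul_nonneg hc0.le (sq_nonneg u)) (div_nonneg hb hc0.le)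
  rw [Real.mul_rpow hc0.le (sq_nonneg u), sq_rpow_eq_abs_rpow, Real.div_rpow hb hc0.le] at h
  have h1 : c ^ (1 + 1 / θ) = s := by
    rw [hc, ← Real.rpow_mul hs.le]
    rw [show θ / (θ + 1) * (1 + 1 / θ) = 1 by field_simp, Real.rpow_one]
  have h2 : c ^ (θ + 1) = s ^ θ := by
    rw [hc, ← Real.rpow_mul hs.le]
    rw [show θ / (θ + 1) * (θ + 1) = θ by field_simp]
  rw [h1, h2] at h
  calc b * u ^ 2 = c * u ^ 2 * (b / c) := by field_simp
    _ ≤ _ := h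
    _ = s * |u| ^ (2 + 2 / θ) + b ^ (θ + 1) * s⁻¹ ^ θ := by
      rw [Real.inv_rpow hs.le, div_eq_mul_inv (b ^ (θ + 1))]

theorem exists_mul_rpow_sub_rpow_le {a D p q : ℝ} (ha : 0 < a) (hD : 0 ≤ D) (hp : 0 < p)
    (hpq : p < q) : ∃ C, ∀ t : ℝ, 0 ≤ t → D * t ^ p - a * t ^ q ≤ C := by
  set R : ℝ := (D / a) ^ (1 / (q - p)) with hR
  have hDa : 0 ≤ D / a := div_nonneg hD ha.le
  have hR0 : 0 ≤ R := Real.rpow_nonneg hDa _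
  refine ⟨D * R ^ p, fun t ht => ?_⟩
  rcases le_or_gt t R with h | h
  · have h1 : D * t ^ p ≤ D * R ^ p :=
      mul_le_mul_of_nonneg_left (Real.rpow_le_rpow ht h hp.le) hD
    have h2 : 0 ≤ a * t ^ q := mul_nonneg ha.le (Real.rpow_nonneg ht _)
    linarith
  · have ht0 : 0 < t := lt_of_le_of_lt hR0 h
    have h1 : D / a ≤ t ^ (q - p) := by
      have h3 : R ^ (q - p) ≤ t ^ (q - p) := Real.rpow_le_rpow hR0 h.le (by linarith)
      have h4 : R ^ (q - p) = D / a := by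
        rw [hR, ← Real.rpow_mul hDa, one_div, inv_mul_cancel₀ (by linarith), Real.rpow_one]
      rwa [h4] at h3
    have h2 : t ^ q = t ^ p * t ^ (q - p) := by
      rw [← Real.rpow_add ht0]
      congr 1
      ring
    have h3 : D ≤ a * t ^ (q - p) := by
      rw [div_le_iff₀ ha] at h1
      linarith
    have h4 : 0 ≤ t ^ p := Real.rpow_nonneg ht _
    have h5 : 0 ≤ D * R ^ p := mul_nonneg hD (Real.rpow_nonneg hR0 _)
    rw [h2]
    nlinarith [mul_le_mul_of_nonneg_right h3 h4]

theorem sq_le_one_add_abs_rpow {p : ℝ} (hp : 2 ≤ p) (u : ℝ) : u ^ 2 ≤ 1 + |u| ^ p := by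
  rw [← sq_abs]
  rcases le_or_gt |u| 1 with h | h
  · have := Real.rpow_nonneg (abs_nonneg u) p
    nlinarith [abs_nonneg u]
  · have h1 : |u| ^ (2 : ℝ) ≤ |u| ^ p := Real.rpow_le_rpow_of_exponent_le h.le hp
    rw [Real.rpow_two] at h1
    linarith

/-- A superquadratic potential dominates lower powers, with a Gaussian to spare. -/
theorem exists_add_sub_rpow_le {a p q : ℝ} (ha : 0 < a) (hp : 2 ≤ p) (hpq : p < q) (D : ℝ) :
    ∃ C, ∀ u : ℝ, D * |u| ^ p + D * u ^ 2 - a * |u| ^ q ≤ C - u ^ 2 := by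
  obtain ⟨C, hC⟩ := exists_mul_rpow_sub_rpow_le (D := 2 * |D| + 1) ha (by positivity)
    (by linarith) hpq
  refine ⟨C + |D| + 1, fun u => ?_⟩
  have h1 := hC |u| (abs_nonneg u)
  have h2 := sq_le_one_add_abs_rpow hp u
  have h3 := Real.rpow_nonneg (abs_nonneg u) p
  have h4 := le_abs_self D
  have h5 := abs_nonneg D
  nlinarith [mul_le_mul_of_nonneg_right h4 h3, mul_le_mul_of_nonneg_right h4 (sq_nonneg u),
    mul_le_mul_of_nonneg_left h2 h5]

end RealBounds

/-- The standing assumptions on the pair potential `W` and the self-potential `P`. -/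
structure IsStableInteraction (W : ℝ → ℝ → ℝ) (P : ℝ → ℝ) (I J a c p q : ℝ) : Prop where
  continuous_pair : Continuous (Function.uncurry W)
  symm : ∀ u v, W u v = W v u
  I_nonneg : 0 ≤ I
  J_nonneg : 0 ≤ J
  abs_pair_le : ∀ u v, |W u v| ≤ (I + J * (u ^ 2 + v ^ 2)) / 2
  continuous_self : Continuous P
  a_pos : 0 < a
  two_le : 2 ≤ p
  p_lt_q : p < q
  le_self : ∀ u, a * |u| ^ q - c ≤ P u

section Hamiltonian

variable {G : SimpleGraph V} [∀ v : V, Fintype (G.neighborSet v)]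
  {W : ℝ → ℝ → ℝ} {P : ℝ → ℝ} {I J a c p q : ℝ}

theorem comb_apply_mem {Λ : Finset V} (σ : ↥Λ → ℝ) (ξ : V → ℝ) (x : ↥Λ) :
    comb Λ σ ξ x = σ x := by
  simp [comb]

theorem comb_apply_notMem {Λ : Finset V} (σ : ↥Λ → ℝ) (ξ : V → ℝ) {x : V} (hx : x ∉ Λ) :
    comb Λ σ ξ x = ξ x := by
  simp [comb, hx]

theorem continuous_comb (Λ : Finset V) :
    Continuous fun z : (↥Λ → ℝ) × (V → ℝ) => comb Λ z.1 z.2 := by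
  refine continuous_pi fun x => ?_
  by_cases hx : x ∈ Λ
  · simp only [comb, hx, dif_pos]
    fun_prop
  · simp only [comb, hx, dif_neg, not_false_eq_true]
    fun_prop

theorem IsStableInteraction.continuous_ham (h : IsStableInteraction W P I J a c p q)
    (Λ : Finset V) : Continuous (ham G W P Λ) := by
  have hW : ∀ x y : V, Continuous fun ω : V → ℝ => W (ω x) (ω y) := fun x y =>
    h.continuous_pair.comp (g := Function.uncurry W) (f := fun ω : V → ℝ => (ω x, ω y))
      ((continuous_apply x).prodMk (continuous_apply y))
  have hP : ∀ x : V, Continuous fun ω : V → ℝ => P (ω x) := fun x =>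
    h.continuous_self.comp (continuous_apply x)
  unfold ham
  refine (Continuous.add (Continuous.div_const ?_ 2) ?_).add ?_
  · exact continuous_finsetSum _ fun x _ => continuous_finsetSum _ fun y _ => hW x y
  · exact continuous_finsetSum _ fun x _ => continuous_finsetSum _ fun y _ => hW x y
  · exact continuous_finsetSum _ fun x _ => hP x

theorem sum_neighbor_comm (h : IsStableInteraction W P I J a c p q) (A B : Finset V)
    (ω : V → ℝ) :
    ∑ x ∈ A, ∑ y ∈ G.neighborFinset x ∩ B, W (ω x) (ω y)
      = ∑ x ∈ B, ∑ y ∈ G.neighborFinset x ∩ A, W (ω x) (ω y) := by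
  classical
  have key : ∀ A B : Finset V, ∑ x ∈ A, ∑ y ∈ G.neighborFinset x ∩ B, W (ω x) (ω y)
      = ∑ x ∈ A, ∑ y ∈ B, if G.Adj x y then W (ω x) (ω y) else 0 := by
    intro A B
    refine Finset.sum_congr rfl fun x _ => ?_
    rw [← Finset.sum_filter]
    refine Finset.sum_congr ?_ fun _ _ => rfl
    ext y
    simp [and_comm]
  rw [key, key, Finset.sum_comm]
  refine Finset.sum_congr rfl fun x _ => Finset.sum_congr rfl fun y _ => ?_
  simp only [G.adj_comm x y, h.symm (ω x) (ω y)]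

/-- The part of `H_Δ` which is not in `H_Λ` only sees the spins off `Λ`. -/
theorem IsStableInteraction.exists_ham_eq_add (h : IsStableInteraction W P I J a c p q)
    {Λ Δ : Finset V} (hΛ : Λ ⊆ Δ) :
    ∃ R : (V → ℝ) → ℝ, (∀ ω, ham G W P Δ ω = ham G W P Λ ω + R ω) ∧
      ∀ ω ω' : V → ℝ, (∀ x ∉ Λ, ω x = ω' x) → R ω = R ω' := by
  refine ⟨fun ω => (∑ x ∈ Δ \ Λ, ∑ y ∈ G.neighborFinset x ∩ (Δ \ Λ), W (ω x) (ω y)) / 2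
    + ∑ x ∈ Δ \ Λ, ∑ y ∈ G.neighborFinset x \ Δ, W (ω x) (ω y) + ∑ x ∈ Δ \ Λ, P (ω x),
    fun ω => ?_, fun ω ω' hω => ?_⟩
  · have hsplit : ∀ f : V → ℝ, ∑ x ∈ Δ, f x = ∑ x ∈ Λ, f x + ∑ x ∈ Δ \ Λ, f x := fun f => by
      rw [add_comm, Finset.sum_sdiff hΛ]
    have hin : ∀ x, ∑ y ∈ G.neighborFinset x ∩ Δ, W (ω x) (ω y)
        = ∑ y ∈ G.neighborFinset x ∩ Λ, W (ω x) (ω y)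
          + ∑ y ∈ G.neighborFinset x ∩ (Δ \ Λ), W (ω x) (ω y) := fun x => by
      rw [← Finset.sum_union]
      · rw [← Finset.inter_union_distrib_left, Finset.union_sdiff_of_subset hΛ]
      · exact Finset.disjoint_of_subset_left Finset.inter_subset_right
          (Finset.disjoint_of_subset_right Finset.inter_subset_right Finset.disjoint_sdiff)
    have hout : ∀ x, ∑ y ∈ G.neighborFinset x \ Λ, W (ω x) (ω y)
        = ∑ y ∈ G.neighborFinset x ∩ (Δ \ Λ), W (ω x) (ω y)
          + ∑ y ∈ G.neighborFinset x \ Δ, W (ω x) (ω y) := fun x => by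
      rw [← Finset.sum_union]
      · refine Finset.sum_congr ?_ fun _ _ => rfl
        ext y
        simp only [Finset.mem_sdiff, Finset.mem_union, Finset.mem_inter]
        have := @hΛ y
        tauto
      · refine Finset.disjoint_left.2 fun y hy hy' => ?_
        simp only [Finset.mem_sdiff, Finset.mem_inter] at hy hy'
        exact hy'.2 hy.2.1
    simp only [ham, hin, hout, hsplit, Finset.sum_add_distrib]
    rw [sum_neighbor_comm h (Δ \ Λ) Λ ω]
    ring
  · have h1 : ∀ x ∈ Δ \ Λ, ω x = ω' x := fun x hx => hω x (Finset.mem_sdiff.1 hx).2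
    have h2 : ∀ x, ∀ y ∈ G.neighborFinset x \ Δ, ω y = ω' y := fun x y hy =>
      hω y fun hy' => (Finset.mem_sdiff.1 hy).2 (hΛ hy')
    have e1 : ∀ x ∈ Δ \ Λ, ∑ y ∈ G.neighborFinset x ∩ (Δ \ Λ), W (ω x) (ω y)
        = ∑ y ∈ G.neighborFinset x ∩ (Δ \ Λ), W (ω' x) (ω' y) := fun x hx =>
      Finset.sum_congr rfl fun y hy => by rw [h1 x hx, h1 y (Finset.mem_inter.1 hy).2]
    have e2 : ∀ x ∈ Δ \ Λ, ∑ y ∈ G.neighborFinset x \ Δ, W (ω x) (ω y)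
        = ∑ y ∈ G.neighborFinset x \ Δ, W (ω' x) (ω' y) := fun x hx =>
      Finset.sum_congr rfl fun y hy => by rw [h1 x hx, h2 x y hy]
    have e3 : ∀ x ∈ Δ \ Λ, P (ω x) = P (ω' x) := fun x hx => by rw [h1 x hx]
    simp only [Finset.sum_congr rfl e1, Finset.sum_congr rfl e2, Finset.sum_congr rfl e3]

/-- The contribution of the boundary condition to the lower bound on the local Hamiltonian. -/
def boundaryEnergy (G : SimpleGraph V) [∀ v : V, Fintype (G.neighborSet v)] (I J : ℝ)
    (Λ : Finset V) (ξ : V → ℝ) : ℝ :=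
  ∑ x ∈ Λ, ∑ y ∈ G.neighborFinset x, (I + J * ξ y ^ 2)

theorem continuous_boundaryEnergy (Λ : Finset V) :
    Continuous (boundaryEnergy G I J Λ) := by
  unfold boundaryEnergy
  fun_prop

theorem IsStableInteraction.le_ham_comb (h : IsStableInteraction W P I J a c p q)
    (Λ : Finset V) : ∃ D, ∀ (ξ : V → ℝ) (σ : ↥Λ → ℝ),
      ∑ x : ↥Λ, (a * |σ x| ^ q - c - D * σ x ^ 2) - boundaryEnergy G I J Λ ξ
        ≤ ham G W P Λ (comb Λ σ ξ) := by
  refine ⟨∑ x ∈ Λ, ∑ _y ∈ G.neighborFinset x, 2 * J, fun ξ σ => ?_⟩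
  set ω := comb Λ σ ξ with hω
  set Q : ℝ := ∑ z : ↥Λ, σ z ^ 2 with hQ
  have hJ := h.J_nonneg
  have hQ0 : 0 ≤ Q := Finset.sum_nonneg fun _ _ => sq_nonneg _
  have hmem : ∀ x ∈ Λ, ω x ^ 2 ≤ Q := fun x hx => by
    rw [hω, comb_apply_mem σ ξ ⟨x, hx⟩]
    exact Finset.single_le_sum (f := fun z : ↥Λ => σ z ^ 2) (fun _ _ => sq_nonneg _)
      (Finset.mem_univ _)
  have hall : ∀ y, ω y ^ 2 ≤ Q + ξ y ^ 2 := fun y => by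
    by_cases hy : y ∈ Λ
    · linarith [hmem y hy, sq_nonneg (ξ y)]
    · rw [hω, comb_apply_notMem σ ξ hy]
      linarith
  have hpair : ∀ x ∈ Λ, ∀ y, |W (ω x) (ω y)| ≤ 2 * J * Q + (I + J * ξ y ^ 2) := by
    intro x hx y
    refine (h.abs_pair_le _ _).trans ?_
    have h1 := mul_le_mul_of_nonneg_left (add_le_add (hmem x hx) (hall y)) hJ
    have h2 : 0 ≤ J * Q := mul_nonneg hJ hQ0
    have h3 : 0 ≤ J * ξ y ^ 2 := mul_nonneg hJ (sq_nonneg _)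
    have h4 := h.I_nonneg
    linarith
  have hself : ∑ x : ↥Λ, (a * |σ x| ^ q - c) ≤ ∑ x ∈ Λ, P (ω x) := by
    rw [← Finset.sum_coe_sort Λ]
    refine Finset.sum_le_sum fun x _ => ?_
    rw [hω, comb_apply_mem]
    exact h.le_self _
  have hint : -(∑ x ∈ Λ, ∑ y ∈ G.neighborFinset x, (2 * J * Q + (I + J * ξ y ^ 2)))
      ≤ (∑ x ∈ Λ, ∑ y ∈ G.neighborFinset x ∩ Λ, W (ω x) (ω y)) / 2
        + ∑ x ∈ Λ, ∑ y ∈ G.neighborFinset x \ Λ, W (ω x) (ω y) := by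
    rw [Finset.sum_div, ← Finset.sum_add_distrib, ← Finset.sum_neg_distrib]
    refine Finset.sum_le_sum fun x hx => ?_
    rw [← Finset.sum_inter_add_sum_sdiff (G.neighborFinset x) Λ, neg_add]
    have hb : ∀ y, 0 ≤ 2 * J * Q + (I + J * ξ y ^ 2) := fun y =>
      (abs_nonneg _).trans (hpair x hx y)
    refine add_le_add ?_ ?_
    · rw [Finset.sum_div, ← Finset.sum_neg_distrib]
      refine Finset.sum_le_sum fun y _ => ?_
      linarith [neg_abs_le (W (ω x) (ω y)), hpair x hx y, hb y]
    · rw [← Finset.sum_neg_distrib]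
      refine Finset.sum_le_sum fun y _ => ?_
      linarith [neg_abs_le (W (ω x) (ω y)), hpair x hx y]
  have hexp : ∑ x ∈ Λ, ∑ y ∈ G.neighborFinset x, (2 * J * Q + (I + J * ξ y ^ 2))
      = (∑ x ∈ Λ, ∑ _y ∈ G.neighborFinset x, 2 * J) * Q + boundaryEnergy G I J Λ ξ := by
    simp only [boundaryEnergy, Finset.sum_add_distrib, Finset.sum_mul]
  rw [hexp] at hint
  rw [Finset.sum_sub_distrib, ← Finset.mul_sum, ← hQ]
  unfold ham
  linarith

/-- Exponential `p`-moments of the Boltzmann factor have an integrable majorant which depends on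
the boundary condition only through a continuous prefactor. -/
theorem IsStableInteraction.exists_integrable_majorant
    (h : IsStableInteraction W P I J a c p q) (Λ : Finset V) (lam : ℝ) :
    ∃ b : (↥Λ → ℝ) → ℝ, Integrable b ∧ ∀ (ξ : V → ℝ) (σ : ↥Λ → ℝ),
      exp (lam * ∑ x : ↥Λ, |σ x| ^ p - ham G W P Λ (comb Λ σ ξ))
        ≤ exp (boundaryEnergy G I J Λ ξ) * b σ := by
  obtain ⟨D, hD⟩ := h.le_ham_comb (G := G) Λ
  obtain ⟨C, hC⟩ := exists_add_sub_rpow_le h.a_pos h.two_le h.p_lt_q (|lam| + |D|)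
  refine ⟨fun σ => ∏ x : ↥Λ, exp (C + c - σ x ^ 2), ?_, fun ξ σ => ?_⟩
  · have h1 : Integrable fun u : ℝ => exp (C + c - u ^ 2) := by
      have := (integrable_exp_neg_mul_sq (b := 1) one_pos).const_mul (exp (C + c))
      refine this.congr (Filter.Eventually.of_forall fun u => ?_)
      simp only [← Real.exp_add]
      congr 1
      ring
    exact Integrable.fintype_prod fun _ => h1
  · simp only
    rw [← Real.exp_sum, ← Real.exp_add, Real.exp_le_exp]
    have h1 := hD ξ σ
    have h2 : lam * ∑ x : ↥Λ, |σ x| ^ p - ∑ x : ↥Λ, (a * |σ x| ^ q - c - D * σ x ^ 2)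
        ≤ ∑ x : ↥Λ, (C + c - σ x ^ 2) := by
      rw [Finset.mul_sum, ← Finset.sum_sub_distrib]
      refine Finset.sum_le_sum fun x _ => ?_
      have h3 := hC (σ x)
      have h4 := Real.rpow_nonneg (abs_nonneg (σ x)) p
      have h5 := sq_nonneg (σ x)
      nlinarith [mul_le_mul_of_nonneg_right (le_abs_self lam) h4,
        mul_le_mul_of_nonneg_right (le_abs_self D) h5,
        mul_nonneg (abs_nonneg D) h4, mul_nonneg (abs_nonneg lam) h5]
    linarith

end Hamiltonian

section Kernel

variable {G : SimpleGraph V} [∀ v : V, Fintype (G.neighborSet v)]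
  {W : ℝ → ℝ → ℝ} {P : ℝ → ℝ} {I J a c p q : ℝ}

/-- Integration of the spins in `Λ` against Lebesgue measure. -/
abbrev lebMarginal (Λ : Finset V) (f : (V → ℝ) → ℝ≥0∞) : (V → ℝ) → ℝ≥0∞ :=
  lmarginal (fun _ : V => (volume : Measure ℝ)) Λ f

theorem lebMarginal_apply (Λ : Finset V) (f : (V → ℝ) → ℝ≥0∞) (ξ : V → ℝ) :
    lebMarginal Λ f ξ = ∫⁻ σ : ↥Λ → ℝ, f (comb Λ σ ξ) := rfl

theorem measurable_comb_left (Λ : Finset V) (ξ : V → ℝ) :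
    Measurable fun σ : ↥Λ → ℝ => comb Λ σ ξ :=
  ((continuous_comb Λ).comp (continuous_id.prodMk continuous_const)).measurable

theorem lebMarginal_mul_of_eq_off {Λ : Finset V} {f h : (V → ℝ) → ℝ≥0∞} (hf : Measurable f)
    (hh : ∀ ω ω' : V → ℝ, (∀ x ∉ Λ, ω x = ω' x) → h ω = h ω') (ξ : V → ℝ) :
    lebMarginal Λ (fun ω => f ω * h ω) ξ = lebMarginal Λ f ξ * h ξ := by
  have h1 : ∀ σ : ↥Λ → ℝ, h (comb Λ σ ξ) = h ξ := fun σ =>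
    hh _ _ fun x hx => comb_apply_notMem σ ξ hx
  simp only [lebMarginal_apply, h1]
  exact lintegral_mul_const _ (hf.comp (measurable_comb_left Λ ξ))

/-- The Boltzmann factor of the region `Λ`. -/
def boltzmann (G : SimpleGraph V) [∀ v : V, Fintype (G.neighborSet v)]
    (W : ℝ → ℝ → ℝ) (P : ℝ → ℝ) (Λ : Finset V) (ω : V → ℝ) : ℝ≥0∞ :=
  ENNReal.ofReal (exp (-ham G W P Λ ω))

namespace IsStableInteraction

theorem measurable_boltzmann (h : IsStableInteraction W P I J a c p q)
    (Λ : Finset V) : Measurable (boltzmann G W P Λ) :=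
  ENNReal.measurable_ofReal.comp (h.continuous_ham Λ).neg.rexp.measurable

theorem continuous_ham_comb (h : IsStableInteraction W P I J a c p q)
    (Λ : Finset V) :
    Continuous fun z : (↥Λ → ℝ) × (V → ℝ) => ham G W P Λ (comb Λ z.1 z.2) :=
  (h.continuous_ham Λ).comp (continuous_comb Λ)

theorem exists_majorant (h : IsStableInteraction W P I J a c p q)
    (Λ : Finset V) :
    ∃ b : (↥Λ → ℝ) → ℝ, Integrable b ∧ ∀ (ξ : V → ℝ) (σ : ↥Λ → ℝ),
      exp (-ham G W P Λ (comb Λ σ ξ)) ≤ exp (boundaryEnergy G I J Λ ξ) * b σ := by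
  obtain ⟨b, hb, hle⟩ := h.exists_integrable_majorant (G := G) Λ 0
  exact ⟨b, hb, fun ξ σ => by simpa using hle ξ σ⟩

theorem integrable_exp_neg_ham (h : IsStableInteraction W P I J a c p q)
    (Λ : Finset V) (ξ : V → ℝ) :
    Integrable fun σ : ↥Λ → ℝ => exp (-ham G W P Λ (comb Λ σ ξ)) := by
  obtain ⟨b, hb, hle⟩ := h.exists_majorant (G := G) Λ
  refine (hb.const_mul (exp (boundaryEnergy G I J Λ ξ))).mono' ?_ (Eventually.of_forall fun σ => ?_)
  · exact ((h.continuous_ham_comb Λ).comp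
      (continuous_id.prodMk continuous_const)).neg.rexp.aestronglyMeasurable
  · rw [Real.norm_of_nonneg (exp_pos _).le]
    exact hle ξ σ

theorem partZ_pos (h : IsStableInteraction W P I J a c p q)
    (Λ : Finset V) (ξ : V → ℝ) : 0 < partZ G W P Λ ξ :=
  integral_exp_pos (h.integrable_exp_neg_ham Λ ξ)

theorem ofReal_partZ (h : IsStableInteraction W P I J a c p q)
    (Λ : Finset V) (ξ : V → ℝ) :
    ENNReal.ofReal (partZ G W P Λ ξ) = lebMarginal Λ (boltzmann G W P Λ) ξ :=
  ofReal_integral_eq_lintegral_ofReal (h.integrable_exp_neg_ham Λ ξ)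
    (Eventually.of_forall fun _ => (exp_pos _).le)

theorem lebMarginal_boltzmann_ne_zero (h : IsStableInteraction W P I J a c p q)
    (Λ : Finset V) (ξ : V → ℝ) :
    lebMarginal Λ (boltzmann G W P Λ) ξ ≠ 0 := by
  rw [← h.ofReal_partZ]
  exact (ENNReal.ofReal_pos.2 (h.partZ_pos Λ ξ)).ne'

theorem lebMarginal_boltzmann_ne_top (h : IsStableInteraction W P I J a c p q)
    (Λ : Finset V) (ξ : V → ℝ) :
    lebMarginal Λ (boltzmann G W P Λ) ξ ≠ ∞ := by
  rw [← h.ofReal_partZ]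
  exact ENNReal.ofReal_ne_top

theorem lintegral_gibbsKer (h : IsStableInteraction W P I J a c p q)
    (Λ : Finset V) (ξ : V → ℝ) {f : (V → ℝ) → ℝ≥0∞}
    (hf : Measurable f) :
    ∫⁻ ω, f ω ∂gibbsKer G W P Λ ξ
      = (lebMarginal Λ (boltzmann G W P Λ) ξ)⁻¹
        * lebMarginal Λ (fun ω => f ω * boltzmann G W P Λ ω) ξ := by
  have hm := measurable_comb_left Λ ξ
  have hd : Measurable fun σ : ↥Λ → ℝ => ENNReal.ofReal (exp (-ham G W P Λ (comb Λ σ ξ))) :=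
    (h.measurable_boltzmann Λ).comp hm
  rw [gibbsKer, lintegral_smul_measure, lintegral_map hf hm, h.ofReal_partZ, smul_eq_mul,
    lintegral_withDensity_eq_lintegral_mul _ hd (g := fun σ => f (comb Λ σ ξ)) (hf.comp hm)]
  simp only [lebMarginal_apply, boltzmann, Pi.mul_apply, mul_comm]

theorem lintegral_gibbsKer_of_eq_off (h : IsStableInteraction W P I J a c p q)
    (Λ : Finset V) (ξ : V → ℝ) {f : (V → ℝ) → ℝ≥0∞}
    (hf : Measurable f) (hoff : ∀ ω ω' : V → ℝ, (∀ x ∉ Λ, ω x = ω' x) → f ω = f ω') :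
    ∫⁻ ω, f ω ∂gibbsKer G W P Λ ξ = f ξ := by
  rw [h.lintegral_gibbsKer Λ ξ hf]
  simp only [mul_comm (f _)]
  rw [lebMarginal_mul_of_eq_off (h.measurable_boltzmann Λ) hoff, ← mul_assoc,
    ENNReal.inv_mul_cancel (h.lebMarginal_boltzmann_ne_zero Λ ξ)
      (h.lebMarginal_boltzmann_ne_top Λ ξ), one_mul]

theorem isProbabilityMeasure_gibbsKer (h : IsStableInteraction W P I J a c p q)
    (Λ : Finset V) (ξ : V → ℝ) :
    IsProbabilityMeasure (gibbsKer G W P Λ ξ) := by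
  refine ⟨?_⟩
  rw [← lintegral_one]
  exact h.lintegral_gibbsKer_of_eq_off Λ ξ measurable_const fun _ _ _ => rfl

theorem measurable_lintegral_gibbsKer (h : IsStableInteraction W P I J a c p q)
    (Λ : Finset V) {f : (V → ℝ) → ℝ≥0∞}
    (hf : Measurable f) : Measurable fun ξ => ∫⁻ ω, f ω ∂gibbsKer G W P Λ ξ := by
  simp only [h.lintegral_gibbsKer Λ _ hf]
  exact ((h.measurable_boltzmann Λ).lmarginal _).inv.mul
    ((hf.mul (h.measurable_boltzmann Λ)).lmarginal _)

theorem measurable_gibbsKer (h : IsStableInteraction W P I J a c p q)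
    (Λ : Finset V) : Measurable (gibbsKer G W P Λ) := by
  refine Measure.measurable_of_measurable_coe _ fun s hs => ?_
  simpa only [lintegral_indicator_one hs] using
    h.measurable_lintegral_gibbsKer (G := G) Λ (measurable_one.indicator hs)

/-- Consistency of the local specification. -/
theorem lintegral_lintegral_gibbsKer (h : IsStableInteraction W P I J a c p q)
    {Λ Δ : Finset V} (hΛ : Λ ⊆ Δ) (ξ : V → ℝ)
    {f : (V → ℝ) → ℝ≥0∞} (hf : Measurable f) :
    ∫⁻ ω, ∫⁻ η, f η ∂gibbsKer G W P Λ ω ∂gibbsKer G W P Δ ξ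
      = ∫⁻ ω, f ω ∂gibbsKer G W P Δ ξ := by
  obtain ⟨R, hR, hRoff⟩ := h.exists_ham_eq_add (G := G) hΛ
  set k : (V → ℝ) → ℝ≥0∞ := fun ω => ENNReal.ofReal (exp (-R ω)) with hk
  have hkoff : ∀ ω ω' : V → ℝ, (∀ x ∉ Λ, ω x = ω' x) → k ω = k ω' := fun ω ω' hω => by
    simp only [hk, hRoff ω ω' hω]
  have hbk : boltzmann G W P Δ = fun ω => boltzmann G W P Λ ω * k ω := by
    funext ω
    simp only [boltzmann, hk, hR ω, neg_add, Real.exp_add]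
    exact ENNReal.ofReal_mul (exp_pos _).le
  have hmb := h.measurable_boltzmann (G := G) Λ
  have hmfb := hf.fun_mul hmb
  have hmF := h.measurable_lintegral_gibbsKer (G := G) Λ hf
  rw [h.lintegral_gibbsKer Δ ξ hf, h.lintegral_gibbsKer Δ ξ hmF]
  congr 1
  have hdisj : Disjoint (Δ \ Λ) Λ := Finset.sdiff_disjoint
  have hunion : Δ = (Δ \ Λ) ∪ Λ := (Finset.sdiff_union_of_subset hΛ).symm
  have hmbΔ := h.measurable_boltzmann (G := G) Δ
  have hfubini : ∀ {g : (V → ℝ) → ℝ≥0∞}, Measurable g →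
      lebMarginal Δ g = lebMarginal (Δ \ Λ) (lebMarginal Λ g) := fun {g} hg => by
    conv_lhs => rw [hunion]
    exact lmarginal_union _ g hg hdisj
  rw [hfubini (hmF.fun_mul hmbΔ), hfubini (hf.fun_mul hmbΔ)]
  congr 1
  funext ω
  simp only [hbk, ← mul_assoc]
  rw [lebMarginal_mul_of_eq_off hmfb hkoff, lebMarginal_mul_of_eq_off (hmF.fun_mul hmb) hkoff]
  congr 1
  have hFoff : ∀ ω ω' : V → ℝ, (∀ x ∉ Λ, ω x = ω' x) →
      ∫⁻ η, f η ∂gibbsKer G W P Λ ω = ∫⁻ η, f η ∂gibbsKer G W P Λ ω' := fun ω ω' hω => by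
    rw [h.lintegral_gibbsKer Λ _ hf, h.lintegral_gibbsKer Λ _ hf]
    congr 1
    · exact congrArg _ (lmarginal_congr _ _ hω)
    · exact lmarginal_congr _ _ hω
  simp only [mul_comm _ (boltzmann G W P Λ _)]
  rw [lebMarginal_mul_of_eq_off hmb hFoff, h.lintegral_gibbsKer Λ _ hf, ← mul_assoc,
    ENNReal.mul_inv_cancel (h.lebMarginal_boltzmann_ne_zero Λ ω)
      (h.lebMarginal_boltzmann_ne_top Λ ω), one_mul]
  simp only [mul_comm]

theorem continuous_integral_comb (h : IsStableInteraction W P I J a c p q)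
    (Λ : Finset V) {f : (V → ℝ) → ℝ} (hf : Continuous f)
    {K : ℝ} (hK : ∀ ω, |f ω| ≤ K) :
    Continuous fun ξ : V → ℝ =>
      ∫ σ : ↥Λ → ℝ, f (comb Λ σ ξ) * exp (-ham G W P Λ (comb Λ σ ξ)) := by
  obtain ⟨b, hb, hle⟩ := h.exists_majorant (G := G) Λ
  have hcont : Continuous fun z : (↥Λ → ℝ) × (V → ℝ) =>
      f (comb Λ z.1 z.2) * exp (-ham G W P Λ (comb Λ z.1 z.2)) :=
    (hf.comp (continuous_comb Λ)).mul (h.continuous_ham_comb Λ).neg.rexp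
  refine continuous_iff_continuousAt.2 fun ξ₀ => ?_
  refine continuousAt_of_dominated
    (bound := fun σ => K * (exp (boundaryEnergy G I J Λ ξ₀ + 1) * b σ)) ?_ ?_ ?_ ?_
  · exact Eventually.of_forall fun ξ =>
      (hcont.comp (continuous_id.prodMk continuous_const)).aestronglyMeasurable
  · have hev : ∀ᶠ ξ in 𝓝 ξ₀, boundaryEnergy G I J Λ ξ < boundaryEnergy G I J Λ ξ₀ + 1 :=
      (continuous_boundaryEnergy Λ).continuousAt.eventually_lt continuousAt_const (by linarith)
    filter_upwards [hev] with ξ hξ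
    refine Eventually.of_forall fun σ => ?_
    rw [norm_mul, Real.norm_of_nonneg (exp_pos _).le, Real.norm_eq_abs]
    have hbσ : 0 ≤ b σ :=
      (pos_of_mul_pos_right ((exp_pos _).trans_le (hle ξ σ)) (exp_pos _).le).le
    refine mul_le_mul (hK _) ((hle ξ σ).trans ?_) (exp_pos _).le ((abs_nonneg _).trans (hK ξ))
    exact mul_le_mul_of_nonneg_right (exp_le_exp.2 hξ.le) hbσ
  · exact (hb.const_mul _).const_mul _
  · exact Eventually.of_forall fun σ =>
      (hcont.comp (continuous_const.prodMk continuous_id)).continuousAt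

/-- The local specification has the Feller property. -/
theorem exists_boundedContinuous_lintegral_gibbsKer (h : IsStableInteraction W P I J a c p q)
    (Λ : Finset V)
    (f : BoundedContinuousFunction (V → ℝ) ℝ≥0) :
    ∃ g : BoundedContinuousFunction (V → ℝ) ℝ≥0, ∀ ξ,
      ∫⁻ ω, f ω ∂gibbsKer G W P Λ ξ = g ξ := by
  have hfc : Continuous fun ω => (f ω : ℝ) := NNReal.continuous_coe.comp f.continuous
  obtain ⟨K, hK⟩ : ∃ K : ℝ≥0, ∀ ω, f ω ≤ K := ⟨nndist f 0, BoundedContinuousFunction.NNReal.upper_bound f⟩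
  have hK' : ∀ ω, |(f ω : ℝ)| ≤ K := fun ω => by
    rw [abs_of_nonneg (f ω).coe_nonneg]
    exact_mod_cast hK ω
  have hZ : Continuous (partZ G W P Λ) := by
    have := h.continuous_integral_comb (G := G) Λ (f := fun _ => (1 : ℝ)) continuous_const (K := 1)
      (by simp)
    simpa only [one_mul] using! this
  have hN := h.continuous_integral_comb (G := G) Λ hfc hK'
  set N : (V → ℝ) → ℝ := fun ξ =>
    ∫ σ : ↥Λ → ℝ, (f (comb Λ σ ξ) : ℝ) * exp (-ham G W P Λ (comb Λ σ ξ)) with hNdef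
  have key : ∀ ξ, ∫⁻ ω, f ω ∂gibbsKer G W P Λ ξ
      = ((N ξ / partZ G W P Λ ξ).toNNReal : ℝ≥0∞) := by
    intro ξ
    have hint : Integrable fun σ : ↥Λ → ℝ =>
        (f (comb Λ σ ξ) : ℝ) * exp (-ham G W P Λ (comb Λ σ ξ)) := by
      refine (h.integrable_exp_neg_ham (G := G) Λ ξ).bdd_mul (c := K) ?_
        (Eventually.of_forall fun σ => ?_)
      · exact (hfc.comp ((continuous_comb Λ).comp
          (continuous_id.prodMk continuous_const))).aestronglyMeasurable
      · simpa using hK' _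
    have hnum : ENNReal.ofReal (N ξ)
        = lebMarginal Λ (fun ω => (f ω : ℝ≥0∞) * boltzmann G W P Λ ω) ξ := by
      rw [hNdef]
      simp only
      rw [ofReal_integral_eq_lintegral_ofReal hint
        (Eventually.of_forall fun σ => mul_nonneg (f _).coe_nonneg (exp_pos _).le)]
      refine lintegral_congr fun σ => ?_
      rw [ENNReal.ofReal_mul (f _).coe_nonneg, ENNReal.ofReal_coe_nnreal]
      rfl
    rw [h.lintegral_gibbsKer Λ ξ (f := fun ω => (f ω : ℝ≥0∞))
        (f.continuous.measurable.coe_nnreal_ennreal), ← hnum, ← h.ofReal_partZ,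
      mul_comm, ← div_eq_mul_inv, ← ENNReal.ofReal_div_of_pos (h.partZ_pos Λ ξ)]
    rfl
  have hgc : Continuous fun ξ => (N ξ / partZ G W P Λ ξ).toNNReal :=
    continuous_real_toNNReal.comp (hN.div hZ fun ξ => (h.partZ_pos Λ ξ).ne')
  have hgb : ∀ ξ, (N ξ / partZ G W P Λ ξ).toNNReal ≤ K := fun ξ => by
    have := h.isProbabilityMeasure_gibbsKer (G := G) Λ ξ
    rw [← ENNReal.coe_le_coe, ← key ξ]
    calc ∫⁻ ω, f ω ∂gibbsKer G W P Λ ξ ≤ ∫⁻ _, (K : ℝ≥0∞) ∂gibbsKer G W P Λ ξ :=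
          lintegral_mono fun ω => ENNReal.coe_le_coe.2 (hK ω)
      _ = K := by simp
  refine ⟨BoundedContinuousFunction.mkOfBound ⟨_, hgc⟩ K fun ξ η => ?_, key⟩
  rw [NNReal.dist_eq, abs_le]
  have h1 : (((N ξ / partZ G W P Λ ξ).toNNReal : ℝ≥0) : ℝ) ≤ K := by exact_mod_cast hgb ξ
  have h2 : (((N η / partZ G W P Λ η).toNNReal : ℝ≥0) : ℝ) ≤ K := by exact_mod_cast hgb η
  constructor
  · exact (by linarith [NNReal.coe_nonneg (N ξ / partZ G W P Λ ξ).toNNReal] :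
      -(K : ℝ) ≤ ((N ξ / partZ G W P Λ ξ).toNNReal : ℝ) - ((N η / partZ G W P Λ η).toNNReal : ℝ))
  · exact (by linarith [NNReal.coe_nonneg (N η / partZ G W P Λ η).toNNReal] :
      ((N ξ / partZ G W P Λ ξ).toNNReal : ℝ) - ((N η / partZ G W P Λ η).toNNReal : ℝ) ≤ (K : ℝ))

end IsStableInteraction

end Kernel

section OneSite

variable {G : SimpleGraph V} [∀ v : V, Fintype (G.neighborSet v)]
  {W : ℝ → ℝ → ℝ} {P : ℝ → ℝ} {I J a c p q θ : ℝ}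

/-- The edge sum `m_θ(x) = Σ_{y∼x} [n(x)n(y)]^θ`. -/
def degreeSum (G : SimpleGraph V) [∀ v : V, Fintype (G.neighborSet v)] (θ : ℝ) (x : V) : ℝ :=
  ∑ y ∈ G.neighborFinset x, ((G.degree x : ℝ) * (G.degree y : ℝ)) ^ θ

theorem degreeSum_nonneg (θ : ℝ) (x : V) : 0 ≤ degreeSum G θ x :=
  Finset.sum_nonneg fun _ _ => Real.rpow_nonneg (by positivity) _

theorem one_le_degree_of_mem {x y : V} (hy : y ∈ G.neighborFinset x) : (1 : ℝ) ≤ G.degree y := by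
  have : 0 < G.degree y :=
    (G.degree_pos_iff_exists_adj _).2 ⟨x, ((G.mem_neighborFinset x y).1 hy).symm⟩
  exact_mod_cast this

theorem one_le_degree_of_mem' {x y : V} (hy : y ∈ G.neighborFinset x) :
    (1 : ℝ) ≤ G.degree x := by
  have : 0 < G.degree x :=
    (G.degree_pos_iff_exists_adj _).2 ⟨y, (G.mem_neighborFinset x y).1 hy⟩
  exact_mod_cast this

theorem degree_rpow_le_degreeSum (hθ : 0 < θ) (x : V) :
    (G.degree x : ℝ) ^ (θ + 1) ≤ degreeSum G θ x := by
  have h1 : (G.degree x : ℝ) ^ (θ + 1) = ∑ _y ∈ G.neighborFinset x, (G.degree x : ℝ) ^ θ := by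
    rw [Finset.sum_const, G.card_neighborFinset_eq_degree, nsmul_eq_mul,
      Real.rpow_add_one' (Nat.cast_nonneg _) (by linarith), mul_comm]
  rw [h1]
  refine Finset.sum_le_sum fun y hy => ?_
  refine Real.rpow_le_rpow (Nat.cast_nonneg _) ?_ hθ.le
  exact le_mul_of_one_le_right (Nat.cast_nonneg _) (one_le_degree_of_mem hy)

theorem degree_le_degreeSum (hθ : 0 < θ) (x : V) : (G.degree x : ℝ) ≤ degreeSum G θ x := by
  refine le_trans ?_ (degree_rpow_le_degreeSum hθ x)
  rcases Nat.eq_zero_or_pos (G.degree x) with h | h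
  · rw [h, Nat.cast_zero]
    exact Real.rpow_nonneg le_rfl _
  · have h1 : (1 : ℝ) ≤ G.degree x := by exact_mod_cast h
    exact Real.self_le_rpow_of_one_le h1 (by linarith)

theorem ham_singleton (x : V) (ξ : V → ℝ) (u : ℝ) :
    ham G W P {x} (Function.update ξ x u)
      = ∑ y ∈ G.neighborFinset x, W u (ξ y) + P u := by
  have hx : x ∉ G.neighborFinset x := by simp
  have h1 : G.neighborFinset x ∩ {x} = ∅ := by simp
  have h2 : G.neighborFinset x \ {x} = G.neighborFinset x := by simp
  simp only [ham, Finset.sum_singleton, h1, h2, Finset.sum_empty, zero_div, zero_add,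
    Function.update_self]
  congr 1
  refine Finset.sum_congr rfl fun y hy => ?_
  rw [Function.update_of_ne]
  rintro rfl
  exact hx hy

/-- The one-site conditional exponential moments are controlled by the neighbouring spins, with an
arbitrarily small constant in front of their `p`-th powers. -/
theorem IsStableInteraction.exists_one_site_bound
    (h : IsStableInteraction W P I J a c (2 + 2 / θ) q) (hθ : 0 < θ) (lam : ℝ) {κ : ℝ}
    (hκ : 0 < κ) :
    ∃ K₀ K₁ : ℝ, 0 ≤ K₀ ∧ 0 ≤ K₁ ∧ ∀ (x : V) (ξ : V → ℝ),
      ∫⁻ ω, ENNReal.ofReal (exp (lam * |ω x| ^ (2 + 2 / θ))) ∂gibbsKer G W P {x} ξ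
        ≤ ENNReal.ofReal (exp (K₀ + K₁ * degreeSum G θ x
          + κ * ∑ y ∈ G.neighborFinset x,
              |ξ y| ^ (2 + 2 / θ) / ((G.degree x : ℝ) * (G.degree y : ℝ)))) := by
  obtain ⟨C, hC⟩ := exists_add_sub_rpow_le h.a_pos h.two_le h.p_lt_q (|lam| + 1)
  obtain ⟨B, hB⟩ := (isCompact_Icc (a := (-1 : ℝ)) (b := 1)).exists_bound_of_continuousOn
    h.continuous_self.continuousOn
  have hI := h.I_nonneg
  have hJ := h.J_nonneg
  have hgauss : Integrable fun u : ℝ => exp (C + c - u ^ 2) := by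
    have := (integrable_exp_neg_mul_sq (b := 1) one_pos).const_mul (exp (C + c))
    refine this.congr (Filter.Eventually.of_forall fun u => ?_)
    simp only [← Real.exp_add]
    congr 1
    ring
  have hM0 : 0 < ∫ u : ℝ, exp (C + c - u ^ 2) := integral_exp_pos hgauss
  set M : ℝ := Real.log (∫ u : ℝ, exp (C + c - u ^ 2)) with hM
  refine ⟨|B| + |M|, I + J / 2 + (J / 2) ^ (θ + 1) + J ^ (θ + 1) * κ⁻¹ ^ θ, by positivity,
    by positivity, fun x ξ => ?_⟩
  set n : ℝ := (G.degree x : ℝ) with hn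
  have hn0 : 0 ≤ n := Nat.cast_nonneg _
  set S : ℝ := ∑ y ∈ G.neighborFinset x, ξ y ^ 2 with hS
  have hpair : ∀ u : ℝ, |∑ y ∈ G.neighborFinset x, W u (ξ y)|
      ≤ (I * n + J * S) / 2 + J / 2 * n * u ^ 2 := by
    intro u
    refine (Finset.abs_sum_le_sum_abs _ _).trans
      ((Finset.sum_le_sum fun y _ => h.abs_pair_le u (ξ y)).trans (le_of_eq ?_))
    rw [← Finset.sum_div, Finset.sum_add_distrib, ← Finset.mul_sum, Finset.sum_add_distrib,
      Finset.sum_const, Finset.sum_const, G.card_neighborFinset_eq_degree, nsmul_eq_mul,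
      nsmul_eq_mul, ← hS, ← hn]
    ring
  have hmeas : Measurable fun ω : V → ℝ => ENNReal.ofReal (exp (lam * |ω x| ^ (2 + 2 / θ))) := by
    fun_prop
  have hnum : lebMarginal {x} (fun ω => ENNReal.ofReal (exp (lam * |ω x| ^ (2 + 2 / θ)))
        * boltzmann G W P {x} ω) ξ
      ≤ ENNReal.ofReal (exp ((I * n + J * S) / 2 + (J / 2 * n) ^ (θ + 1) + M)) := by
    rw [lebMarginal, lmarginal_singleton]
    have hle : ∀ u : ℝ, ENNReal.ofReal (exp (lam * |Function.update ξ x u x| ^ (2 + 2 / θ)))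
          * boltzmann G W P {x} (Function.update ξ x u)
        ≤ ENNReal.ofReal (exp ((I * n + J * S) / 2 + (J / 2 * n) ^ (θ + 1)))
          * ENNReal.ofReal (exp (C + c - u ^ 2)) := by
      intro u
      rw [boltzmann, ham_singleton, Function.update_self, ← ENNReal.ofReal_mul (exp_pos _).le,
        ← ENNReal.ofReal_mul (exp_pos _).le, ← Real.exp_add, ← Real.exp_add]
      refine ENNReal.ofReal_le_ofReal (exp_le_exp.2 ?_)
      have h1 := (abs_le.1 (hpair u)).1
      have h2 := sq_mul_le hθ u (b := J / 2 * n) (by positivity)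
      have h3 := hC u
      have h4 := h.le_self u
      have h5 := Real.rpow_nonneg (abs_nonneg u) (2 + 2 / θ)
      nlinarith [mul_le_mul_of_nonneg_right (le_abs_self lam) h5,
        mul_nonneg (abs_nonneg lam) (sq_nonneg u), sq_nonneg u]
    refine (lintegral_mono hle).trans (le_of_eq ?_)
    rw [lintegral_const_mul _ (by fun_prop), ← ofReal_integral_eq_lintegral_ofReal hgauss
      (Eventually.of_forall fun _ => (exp_pos _).le), ← ENNReal.ofReal_mul (exp_pos _).le,
      Real.exp_add _ M, hM, Real.exp_log hM0]
  have hden : ENNReal.ofReal (exp (-((I * n + J * S) / 2 + J / 2 * n + B)))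
      ≤ lebMarginal {x} (boltzmann G W P {x}) ξ := by
    rw [lebMarginal, lmarginal_singleton]
    calc ENNReal.ofReal (exp (-((I * n + J * S) / 2 + J / 2 * n + B)))
        ≤ ENNReal.ofReal (exp (-((I * n + J * S) / 2 + J / 2 * n + B)))
            * volume (Set.Icc (-1 : ℝ) 1) := by
          rw [Real.volume_Icc]
          refine le_mul_of_one_le_right' ?_
          rw [ENNReal.one_le_ofReal]
          norm_num
      _ = ∫⁻ _ in Set.Icc (-1 : ℝ) 1,
            ENNReal.ofReal (exp (-((I * n + J * S) / 2 + J / 2 * n + B))) :=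
          (setLIntegral_const _ _).symm
      _ ≤ ∫⁻ u in Set.Icc (-1 : ℝ) 1, boltzmann G W P {x} (Function.update ξ x u) := by
          refine setLIntegral_mono' measurableSet_Icc fun u hu => ?_
          rw [boltzmann, ham_singleton]
          refine ENNReal.ofReal_le_ofReal (exp_le_exp.2 ?_)
          have h1 := (abs_le.1 (hpair u)).2
          have h2 := (abs_le.1 (hB u hu)).2
          have h3 : J / 2 * n * u ^ 2 ≤ J / 2 * n :=
            mul_le_of_le_one_right (by positivity) (by nlinarith [hu.1, hu.2])
          linarith
      _ ≤ _ := setLIntegral_le_lintegral _ _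
  have hJS : J * S ≤ κ * ∑ y ∈ G.neighborFinset x,
        |ξ y| ^ (2 + 2 / θ) / (n * (G.degree y : ℝ))
      + J ^ (θ + 1) * κ⁻¹ ^ θ * degreeSum G θ x := by
    rw [hS, degreeSum, Finset.mul_sum, Finset.mul_sum, Finset.mul_sum, ← Finset.sum_add_distrib]
    refine Finset.sum_le_sum fun y hy => ?_
    have hy1 := one_le_degree_of_mem hy
    have hx1 := one_le_degree_of_mem' hy
    have hnn : 0 < n * (G.degree y : ℝ) := by
      rw [hn]
      nlinarith
    refine (sq_mul_le_weighted hθ (ξ y) hJ (div_pos hκ hnn)).trans (le_of_eq ?_)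
    rw [inv_div, div_eq_inv_mul _ κ, Real.mul_rpow (inv_nonneg.2 hκ.le) hnn.le]
    ring
  have hd1 := degree_le_degreeSum (G := G) hθ x
  have hd2 : (J / 2 * n) ^ (θ + 1) ≤ (J / 2) ^ (θ + 1) * degreeSum G θ x := by
    rw [Real.mul_rpow (by positivity) hn0]
    exact mul_le_mul_of_nonneg_left (degree_rpow_le_degreeSum hθ x) (by positivity)
  rw [h.lintegral_gibbsKer _ _ hmeas]
  calc _ ≤ (ENNReal.ofReal (exp (-((I * n + J * S) / 2 + J / 2 * n + B))))⁻¹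
        * ENNReal.ofReal (exp ((I * n + J * S) / 2 + (J / 2 * n) ^ (θ + 1) + M)) :=
        mul_le_mul' (ENNReal.inv_le_inv.2 hden) hnum
    _ = ENNReal.ofReal (exp (((I * n + J * S) / 2 + J / 2 * n + B)
        + ((I * n + J * S) / 2 + (J / 2 * n) ^ (θ + 1) + M))) := by
        rw [← ENNReal.ofReal_inv_of_pos (exp_pos _), ← Real.exp_neg, neg_neg,
          ← ENNReal.ofReal_mul (exp_pos _).le, ← Real.exp_add]
    _ ≤ _ := by
        refine ENNReal.ofReal_le_ofReal (exp_le_exp.2 ?_)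
        have h1 := mul_le_mul_of_nonneg_left hd1 hI
        have h2 := mul_le_mul_of_nonneg_left hd1 (div_nonneg hJ zero_le_two)
        linarith [le_abs_self B, le_abs_self M]

end OneSite

theorem wgt_pos {G : SimpleGraph V} {o : V} {α : ℝ} (x : V) : 0 < wgt G o α x := exp_pos _

section Moments

variable {G : SimpleGraph V} [∀ v : V, Fintype (G.neighborSet v)]
  {W : ℝ → ℝ → ℝ} {P : ℝ → ℝ} {I J a c p q θ α : ℝ} {o : V}

theorem wgt_le_of_mem (hconn : G.Connected) (hα : 0 < α) {x y : V}
    (hy : y ∈ G.neighborFinset x) : wgt G o α x ≤ exp α * wgt G o α y := by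
  rw [wgt, wgt, ← Real.exp_add, exp_le_exp]
  have hadj : G.Adj y x := ((G.mem_neighborFinset x y).1 hy).symm
  have h1 : G.dist o y ≤ G.dist o x + G.dist x y := hconn.dist_triangle
  rw [SimpleGraph.dist_eq_one_iff_adj.2 hadj.symm] at h1
  have h2 : (G.dist o y : ℝ) ≤ G.dist o x + 1 := by exact_mod_cast h1
  nlinarith

theorem summable_wgt (hconn : G.Connected) (hθ : 0 < θ) (hΘ : ThetaFin G o α θ) :
    Summable (wgt G o α) := by
  rcases subsingleton_or_nontrivial V with hV | hV
  · have := Fintype.ofFinite V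
    exact (hasSum_fintype _).summable
  · refine Summable.of_nonneg_of_le (fun x => (wgt_pos x).le) (fun x => ?_) hΘ
    refine le_mul_of_one_le_left (wgt_pos x).le ?_
    refine le_trans ?_ (degree_le_degreeSum hθ x)
    exact_mod_cast hconn.preconnected.degree_pos_of_nontrivial x

/-- Double counting of edges: transporting a mass from each vertex to its neighbours with rates
`1 / (n(x) n(y))` does not increase the total mass. -/
theorem sum_sum_div_degree_le {F : V → ℝ} (hF0 : ∀ x, 0 ≤ F x) (hF : Summable F) (Λ : Finset V) :
    ∑ x ∈ Λ, ∑ y ∈ G.neighborFinset x, F y / ((G.degree x : ℝ) * (G.degree y : ℝ))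
      ≤ ∑' x, F x := by
  classical
  set Γ : Finset V := Λ.biUnion fun x => G.neighborFinset x with hΓ
  have h1 : ∀ x ∈ Λ, ∑ y ∈ G.neighborFinset x, F y / ((G.degree x : ℝ) * (G.degree y : ℝ))
      = ∑ y ∈ Γ, if G.Adj x y then F y / ((G.degree x : ℝ) * (G.degree y : ℝ)) else 0 := by
    intro x hx
    rw [← Finset.sum_filter]
    refine Finset.sum_congr ?_ fun _ _ => rfl
    ext y
    simp only [hΓ, SimpleGraph.mem_neighborFinset, Finset.mem_filter, Finset.mem_biUnion]
    exact ⟨fun hy => ⟨⟨x, hx, hy⟩, hy⟩, fun hy => hy.2⟩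
  rw [Finset.sum_congr rfl h1, Finset.sum_comm]
  refine le_trans (Finset.sum_le_sum fun y _ => ?_) (hF.sum_le_tsum Γ fun x _ => hF0 x)
  calc ∑ x ∈ Λ, (if G.Adj x y then F y / ((G.degree x : ℝ) * (G.degree y : ℝ)) else 0)
      ≤ ∑ _x ∈ G.neighborFinset y, F y / (G.degree y : ℝ) := by
        rw [← Finset.sum_filter]
        have hsub : Λ.filter (fun x => G.Adj x y) ⊆ G.neighborFinset y := fun x hx => by
          rw [SimpleGraph.mem_neighborFinset]
          exact (Finset.mem_filter.1 hx).2.symm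
        refine le_trans (Finset.sum_le_sum fun x hx => ?_)
          (Finset.sum_le_sum_of_subset_of_nonneg hsub fun x _ _ =>
            div_nonneg (hF0 y) (Nat.cast_nonneg _))
        have hx1 := one_le_degree_of_mem (hsub hx)
        have hy1 := one_le_degree_of_mem' (hsub hx)
        refine div_le_div_of_nonneg_left (hF0 y) (by linarith) ?_
        exact le_mul_of_one_le_left (by linarith) hx1
    _ ≤ F y := by
        rw [Finset.sum_const, G.card_neighborFinset_eq_degree, nsmul_eq_mul]
        rcases Nat.eq_zero_or_pos (G.degree y) with h | h
        · simp [h, hF0 y]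
        · have : (G.degree y : ℝ) ≠ 0 := by exact_mod_cast h.ne'
          rw [mul_div_cancel₀ _ this]

/-- Resolution of the recursive inequality between the local moments. -/
theorem tsum_le_of_recursion (hconn : G.Connected) (hα : 0 < α) {Λ : Finset V} {n k : V → ℝ}
    (hn0 : ∀ x, 0 ≤ n x) (hn : Summable fun x => n x * wgt G o α x)
    (hk0 : ∀ x, 0 ≤ k x) (hk : Summable fun x => k x * wgt G o α x)
    (hrec : ∀ x ∈ Λ, n x ≤ k x + exp (-α) / 2 * ∑ y ∈ G.neighborFinset x,
      n y / ((G.degree x : ℝ) * (G.degree y : ℝ))) :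
    ∑' x, n x * wgt G o α x
      ≤ 2 * ∑' x, k x * wgt G o α x + 2 * ∑' x : {x // x ∉ Λ}, n x * wgt G o α x := by
  have hF0 : ∀ x, 0 ≤ n x * wgt G o α x := fun x => mul_nonneg (hn0 x) (wgt_pos x).le
  have h1 : ∑ x ∈ Λ, n x * wgt G o α x
      ≤ ∑' x, k x * wgt G o α x + 1 / 2 * ∑' x, n x * wgt G o α x := by
    calc ∑ x ∈ Λ, n x * wgt G o α x
        ≤ ∑ x ∈ Λ, (k x * wgt G o α x + 1 / 2 * ∑ y ∈ G.neighborFinset x,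
            n y * wgt G o α y / ((G.degree x : ℝ) * (G.degree y : ℝ))) := by
          refine Finset.sum_le_sum fun x hx => ?_
          refine (mul_le_mul_of_nonneg_right (hrec x hx) (wgt_pos x).le).trans ?_
          rw [add_mul, mul_assoc, Finset.sum_mul, Finset.mul_sum, Finset.mul_sum]
          refine add_le_add le_rfl (Finset.sum_le_sum fun y hy => ?_)
          have h2 := wgt_le_of_mem (o := o) hconn hα hy
          have h3 : 0 ≤ n y / ((G.degree x : ℝ) * (G.degree y : ℝ)) :=
            div_nonneg (hn0 y) (by positivity)
          calc exp (-α) / 2 * (n y / ((G.degree x : ℝ) * (G.degree y : ℝ)) * wgt G o α x)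
              ≤ exp (-α) / 2 * (n y / ((G.degree x : ℝ) * (G.degree y : ℝ))
                  * (exp α * wgt G o α y)) := by gcongr
            _ = (exp (-α) * exp α) / 2
                  * (n y * wgt G o α y / ((G.degree x : ℝ) * (G.degree y : ℝ))) := by ring
            _ = _ := by rw [← Real.exp_add, neg_add_cancel, Real.exp_zero]
      _ ≤ _ := by
          rw [Finset.sum_add_distrib, ← Finset.mul_sum]
          have h2 := sum_sum_div_degree_le (G := G) hF0 hn Λ
          have h3 := hk.sum_le_tsum Λ fun x _ => mul_nonneg (hk0 x) (wgt_pos x).le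
          linarith
  have h2 : ∑ x ∈ Λ, n x * wgt G o α x + ∑' x : {x // x ∉ Λ}, n x * wgt G o α x
      = ∑' x, n x * wgt G o α x := hn.sum_add_tsum_compl
  linarith

/-- Hölder's inequality for a probability measure and exponents summing to at most one. -/
theorem lintegral_prod_rpow_le {Ω ι : Type*} [MeasurableSpace Ω] (μ : Measure Ω)
    [IsProbabilityMeasure μ] (s : Finset ι) {f : ι → Ω → ℝ≥0∞}
    (hf : ∀ i ∈ s, AEMeasurable (f i) μ) {r : ι → ℝ} (hr : ∀ i ∈ s, 0 ≤ r i)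
    (hr1 : ∑ i ∈ s, r i ≤ 1) :
    ∫⁻ ω, ∏ i ∈ s, f i ω ^ r i ∂μ ≤ ∏ i ∈ s, (∫⁻ ω, f i ω ∂μ) ^ r i := by
  simpa using ENNReal.lintegral_mul_prod_norm_pow_le s (g := fun _ => 1) aemeasurable_const hf
    (1 - ∑ i ∈ s, r i) (sub_add_cancel _ _) (sub_nonneg.2 hr1) hr

theorem prod_ofReal_exp_rpow {ι : Type*} (s : Finset ι) (f r : ι → ℝ) :
    ∏ i ∈ s, ENNReal.ofReal (exp (f i)) ^ r i
      = ENNReal.ofReal (exp (∑ i ∈ s, r i * f i)) := by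
  rw [Real.exp_sum, ENNReal.ofReal_prod_of_nonneg fun _ _ => (exp_pos _).le]
  refine Finset.prod_congr rfl fun i _ => ?_
  rw [ENNReal.ofReal_rpow_of_pos (exp_pos _), ← Real.exp_mul, mul_comm]

theorem measurable_ofReal_exp_mul (lam p : ℝ) (x : V) :
    Measurable fun ω : V → ℝ => ENNReal.ofReal (exp (lam * |ω x| ^ p)) := by
  fun_prop

/-- The logarithm of the exponential moment of the spin at `x` under `π_Λ(·|ξ)`. -/
def logMoment (G : SimpleGraph V) [∀ v : V, Fintype (G.neighborSet v)] (W : ℝ → ℝ → ℝ)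
    (P : ℝ → ℝ) (p lam : ℝ) (Λ : Finset V) (ξ : V → ℝ) (x : V) : ℝ :=
  Real.log (∫⁻ ω, ENNReal.ofReal (exp (lam * |ω x| ^ p)) ∂gibbsKer G W P Λ ξ).toReal

theorem sum_div_degree_le_one (x : V) :
    ∑ y ∈ G.neighborFinset x, 1 / ((G.degree x : ℝ) * (G.degree y : ℝ)) ≤ 1 := by
  calc ∑ y ∈ G.neighborFinset x, 1 / ((G.degree x : ℝ) * (G.degree y : ℝ))
      ≤ ∑ _y ∈ G.neighborFinset x, 1 / (G.degree x : ℝ) := by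
        refine Finset.sum_le_sum fun y hy => ?_
        have hx1 := one_le_degree_of_mem' hy
        have hy1 := one_le_degree_of_mem hy
        exact div_le_div_of_nonneg_left zero_le_one (by linarith)
          (le_mul_of_one_le_right (by linarith) hy1)
    _ ≤ 1 := by
        rw [Finset.sum_const, G.card_neighborFinset_eq_degree, nsmul_eq_mul, mul_one_div]
        exact div_self_le_one _

namespace IsStableInteraction

variable {lam : ℝ}

theorem lintegral_exp_ne_top (h : IsStableInteraction W P I J a c p q) (hlam : 0 ≤ lam)
    (Λ : Finset V) (ξ : V → ℝ) (x : V) :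
    ∫⁻ ω, ENNReal.ofReal (exp (lam * |ω x| ^ p)) ∂gibbsKer G W P Λ ξ ≠ ∞ := by
  by_cases hx : x ∈ Λ
  · obtain ⟨b, hb, hle⟩ := h.exists_integrable_majorant (G := G) Λ lam
    rw [h.lintegral_gibbsKer Λ ξ (measurable_ofReal_exp_mul lam p x)]
    refine ENNReal.mul_ne_top (ENNReal.inv_ne_top.2 (h.lebMarginal_boltzmann_ne_zero Λ ξ))
      (ne_top_of_le_ne_top (hb.const_mul (exp (boundaryEnergy G I J Λ ξ))).lintegral_lt_top.ne ?_)
    rw [lebMarginal_apply]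
    refine lintegral_mono fun σ => ?_
    simp only [boltzmann]
    rw [← ENNReal.ofReal_mul (exp_pos _).le, ← Real.exp_add]
    refine ENNReal.ofReal_le_ofReal (le_trans (exp_le_exp.2 ?_) (hle ξ σ))
    rw [comb_apply_mem σ ξ ⟨x, hx⟩, ← sub_eq_add_neg]
    refine sub_le_sub_right (mul_le_mul_of_nonneg_left ?_ hlam) _
    exact Finset.single_le_sum (f := fun z : ↥Λ => |σ z| ^ p)
      (fun _ _ => Real.rpow_nonneg (abs_nonneg _) _) (Finset.mem_univ _)
  · rw [h.lintegral_gibbsKer_of_eq_off Λ ξ (measurable_ofReal_exp_mul lam p x)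
      fun ω ω' hω => by rw [hω x hx]]
    exact ENNReal.ofReal_ne_top

theorem one_le_lintegral_exp (h : IsStableInteraction W P I J a c p q) (hlam : 0 ≤ lam)
    (Λ : Finset V) (ξ : V → ℝ) (x : V) :
    1 ≤ ∫⁻ ω, ENNReal.ofReal (exp (lam * |ω x| ^ p)) ∂gibbsKer G W P Λ ξ := by
  have := h.isProbabilityMeasure_gibbsKer (G := G) Λ ξ
  calc (1 : ℝ≥0∞) = ∫⁻ _, 1 ∂gibbsKer G W P Λ ξ := by simp
    _ ≤ _ := lintegral_mono fun ω => by
      rw [ENNReal.one_le_ofReal]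
      exact Real.one_le_exp (mul_nonneg hlam (Real.rpow_nonneg (abs_nonneg _) _))

theorem logMoment_nonneg (h : IsStableInteraction W P I J a c p q) (hlam : 0 ≤ lam)
    (Λ : Finset V) (ξ : V → ℝ) (x : V) : 0 ≤ logMoment G W P p lam Λ ξ x := by
  refine Real.log_nonneg ?_
  have h1 := ENNReal.toReal_mono (h.lintegral_exp_ne_top (G := G) hlam Λ ξ x)
    (h.one_le_lintegral_exp hlam Λ ξ x)
  simpa using h1

theorem lintegral_exp_eq (h : IsStableInteraction W P I J a c p q) (hlam : 0 ≤ lam)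
    (Λ : Finset V) (ξ : V → ℝ) (x : V) :
    ∫⁻ ω, ENNReal.ofReal (exp (lam * |ω x| ^ p)) ∂gibbsKer G W P Λ ξ
      = ENNReal.ofReal (exp (logMoment G W P p lam Λ ξ x)) := by
  have h1 := h.lintegral_exp_ne_top (G := G) hlam Λ ξ x
  have h2 := h.one_le_lintegral_exp (G := G) hlam Λ ξ x
  rw [logMoment, Real.exp_log (ENNReal.toReal_pos (zero_lt_one.trans_le h2).ne' h1),
    ENNReal.ofReal_toReal h1]

theorem logMoment_of_notMem (h : IsStableInteraction W P I J a c p q)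
    {Λ : Finset V} (ξ : V → ℝ) {x : V} (hx : x ∉ Λ) :
    logMoment G W P p lam Λ ξ x = lam * |ξ x| ^ p := by
  rw [logMoment, h.lintegral_gibbsKer_of_eq_off Λ ξ (measurable_ofReal_exp_mul lam p x)
      fun ω ω' hω => by rw [hω x hx], ENNReal.toReal_ofReal (exp_pos _).le, Real.log_exp]

/-- The recursive inequality between the logarithmic moments. -/
theorem exists_logMoment_le (h : IsStableInteraction W P I J a c (2 + 2 / θ) q) (hθ : 0 < θ)
    (hα : 0 < α) (hlam : 0 < lam) :
    ∃ K₀ K₁ : ℝ, 0 ≤ K₀ ∧ 0 ≤ K₁ ∧ ∀ (Λ : Finset V) (ξ : V → ℝ), ∀ x ∈ Λ,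
      logMoment G W P (2 + 2 / θ) lam Λ ξ x ≤ K₀ + K₁ * degreeSum G θ x
        + exp (-α) / 2 * ∑ y ∈ G.neighborFinset x,
          logMoment G W P (2 + 2 / θ) lam Λ ξ y / ((G.degree x : ℝ) * (G.degree y : ℝ)) := by
  set δ : ℝ := exp (-α) / 2 with hδ
  have hδ0 : 0 < δ := half_pos (exp_pos _)
  have hδ1 : δ ≤ 1 := by
    have : exp (-α) ≤ 1 := Real.exp_le_one_iff.2 (by linarith)
    linarith
  obtain ⟨K₀, K₁, hK₀, hK₁, hK⟩ := h.exists_one_site_bound (G := G) hθ lam (mul_pos hδ0 hlam)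
  refine ⟨K₀, K₁, hK₀, hK₁, fun Λ ξ x hx => ?_⟩
  have := h.isProbabilityMeasure_gibbsKer (G := G) Λ ξ
  set r : V → ℝ := fun y => δ * (1 / ((G.degree x : ℝ) * (G.degree y : ℝ))) with hr
  have hr0 : ∀ y, 0 ≤ r y := fun y => by positivity
  have hr1 : ∑ y ∈ G.neighborFinset x, r y ≤ 1 := by
    rw [hr, ← Finset.mul_sum]
    exact mul_le_one₀ hδ1 (Finset.sum_nonneg fun y _ => by positivity) (sum_div_degree_le_one x)
  have hb : ∀ ω : V → ℝ, ENNReal.ofReal (exp (K₀ + K₁ * degreeSum G θ x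
        + δ * lam * ∑ y ∈ G.neighborFinset x,
            |ω y| ^ (2 + 2 / θ) / ((G.degree x : ℝ) * (G.degree y : ℝ))))
      = ENNReal.ofReal (exp (K₀ + K₁ * degreeSum G θ x)) * ∏ y ∈ G.neighborFinset x,
          ENNReal.ofReal (exp (lam * |ω y| ^ (2 + 2 / θ))) ^ r y := fun ω => by
    rw [prod_ofReal_exp_rpow, ← ENNReal.ofReal_mul (exp_pos _).le, ← Real.exp_add,
      Finset.mul_sum]
    congr 3
    refine Finset.sum_congr rfl fun y _ => ?_
    simp only [hr]
    ring
  have key : ENNReal.ofReal (exp (logMoment G W P (2 + 2 / θ) lam Λ ξ x))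
      ≤ ENNReal.ofReal (exp (K₀ + K₁ * degreeSum G θ x
        + ∑ y ∈ G.neighborFinset x, r y * logMoment G W P (2 + 2 / θ) lam Λ ξ y)) := by
    rw [← h.lintegral_exp_eq hlam.le, ← h.lintegral_lintegral_gibbsKer
      (Finset.singleton_subset_iff.2 hx) ξ (measurable_ofReal_exp_mul lam _ x)]
    refine (lintegral_mono fun ω => hK x ω).trans ?_
    simp only [hb]
    rw [lintegral_const_mul _ (by fun_prop), Real.exp_add (K₀ + K₁ * degreeSum G θ x), ENNReal.ofReal_mul (exp_pos _).le,
      ← prod_ofReal_exp_rpow]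
    refine mul_le_mul_right ((lintegral_prod_rpow_le _ _
      (fun y _ => (measurable_ofReal_exp_mul lam _ y).aemeasurable)
      (fun y _ => hr0 y) hr1).trans (le_of_eq ?_)) _
    refine Finset.prod_congr rfl fun y _ => ?_
    rw [h.lintegral_exp_eq hlam.le]
  rw [ENNReal.ofReal_le_ofReal_iff (exp_pos _).le, exp_le_exp] at key
  refine key.trans (le_of_eq ?_)
  rw [Finset.mul_sum]
  congr 1
  refine Finset.sum_congr rfl fun y _ => ?_
  simp only [hr]
  ring

/-- Exponential moments of the weighted norm under the local specification. -/
theorem exists_exp_moment_bound (h : IsStableInteraction W P I J a c (2 + 2 / θ) q)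
    (hconn : G.Connected) (hα : 0 < α) (hθ : 0 < θ) (hΘ : ThetaFin G o α θ) (hlam : 0 < lam) :
    ∃ A : ℝ, ∀ (Λ Δ : Finset V), ∀ ξ ∈ tempered G o (2 + 2 / θ) α,
      ∫⁻ ω, ENNReal.ofReal (exp (lam * ∑ x ∈ Δ, |ω x| ^ (2 + 2 / θ) * wgt G o α x))
          ∂gibbsKer G W P Λ ξ
        ≤ ENNReal.ofReal (exp (A
          + 2 * lam * ∑' x : {x // x ∉ Λ}, |ξ x| ^ (2 + 2 / θ) * wgt G o α x)) := by
  have hw := summable_wgt (o := o) hconn hθ hΘ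
  set S : ℝ := ∑' x, wgt G o α x with hS
  have hS0 : 0 < S := hw.tsum_pos (fun x => (wgt_pos x).le) o (wgt_pos o)
  have hl : 0 < lam * S := mul_pos hlam hS0
  obtain ⟨K₀, K₁, hK₀, hK₁, hK⟩ := h.exists_logMoment_le (G := G) hθ hα hl
  have hk : Summable fun x => (K₀ + K₁ * degreeSum G θ x) * wgt G o α x := by
    simp only [add_mul, mul_assoc]
    exact (hw.mul_left K₀).add (hΘ.mul_left K₁)
  refine ⟨2 * (∑' x, (K₀ + K₁ * degreeSum G θ x) * wgt G o α x) / S, fun Λ Δ ξ hξ => ?_⟩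
  have := h.isProbabilityMeasure_gibbsKer (G := G) Λ ξ
  set n := logMoment G W P (2 + 2 / θ) (lam * S) Λ ξ with hn
  have hn0 : ∀ x, 0 ≤ n x := h.logMoment_nonneg hl.le Λ ξ
  have hnoff : ∀ x ∉ Λ, n x = lam * S * |ξ x| ^ (2 + 2 / θ) := fun x hx =>
    h.logMoment_of_notMem ξ hx
  have hnsum : Summable fun x => n x * wgt G o α x := by
    have h1 : Summable fun x => lam * S * (|ξ x| ^ (2 + 2 / θ) * wgt G o α x) :=
      Summable.mul_left _ hξ
    refine h1.congr_cofinite ?_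
    filter_upwards [Λ.finite_toSet.compl_mem_cofinite] with x hx
    rw [hnoff x hx]
    ring
  have hbound := tsum_le_of_recursion (o := o) (k := fun x => K₀ + K₁ * degreeSum G θ x) hconn hα
    hn0 hnsum (fun x => add_nonneg hK₀ (mul_nonneg hK₁ (degreeSum_nonneg θ x))) hk
    fun x hx => hK Λ ξ x hx
  have htail : ∑' x : {x // x ∉ Λ}, n x * wgt G o α x
      = lam * S * ∑' x : {x // x ∉ Λ}, |ξ x| ^ (2 + 2 / θ) * wgt G o α x := by
    rw [← tsum_mul_left]
    refine tsum_congr fun x => ?_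
    rw [hnoff x x.2]
    ring
  have hΔ := hnsum.sum_le_tsum Δ fun x _ => mul_nonneg (hn0 x) (wgt_pos x).le
  calc ∫⁻ ω, ENNReal.ofReal (exp (lam * ∑ x ∈ Δ, |ω x| ^ (2 + 2 / θ) * wgt G o α x))
          ∂gibbsKer G W P Λ ξ
      = ∫⁻ ω, ∏ x ∈ Δ, ENNReal.ofReal (exp (lam * S * |ω x| ^ (2 + 2 / θ)))
          ^ (wgt G o α x / S) ∂gibbsKer G W P Λ ξ := by
        refine lintegral_congr fun ω => ?_
        rw [prod_ofReal_exp_rpow, Finset.mul_sum]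
        congr 2
        refine Finset.sum_congr rfl fun x _ => ?_
        field_simp
    _ ≤ ∏ x ∈ Δ, ENNReal.ofReal (exp (n x)) ^ (wgt G o α x / S) := by
        refine (lintegral_prod_rpow_le _ _
          (fun x _ => (measurable_ofReal_exp_mul (lam * S) _ x).aemeasurable)
          (fun x _ => div_nonneg (wgt_pos x).le hS0.le) ?_).trans (le_of_eq ?_)
        · rw [← Finset.sum_div, div_le_one hS0]
          exact hw.sum_le_tsum Δ fun x _ => (wgt_pos x).le
        · refine Finset.prod_congr rfl fun x _ => ?_
          rw [h.lintegral_exp_eq hl.le]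
    _ ≤ _ := by
        rw [prod_ofReal_exp_rpow]
        refine ENNReal.ofReal_le_ofReal (exp_le_exp.2 ?_)
        calc ∑ x ∈ Δ, wgt G o α x / S * n x = (∑ x ∈ Δ, n x * wgt G o α x) / S := by
              rw [Finset.sum_div]
              exact Finset.sum_congr rfl fun x _ => by ring
          _ ≤ _ := by
              rw [div_le_iff₀ hS0, add_mul, div_mul_cancel₀ _ hS0.ne']
              rw [htail] at hbound
              linarith

end IsStableInteraction

end Moments

section Tempered

variable {G : SimpleGraph V} {p α : ℝ} {o : V}

/-- The partial sum over `Δ` of the series defining `‖ω‖_{p,α}^p`. -/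
def partialNorm (G : SimpleGraph V) (o : V) (p α : ℝ) (Δ : Finset V) (ω : V → ℝ) : ℝ :=
  ∑ x ∈ Δ, |ω x| ^ p * wgt G o α x

/-- The configurations with `‖ω‖_{p,α}^p ≤ R`. -/
def normBall (G : SimpleGraph V) (o : V) (p α R : ℝ) : Set (V → ℝ) :=
  {ω | ∀ Δ, partialNorm G o p α Δ ω ≤ R}

theorem rpow_mul_wgt_nonneg (ω : V → ℝ) (x : V) : 0 ≤ |ω x| ^ p * wgt G o α x :=
  mul_nonneg (Real.rpow_nonneg (abs_nonneg _) _) (wgt_pos x).le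

theorem measurable_partialNorm (Δ : Finset V) : Measurable (partialNorm G o p α Δ) := by
  unfold partialNorm
  fun_prop

theorem continuous_partialNorm (hp : 0 ≤ p) (Δ : Finset V) :
    Continuous (partialNorm G o p α Δ) := by
  refine continuous_finsetSum _ fun x _ => Continuous.mul ?_ continuous_const
  exact (continuous_apply x).abs.rpow_const fun _ => Or.inr hp

theorem partialNorm_mono (ω : V → ℝ) : Monotone fun Δ => partialNorm G o p α Δ ω :=
  fun _ _ h => Finset.sum_le_sum_of_subset_of_nonneg h fun x _ _ => rpow_mul_wgt_nonneg ω x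

theorem normBall_mono {R R' : ℝ} (h : R ≤ R') : normBall G o p α R ⊆ normBall G o p α R' :=
  fun _ hω Δ => (hω Δ).trans h

theorem normBall_subset_tempered (R : ℝ) : normBall G o p α R ⊆ tempered G o p α :=
  fun ω hω => summable_of_sum_le (rpow_mul_wgt_nonneg ω) hω

theorem partialNorm_le_sNorm {ω : V → ℝ} (hω : ω ∈ tempered G o p α) (Δ : Finset V) :
    partialNorm G o p α Δ ω ≤ sNorm G o p α ω :=
  Summable.sum_le_tsum Δ (fun x _ => rpow_mul_wgt_nonneg ω x) hω

theorem tempered_eq_iUnion : tempered G o p α = ⋃ n : ℕ, normBall G o p α n := by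
  refine Set.Subset.antisymm (fun ω hω => ?_) (Set.iUnion_subset fun n =>
    normBall_subset_tempered n)
  obtain ⟨n, hn⟩ := exists_nat_ge (sNorm G o p α ω)
  exact Set.mem_iUnion.2 ⟨n, fun Δ => (partialNorm_le_sNorm hω Δ).trans hn⟩

theorem measurableSet_normBall (R : ℝ) : MeasurableSet (normBall G o p α R) := by
  simp only [normBall, Set.ofPred_forall]
  exact MeasurableSet.iInter fun Δ => measurableSet_le (measurable_partialNorm Δ) measurable_const

theorem measurableSet_tempered : MeasurableSet (tempered G o p α) := by
  rw [tempered_eq_iUnion]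
  exact MeasurableSet.iUnion fun n => measurableSet_normBall n

theorem isCompact_normBall (hp : 0 < p) (R : ℝ) : IsCompact (normBall G o p α R) := by
  have hbox : IsCompact (Set.univ.pi fun x : V =>
      Set.Icc (-(R / wgt G o α x) ^ p⁻¹) ((R / wgt G o α x) ^ p⁻¹)) :=
    isCompact_univ_pi fun x => isCompact_Icc
  refine hbox.of_isClosed_subset ?_ fun ω hω x _ => ?_
  · simp only [normBall, Set.ofPred_forall]
    exact isClosed_iInter fun Δ => isClosed_le (continuous_partialNorm hp.le Δ) continuous_const
  · have h1 : |ω x| ^ p * wgt G o α x ≤ R := by simpa [partialNorm] using hω {x}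
    have h2 : |ω x| ^ p ≤ R / wgt G o α x := (le_div_iff₀ (wgt_pos x)).2 h1
    have h3 : 0 ≤ R / wgt G o α x := (Real.rpow_nonneg (abs_nonneg _) _).trans h2
    exact abs_le.1 ((Real.le_rpow_inv_iff_of_pos (abs_nonneg _) h3 hp).2 h2)

/-- A uniformly tight set of probability measures carried by tempered configurations. -/
def tightSet (G : SimpleGraph V) (o : V) (p α : ℝ) (C : ℝ≥0) :
    Set (ProbabilityMeasure (V → ℝ)) :=
  {ν | ∀ m : ℕ, ν (normBall G o p α (m + 1))ᶜ ≤ C / (m + 1)}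

theorem tendsto_div_add_one (C : ℝ≥0) :
    Tendsto (fun m : ℕ => C / ((m : ℝ≥0) + 1)) atTop (𝓝 0) := by
  have h := (tendsto_const_div_atTop_nhds_zero_nat (C : ℝ)).comp (tendsto_add_atTop_nat 1)
  rw [← NNReal.tendsto_coe]
  refine h.congr fun m => ?_
  simp

theorem isCompact_tightSet (hp : 0 < p) (C : ℝ≥0) : IsCompact (tightSet G o p α C) := by
  refine isCompact_setOfPred_probabilityMeasure_mass_eq_compl_isCompact_le (tendsto_div_add_one C)
    (fun m => isCompact_normBall hp _) (Or.inr fun m n hmn => normBall_mono ?_)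
  have : (m : ℝ) ≤ n := by exact_mod_cast hmn
  linarith

theorem mem_tightSet {C : ℝ≥0} {ν : ProbabilityMeasure (V → ℝ)}
    (hν : ∀ Δ, ∫⁻ ω, ENNReal.ofReal (exp (partialNorm G o p α Δ ω)) ∂ν.toMeasure ≤ C) :
    ν ∈ tightSet G o p α C := by
  intro m
  have hm : (0 : ℝ) < m + 1 := by positivity
  have hcompl : (normBall G o p α (m + 1))ᶜ
      = ⋃ Δ : Finset V, {ω | (m : ℝ) + 1 < partialNorm G o p α Δ ω} := by
    ext ω
    simp [normBall]
  have hdir : Directed (· ⊆ ·) fun Δ : Finset V =>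
      {ω : V → ℝ | (m : ℝ) + 1 < partialNorm G o p α Δ ω} :=
    Monotone.directed_le fun Δ Δ' h ω hω => lt_of_lt_of_le hω (partialNorm_mono ω h)
  rw [← ENNReal.coe_le_coe, ProbabilityMeasure.ennreal_coeFn_eq_coeFn_toMeasure, hcompl,
    hdir.measure_iUnion]
  refine iSup_le fun Δ => ?_
  have hsub : {ω : V → ℝ | (m : ℝ) + 1 < partialNorm G o p α Δ ω}
      ⊆ {ω | ENNReal.ofReal (m + 1) ≤ ENNReal.ofReal (exp (partialNorm G o p α Δ ω))} := by
    intro ω hω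
    have hm' : (m : ℝ) + 1 < partialNorm G o p α Δ ω := hω
    refine ENNReal.ofReal_le_ofReal ?_
    linarith [Real.add_one_le_exp (partialNorm G o p α Δ ω)]
  refine (measure_mono hsub).trans ((meas_ge_le_lintegral_div
    (measurable_partialNorm Δ).exp.ennreal_ofReal.aemeasurable
    (ENNReal.ofReal_pos.2 hm).ne' ENNReal.ofReal_ne_top).trans ?_)
  refine (ENNReal.div_le_div_right (hν Δ) _).trans (le_of_eq ?_)
  rw [ENNReal.coe_div (by positivity)]
  congr 1
  rw [ENNReal.ofReal_add (by positivity) zero_le_one]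
  simp

theorem measure_tempered_of_mem_tightSet {C : ℝ≥0} {ν : ProbabilityMeasure (V → ℝ)}
    (hν : ν ∈ tightSet G o p α C) : ν.toMeasure (tempered G o p α) = 1 := by
  rw [← prob_compl_eq_zero_iff measurableSet_tempered,
    ← ProbabilityMeasure.ennreal_coeFn_eq_coeFn_toMeasure, ENNReal.coe_eq_zero]
  refine le_antisymm (ge_of_tendsto' (tendsto_div_add_one C) fun m => ?_) zero_le
  exact (ν.apply_mono (Set.compl_subset_compl.2 (normBall_subset_tempered _))).trans (hν m)

end Tempered

section GibbsMeasures

variable {G : SimpleGraph V} [∀ v : V, Fintype (G.neighborSet v)]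
  {W : ℝ → ℝ → ℝ} {P : ℝ → ℝ} {I J a c p q θ α lam : ℝ} {o : V}

theorem lintegral_le_of_ae_tendsto {Ω : Type*} [MeasurableSpace Ω] {μ : Measure Ω}
    {f : ℕ → Ω → ℝ≥0∞} {g : Ω → ℝ≥0∞} (hf : ∀ n, Measurable (f n))
    (hfg : ∀ᵐ ω ∂μ, Tendsto (fun n => f n ω) atTop (𝓝 (g ω))) {B : ℝ≥0∞}
    (hB : ∀ n, ∫⁻ ω, f n ω ∂μ ≤ B) : ∫⁻ ω, g ω ∂μ ≤ B := by
  calc ∫⁻ ω, g ω ∂μ = ∫⁻ ω, liminf (fun n => f n ω) atTop ∂μ :=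
        lintegral_congr_ae (hfg.mono fun ω hω => hω.liminf_eq.symm)
    _ ≤ liminf (fun n => ∫⁻ ω, f n ω ∂μ) atTop := lintegral_liminf_le hf
    _ ≤ liminf (fun _ : ℕ => B) atTop := liminf_le_liminf (Eventually.of_forall hB)
    _ = B := liminf_const B

namespace IsStableInteraction

theorem lintegral_of_isGibbsMeasure (h : IsStableInteraction W P I J a c p q)
    {μ : Measure (V → ℝ)} (hμ : IsGibbsMeasure G W P μ) (Λ : Finset V) {f : (V → ℝ) → ℝ≥0∞}
    (hf : Measurable f) :
    ∫⁻ ω, f ω ∂μ = ∫⁻ ω, ∫⁻ η, f η ∂gibbsKer G W P Λ ω ∂μ := by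
  have hk := (h.measurable_gibbsKer (G := G) Λ).aemeasurable (μ := μ)
  have hbind : μ.bind (gibbsKer G W P Λ) = μ := by
    ext A hA
    rw [Measure.bind_apply hA hk, ← hμ.2 Λ A hA]
  rw [← Measure.lintegral_bind hk hf.aemeasurable, hbind]

/-- The DLR equations can be tested on bounded continuous functions. -/
theorem isGibbsMeasure_iff (h : IsStableInteraction W P I J a c p q)
    (ν : ProbabilityMeasure (V → ℝ)) :
    IsGibbsMeasure G W P ν.toMeasure ↔
      ∀ (Λ : Finset V) (f : BoundedContinuousFunction (V → ℝ) ℝ≥0),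
        ∫⁻ ω, f ω ∂ν.toMeasure = ∫⁻ ω, ∫⁻ η, f η ∂gibbsKer G W P Λ ω ∂ν.toMeasure := by
  refine ⟨fun hν Λ f => h.lintegral_of_isGibbsMeasure hν Λ
    f.continuous.measurable.coe_nnreal_ennreal, fun hν => ⟨inferInstance, fun Λ A hA => ?_⟩⟩
  have hk := (h.measurable_gibbsKer (G := G) Λ).aemeasurable (μ := ν.toMeasure)
  have heq : ν.toMeasure = ν.toMeasure.bind (gibbsKer G W P Λ) := by
    refine ext_of_forall_lintegral_eq_of_IsFiniteMeasure fun f => ?_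
    rw [Measure.lintegral_bind hk f.continuous.measurable.coe_nnreal_ennreal.aemeasurable]
    exact hν Λ f
  rw [← Measure.bind_apply hA hk, ← heq]

theorem isClosed_setOf_dlr (h : IsStableInteraction W P I J a c p q) (Λ : Finset V)
    (f : BoundedContinuousFunction (V → ℝ) ℝ≥0) :
    IsClosed {ν : ProbabilityMeasure (V → ℝ) |
      ∫⁻ ω, f ω ∂ν.toMeasure = ∫⁻ ω, ∫⁻ η, f η ∂gibbsKer G W P Λ ω ∂ν.toMeasure} := by
  obtain ⟨g, hg⟩ := h.exists_boundedContinuous_lintegral_gibbsKer (G := G) Λ f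
  simp only [hg]
  exact isClosed_eq (ProbabilityMeasure.continuous_lintegral_boundedContinuousFunction f)
    (ProbabilityMeasure.continuous_lintegral_boundedContinuousFunction g)

theorem isClosed_setOf_isGibbsMeasure (h : IsStableInteraction W P I J a c p q) :
    IsClosed {ν : ProbabilityMeasure (V → ℝ) | IsGibbsMeasure G W P ν.toMeasure} := by
  simp only [h.isGibbsMeasure_iff, Set.ofPred_forall]
  exact isClosed_iInter fun Λ => isClosed_iInter fun f => h.isClosed_setOf_dlr Λ f

/-- Exponential moments of tempered Gibbs measures. -/
theorem exists_gibbs_exp_moment_bound (h : IsStableInteraction W P I J a c (2 + 2 / θ) q)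
    (hconn : G.Connected) (hα : 0 < α) (hθ : 0 < θ) (hΘ : ThetaFin G o α θ) (hlam : 0 < lam) :
    ∃ A : ℝ,
      (∀ Λ Δ : Finset V,
        ∫⁻ ω, ENNReal.ofReal (exp (lam * partialNorm G o (2 + 2 / θ) α Δ ω))
          ∂gibbsKer G W P Λ 0 ≤ ENNReal.ofReal (exp A)) ∧
      ∀ μ : Measure (V → ℝ), IsGibbsMeasure G W P μ → μ (tempered G o (2 + 2 / θ) α) = 1 →
        ∫⁻ ω, ENNReal.ofReal (exp (lam * sNorm G o (2 + 2 / θ) α ω)) ∂μ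
          ≤ ENNReal.ofReal (exp A) := by
  obtain ⟨A, hA⟩ := h.exists_exp_moment_bound hconn hα hθ hΘ hlam
  have hp : (2 + 2 / θ) ≠ 0 := by positivity
  refine ⟨A, fun Λ Δ => ?_, fun μ hμ hμt => ?_⟩
  · have h0 : (0 : V → ℝ) ∈ tempered G o (2 + 2 / θ) α := by
      simp [tempered, Real.zero_rpow hp, summable_zero]
    simpa [partialNorm, Real.zero_rpow hp] using hA Λ Δ 0 h0
  · have := hμ.1
    have hae : ∀ᵐ ω ∂μ, ω ∈ tempered G o (2 + 2 / θ) α :=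
      (mem_ae_iff_prob_eq_one measurableSet_tempered).2 hμt
    obtain ⟨s, hs⟩ := exists_seq_tendsto (atTop : Filter (Finset V))
    set f : ℕ → (V → ℝ) → ℝ≥0∞ := fun n ω =>
      min (n : ℝ≥0∞) (ENNReal.ofReal (exp (lam * partialNorm G o (2 + 2 / θ) α (s n) ω))) with hf
    have hfm : ∀ n, Measurable (f n) := fun n =>
      measurable_const.min
        ((measurable_partialNorm (s n)).const_mul lam).exp.ennreal_ofReal
    refine lintegral_le_of_ae_tendsto hfm ?_ fun n => ?_
    · filter_upwards [hae] with ω hω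
      have h1 : Tendsto (fun n => partialNorm G o (2 + 2 / θ) α (s n) ω) atTop
          (𝓝 (sNorm G o (2 + 2 / θ) α ω)) := (Summable.hasSum hω).comp hs
      have h2 := ENNReal.tendsto_ofReal ((Real.continuous_exp.tendsto _).comp (h1.const_mul lam))
      simpa using ENNReal.tendsto_nat_nhds_top.min h2
    · set F : ℕ → (V → ℝ) → ℝ≥0∞ := fun m ω => ∫⁻ η, f n η ∂gibbsKer G W P (s m) ω with hF
      have hlim : ∀ᵐ ω ∂μ, limsup (fun m => F m ω) atTop ≤ ENNReal.ofReal (exp A) := by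
        filter_upwards [hae] with ω hω
        have h1 : Tendsto (fun m => ENNReal.ofReal (exp (A + 2 * lam *
            ∑' x : {x // x ∉ s m}, |ω x| ^ (2 + 2 / θ) * wgt G o α x))) atTop
            (𝓝 (ENNReal.ofReal (exp A))) := by
          have h2 := (tendsto_tsum_compl_atTop_zero
            fun x => |ω x| ^ (2 + 2 / θ) * wgt G o α x).comp hs
          have h3 := (h2.const_mul (2 * lam)).const_add A
          rw [mul_zero, add_zero] at h3
          exact ENNReal.tendsto_ofReal ((Real.continuous_exp.tendsto _).comp h3)
        rw [← h1.limsup_eq]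
        exact limsup_le_limsup (Eventually.of_forall fun m =>
          (lintegral_mono fun η => min_le_right _ _).trans (hA (s m) (s n) ω hω))
      calc ∫⁻ ω, f n ω ∂μ = limsup (fun m => ∫⁻ ω, F m ω ∂μ) atTop := by
            simp only [hF, ← h.lintegral_of_isGibbsMeasure hμ _ (hfm n), limsup_const]
        _ ≤ ∫⁻ ω, limsup (fun m => F m ω) atTop ∂μ := by
            refine limsup_lintegral_le (fun _ => (n : ℝ≥0∞))
              (fun m => h.measurable_lintegral_gibbsKer (s m) (hfm n))
              (fun m => Eventually.of_forall fun ω => ?_) (by simp)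
            have := h.isProbabilityMeasure_gibbsKer (G := G) (s m) ω
            calc F m ω ≤ ∫⁻ _, (n : ℝ≥0∞) ∂gibbsKer G W P (s m) ω :=
                  lintegral_mono fun η => min_le_left _ _
              _ = n := by simp
        _ ≤ ∫⁻ _, ENNReal.ofReal (exp A) ∂μ := lintegral_mono_ae hlim
        _ = ENNReal.ofReal (exp A) := by simp

/-- The set of tempered Gibbs measures is non-empty and weakly compact. -/
theorem nonempty_and_isCompact_tempered_gibbs
    (h : IsStableInteraction W P I J a c (2 + 2 / θ) q)
    (hconn : G.Connected) (hα : 0 < α) (hθ : 0 < θ) (hΘ : ThetaFin G o α θ) :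
    Set.Nonempty {ν : ProbabilityMeasure (V → ℝ) | IsGibbsMeasure G W P ν.toMeasure ∧
        ν.toMeasure (tempered G o (2 + 2 / θ) α) = 1} ∧
      IsCompact {ν : ProbabilityMeasure (V → ℝ) | IsGibbsMeasure G W P ν.toMeasure ∧
        ν.toMeasure (tempered G o (2 + 2 / θ) α) = 1} := by
  obtain ⟨A, hA₀, hA⟩ := h.exists_gibbs_exp_moment_bound hconn hα hθ hΘ one_pos
  simp only [one_mul] at hA₀ hA
  have hK : IsCompact (tightSet G o (2 + 2 / θ) α (exp A).toNNReal) :=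
    isCompact_tightSet (by positivity) _
  have heq : {ν : ProbabilityMeasure (V → ℝ) | IsGibbsMeasure G W P ν.toMeasure ∧
        ν.toMeasure (tempered G o (2 + 2 / θ) α) = 1}
      = tightSet G o (2 + 2 / θ) α (exp A).toNNReal
        ∩ {ν | IsGibbsMeasure G W P ν.toMeasure} := by
    ext ν
    refine ⟨fun hν => ⟨mem_tightSet fun Δ => ?_, hν.1⟩,
      fun hν => ⟨hν.2, measure_tempered_of_mem_tightSet hν.1⟩⟩
    refine le_trans (lintegral_mono_ae ?_) (hA _ hν.1 hν.2)
    filter_upwards [(mem_ae_iff_prob_eq_one measurableSet_tempered).2 hν.2] with ω hω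
    exact ENNReal.ofReal_le_ofReal (exp_le_exp.2 (partialNorm_le_sNorm hω Δ))
  rw [heq]
  refine ⟨?_, hK.inter_right h.isClosed_setOf_isGibbsMeasure⟩
  set F : Finset V → ProbabilityMeasure (V → ℝ) := fun Λ =>
    ⟨gibbsKer G W P Λ 0, h.isProbabilityMeasure_gibbsKer Λ 0⟩ with hF
  obtain ⟨ν, hν, hcl⟩ := hK.exists_mapClusterPt (f := atTop) (u := F)
    (le_principal_iff.2 (mem_map.2 (univ_mem' fun Λ => mem_tightSet (hA₀ Λ))))
  refine ⟨ν, hν, (h.isGibbsMeasure_iff ν).2 fun Λ f => ?_⟩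
  refine (h.isClosed_setOf_dlr (G := G) Λ f).mem_of_mapClusterPt hcl ?_
  filter_upwards [eventually_ge_atTop Λ] with Δ hΔ
  exact (h.lintegral_lintegral_gibbsKer hΔ 0 f.continuous.measurable.coe_nnreal_ennreal).symm

theorem exists_gibbs_site_exp_moment_bound
    (h : IsStableInteraction W P I J a c (2 + 2 / θ) q)
    (hconn : G.Connected) (hα : 0 < α) (hθ : 0 < θ) (hΘ : ThetaFin G o α θ) (hlam : 0 < lam)
    (x : V) :
    ∃ A : ℝ, ∀ μ : Measure (V → ℝ), IsGibbsMeasure G W P μ →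
      μ (tempered G o (2 + 2 / θ) α) = 1 →
        ∫⁻ ω, ENNReal.ofReal (exp (lam * |ω x| ^ (2 + 2 / θ))) ∂μ ≤ ENNReal.ofReal (exp A) := by
  have hw := wgt_pos (G := G) (o := o) (α := α) x
  obtain ⟨A, -, hA⟩ := h.exists_gibbs_exp_moment_bound hconn hα hθ hΘ (div_pos hlam hw)
  refine ⟨A, fun μ hμ hμt => le_trans (lintegral_mono_ae ?_) (hA μ hμ hμt)⟩
  have := hμ.1
  filter_upwards [(mem_ae_iff_prob_eq_one measurableSet_tempered).2 hμt] with ω hω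
  refine ENNReal.ofReal_le_ofReal (exp_le_exp.2 ?_)
  have h1 : |ω x| ^ (2 + 2 / θ) * wgt G o α x ≤ sNorm G o (2 + 2 / θ) α ω := by
    simpa [partialNorm] using partialNorm_le_sNorm hω {x}
  calc lam * |ω x| ^ (2 + 2 / θ)
      = lam / wgt G o α x * (|ω x| ^ (2 + 2 / θ) * wgt G o α x) := by field_simp
    _ ≤ _ := mul_le_mul_of_nonneg_left h1 (div_pos hlam hw).le

end IsStableInteraction

end GibbsMeasures

end GibbsField

/-- **Basic theorem (Theorem 2).** With `r = 2`, `p = 2 + 2/θ`, `Ω^t = L^p(V,w_α)` and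
`𝒢^t = {μ ∈ 𝒢 : μ(Ω^t) = 1}` (where `Θ(α,θ) < ∞`):
(i) `𝒢^t` is non-empty and weakly compact;
(ii) for every `λ > 0` and `x ∈ V` there is `C(λ,x) > 0` with
`∫ exp(λ|ω(x)|^p) dμ ≤ C(λ,x)` for all `μ ∈ 𝒢^t`;
(iii) for every `λ > 0` there is `C(λ) > 0` with
`∫ exp(λ‖ω‖_{p,α}^p) dμ ≤ C(λ)` for all `μ ∈ 𝒢^t`. -/
theorem basic_theorem_tempered_gibbs_fields
    (G : SimpleGraph V) [∀ v : V, Fintype (G.neighborSet v)] (hconn : G.Connected)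
    (o : V) (α θ : ℝ) (hα : 0 < α) (hθ : 0 < θ) (hΘ : ThetaFin G o α θ)
    (W : ℝ → ℝ → ℝ) (hWcont : Continuous (Function.uncurry W))
    (hWsym : ∀ u v : ℝ, W u v = W v u)
    (IW JW : ℝ) (hIW : 0 < IW) (hJW : 0 < JW)
    (hW : ∀ u v : ℝ, |W u v| ≤ (IW + JW * (u ^ 2 + v ^ 2)) / 2)
    (P : ℝ → ℝ) (hPcont : Continuous P)
    (aV cV q : ℝ) (haV : 0 < aV) (hcV : 0 < cV) (hq : 2 + 2 / θ < q)
    (hP : ∀ u : ℝ, aV * |u| ^ q - cV ≤ P u)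
    (p : ℝ) (hp : p = 2 + 2 / θ) :
    (Set.Nonempty {ν : ProbabilityMeasure (V → ℝ) |
        IsGibbsMeasure G W P ν.toMeasure ∧ ν.toMeasure (tempered G o p α) = 1}) ∧
    IsCompact {ν : ProbabilityMeasure (V → ℝ) |
        IsGibbsMeasure G W P ν.toMeasure ∧ ν.toMeasure (tempered G o p α) = 1} ∧
    (∀ lam : ℝ, 0 < lam → ∀ x : V, ∃ C : ℝ, 0 < C ∧
      ∀ μ : Measure (V → ℝ), IsGibbsMeasure G W P μ → μ (tempered G o p α) = 1 →
        ∫⁻ ω, ENNReal.ofReal (Real.exp (lam * |ω x| ^ p)) ∂μ ≤ ENNReal.ofReal C) ∧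
    (∀ lam : ℝ, 0 < lam → ∃ C : ℝ, 0 < C ∧
      ∀ μ : Measure (V → ℝ), IsGibbsMeasure G W P μ → μ (tempered G o p α) = 1 →
        ∫⁻ ω, ENNReal.ofReal (Real.exp (lam * sNorm G o p α ω)) ∂μ ≤ ENNReal.ofReal C) := by
  subst hp
  have h : GibbsField.IsStableInteraction W P IW JW aV cV (2 + 2 / θ) q :=
    ⟨hWcont, hWsym, hIW.le, hJW.le, hW, hPcont, haV,
      by have := div_pos two_pos hθ; linarith, hq, hP⟩
  obtain ⟨hne, hcpt⟩ := h.nonempty_and_isCompact_tempered_gibbs hconn hα hθ hΘ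
  refine ⟨hne, hcpt, fun lam hlam x => ?_, fun lam hlam => ?_⟩
  · obtain ⟨A, hA⟩ := h.exists_gibbs_site_exp_moment_bound hconn hα hθ hΘ hlam x
    exact ⟨exp A, exp_pos A, hA⟩
  · obtain ⟨A, -, hA⟩ := h.exists_gibbs_exp_moment_bound hconn hα hθ hΘ hlam
    exact ⟨exp A, exp_pos A, hA⟩
end
end

section
/- Extended theorem (Theorem 3). For every α ∈ (α_, ᾱ] and every p ∈ [p₀, q): (i) the set 𝒢_{p,α} is non-empty and compact in the weak topology of probability measures on Ω; (ii) for every λ > 0 and every vertex x ∈ V there exists a constant C(p,α;λ,x) > 0 such that ∫_Ω exp(λ|ω(x)|^p) μ(dω) ≤ C(p,α;λ,x) for all μ ∈ 𝒢_{p,α}; (iii) for every λ > 0 there exists a constant C(p,α;λ) > 0 such that ∫_Ω exp(λ‖ω‖_{p,α}^p) μ(dω) ≤ C(p,α;λ) for all μ ∈ 𝒢_{p,α}. -/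
open MeasureTheory Real Filter

noncomputable section

variable {V : Type} [Countable V] [DecidableEq V]

section ScalarEstimates

/-- A version of Young's inequality with explicit constants. -/
theorem mul_rpow_le_add_of_lt {r q ε s v : ℝ} (hr : 0 < r) (hrq : r < q) (hε : 0 < ε)
    (hs : 0 ≤ s) (hv : 0 ≤ v) :
    s * v ^ r ≤ ε * v ^ q + s * (s / ε) ^ (r / (q - r)) := by
  have hqr : 0 < q - r := by linarith
  have hC : 0 ≤ s * (s / ε) ^ (r / (q - r)) := by positivity
  have hvq : 0 ≤ ε * v ^ q := by positivity
  rcases hv.eq_or_lt with rfl | hv'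
  · rw [Real.zero_rpow hr.ne']; linarith
  by_cases h : s * v ^ r ≤ ε * v ^ q
  · linarith
  push Not at h
  have hsplit : v ^ q = v ^ r * v ^ (q - r) := by
    rw [← Real.rpow_add hv']; ring_nf
  have h1 : v ^ (q - r) ≤ s / ε := by
    rw [le_div_iff₀ hε]
    rw [hsplit] at h
    have hvr : 0 < v ^ r := by positivity
    by_contra hcon
    push Not at hcon
    nlinarith [mul_lt_mul_of_pos_left hcon hvr]
  have h2 : v ^ r ≤ (s / ε) ^ (r / (q - r)) := by
    have := Real.rpow_le_rpow (by positivity) h1 (by positivity : 0 ≤ r / (q - r))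
    rwa [← Real.rpow_mul hv, mul_div_cancel₀ _ hqr.ne'] at this
  have := mul_le_mul_of_nonneg_left h2 hs
  linarith

theorem integrable_exp_neg_mul_abs_rpow {b q : ℝ} (hb : 0 < b) (hq : 0 < q) :
    Integrable (fun u : ℝ => Real.exp (-b * |u| ^ q)) := by
  have hIoi : IntegrableOn (fun u : ℝ => Real.exp (-b * |u| ^ q)) (Set.Ioi 0) := by
    refine (integrableOn_rpow_mul_exp_neg_mul_rpow (s := 0) (by norm_num) hq hb).congr_fun
      (fun u hu => ?_) measurableSet_Ioi
    simp [abs_of_pos (Set.mem_Ioi.1 hu)]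
  have hIic : IntegrableOn (fun u : ℝ => Real.exp (-b * |u| ^ q)) (Set.Iic 0) := by
    rw [← Measure.map_neg_eq_self (volume : Measure ℝ)]
    let m : MeasurableEmbedding fun x : ℝ => -x := (Homeomorph.neg ℝ).measurableEmbedding
    rw [m.integrableOn_map_iff]
    simp_rw [Function.comp_def, abs_neg, Set.neg_preimage, Set.neg_Iic, neg_zero]
    exact Iff.mpr integrableOn_Ici_iff_integrableOn_Ioi hIoi
  rw [← integrableOn_univ, ← Set.Iic_union_Ioi (a := (0 : ℝ))]
  exact hIic.union hIoi

theorem integrable_exp_rpow_add_rpow_sub_rpow {r p q a s t : ℝ} (hr : 0 < r) (hp : 0 < p)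
    (hrq : r < q) (hpq : p < q) (ha : 0 < a) (hs : 0 ≤ s) (ht : 0 ≤ t) :
    Integrable (fun u : ℝ => Real.exp (s * |u| ^ r + t * |u| ^ p - a * |u| ^ q)) := by
  have hq : 0 < q := hr.trans hrq
  have h := (integrable_exp_neg_mul_abs_rpow (half_pos ha) hq).const_mul
    (Real.exp (s * (s / (a / 4)) ^ (r / (q - r)) + t * (t / (a / 4)) ^ (p / (q - p))))
  have hcont : ∀ e : ℝ, 0 < e → Continuous fun u : ℝ => |u| ^ e := fun e he =>
    continuous_abs.rpow_const fun _ => Or.inr he.le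
  refine h.mono' ?_ (Eventually.of_forall fun u => ?_)
  · exact (Real.continuous_exp.comp ((((hcont r hr).const_mul s).add
      ((hcont p hp).const_mul t)).sub ((hcont q hq).const_mul a))).aestronglyMeasurable
  · rw [Real.norm_eq_abs, abs_of_pos (Real.exp_pos _), ← Real.exp_add, Real.exp_le_exp]
    have h1 := mul_rpow_le_add_of_lt hr hrq (by linarith : 0 < a / 4) hs (abs_nonneg u)
    have h2 := mul_rpow_le_add_of_lt hp hpq (by linarith : 0 < a / 4) ht (abs_nonneg u)
    linarith

end ScalarEstimates

section Hamiltonian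

theorem ite_and_or_eq (a b c : Prop) [Decidable a] [Decidable b] [Decidable c] (w : ℝ) :
    (if a ∧ (b ∨ c) then w else 0) =
      (if a ∧ b ∧ c then w else 0) + (if a ∧ b ∧ ¬ c then w else 0) +
        (if a ∧ ¬ b ∧ c then w else 0) := by
  by_cases a <;> by_cases b <;> by_cases c <;> simp [*]

theorem ite_and_or_sub_ite (a : Prop) {b c b' c' : Prop} [Decidable a] [Decidable b] [Decidable c]
    [Decidable b'] [Decidable c'] (hb : b' → b) (hc : c' → c) (w : ℝ) :
    (if a ∧ (b ∨ c) then w else 0) - (if a ∧ (b' ∨ c') then w else 0) =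
      if a ∧ (b ∨ c) ∧ ¬ b' ∧ ¬ c' then w else 0 := by
  by_cases a <;> by_cases b <;> by_cases c <;> by_cases b' <;> by_cases c' <;> simp_all

variable (G : SimpleGraph V) [∀ v : V, Fintype (G.neighborSet v)] (W : ℝ → ℝ → ℝ) (P : ℝ → ℝ)

/-- The finite set `Λ` together with all neighbours of its vertices. -/
def closedNhd (Λ : Finset V) : Finset V := Λ ∪ Λ.biUnion fun x => G.neighborFinset x

theorem subset_closedNhd (Λ : Finset V) : Λ ⊆ closedNhd G Λ := Finset.subset_union_left

theorem mem_closedNhd_of_mem_neighborFinset {Λ : Finset V} {x y : V} (hx : x ∈ Λ)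
    (h : y ∈ G.neighborFinset x) : y ∈ closedNhd G Λ :=
  Finset.mem_union_right _ (Finset.mem_biUnion.2 ⟨x, hx, h⟩)

theorem mem_neighborFinset_symm {x y : V} :
    y ∈ G.neighborFinset x ↔ x ∈ G.neighborFinset y := by
  simp [G.adj_comm]

/-- Summing over the ordered pairs of adjacent vertices `x ∈ Λ`, `y ∉ Λ` or `y ∈ Λ`. -/
theorem sum_sum_ite_neighborFinset {Λ B : Finset V} (hB : closedNhd G Λ ⊆ B) (f : V → V → ℝ)
    (p : V → Prop) [DecidablePred p] :
    ∑ x ∈ B, ∑ y ∈ B, (if y ∈ G.neighborFinset x ∧ x ∈ Λ ∧ p y then f x y else 0) =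
      ∑ x ∈ Λ, ∑ y ∈ G.neighborFinset x with p y, f x y := by
  rw [← Finset.sum_subset ((subset_closedNhd G Λ).trans hB)]
  · refine Finset.sum_congr rfl fun x hx => ?_
    rw [← Finset.sum_filter]
    refine Finset.sum_congr ?_ fun _ _ => rfl
    ext y
    have := fun h => hB (mem_closedNhd_of_mem_neighborFinset G hx (y := y) h)
    simp only [Finset.mem_filter]
    tauto
  · intro x _ hx
    simp [hx]

/-- The Hamiltonian as a sum over ordered pairs of vertices of a large finite set. -/
theorem ham_eq_sum_pairs (hWsym : ∀ u v : ℝ, W u v = W v u) {Λ B : Finset V}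
    (hB : closedNhd G Λ ⊆ B) (ω : V → ℝ) :
    ham G W P Λ ω =
      (∑ x ∈ B, ∑ y ∈ B,
        if y ∈ G.neighborFinset x ∧ (x ∈ Λ ∨ y ∈ Λ) then W (ω x) (ω y) else 0) / 2
      + ∑ x ∈ Λ, P (ω x) := by
  have h1 := sum_sum_ite_neighborFinset G hB (fun x y => W (ω x) (ω y)) (fun y => y ∈ Λ)
  have h2 := sum_sum_ite_neighborFinset G hB (fun x y => W (ω x) (ω y)) (fun y => y ∉ Λ)
  have h3 : ∑ x ∈ B, ∑ y ∈ B,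
      (if y ∈ G.neighborFinset x ∧ x ∉ Λ ∧ y ∈ Λ then W (ω x) (ω y) else 0) =
      ∑ x ∈ B, ∑ y ∈ B,
        (if y ∈ G.neighborFinset x ∧ x ∈ Λ ∧ y ∉ Λ then W (ω x) (ω y) else 0) := by
    rw [Finset.sum_comm]
    refine Finset.sum_congr rfl fun x _ => Finset.sum_congr rfl fun y _ => ?_
    rw [hWsym]
    exact if_congr (by rw [mem_neighborFinset_symm G (x := y), and_comm (a := y ∉ Λ)]) rfl rfl
  have h4 : (∑ x ∈ B, ∑ y ∈ B,
      if y ∈ G.neighborFinset x ∧ (x ∈ Λ ∨ y ∈ Λ) then W (ω x) (ω y) else 0) =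
      (∑ x ∈ B, ∑ y ∈ B,
        (if y ∈ G.neighborFinset x ∧ x ∈ Λ ∧ y ∈ Λ then W (ω x) (ω y) else 0)) +
      (∑ x ∈ B, ∑ y ∈ B,
        (if y ∈ G.neighborFinset x ∧ x ∈ Λ ∧ y ∉ Λ then W (ω x) (ω y) else 0)) +
      ∑ x ∈ B, ∑ y ∈ B,
        (if y ∈ G.neighborFinset x ∧ x ∉ Λ ∧ y ∈ Λ then W (ω x) (ω y) else 0) := by
    simp only [← Finset.sum_add_distrib]
    refine Finset.sum_congr rfl fun x _ => Finset.sum_congr rfl fun y _ => ?_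
    exact ite_and_or_eq _ _ _ _
  rw [h4, h3, h1, h2, ham]
  simp only [Finset.filter_mem_eq_inter, ← Finset.sdiff_eq_filter]
  ring

theorem ham_sub_ham_congr (hWsym : ∀ u v : ℝ, W u v = W v u) {Δ Λ : Finset V} (hΔ : Δ ⊆ Λ)
    {ω ω' : V → ℝ} (h : ∀ x ∉ Δ, ω x = ω' x) :
    ham G W P Λ ω - ham G W P Δ ω = ham G W P Λ ω' - ham G W P Δ ω' := by
  have hΔB : closedNhd G Δ ⊆ closedNhd G Λ :=
    Finset.union_subset_union hΔ (Finset.biUnion_subset_biUnion_of_subset_left _ hΔ)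
  rw [ham_eq_sum_pairs G W P hWsym le_rfl, ham_eq_sum_pairs G W P hWsym hΔB,
    ham_eq_sum_pairs G W P hWsym le_rfl, ham_eq_sum_pairs G W P hWsym hΔB,
    ← Finset.sum_sdiff hΔ, ← Finset.sum_sdiff hΔ]
  have hP : ∑ x ∈ Λ \ Δ, P (ω x) = ∑ x ∈ Λ \ Δ, P (ω' x) :=
    Finset.sum_congr rfl fun x hx => by rw [h x (Finset.mem_sdiff.1 hx).2]
  have hW : ∀ η : V → ℝ, (∑ x ∈ closedNhd G Λ, ∑ y ∈ closedNhd G Λ,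
      if y ∈ G.neighborFinset x ∧ (x ∈ Λ ∨ y ∈ Λ) then W (η x) (η y) else 0) -
      (∑ x ∈ closedNhd G Λ, ∑ y ∈ closedNhd G Λ,
      if y ∈ G.neighborFinset x ∧ (x ∈ Δ ∨ y ∈ Δ) then W (η x) (η y) else 0) =
      ∑ x ∈ closedNhd G Λ, ∑ y ∈ closedNhd G Λ,
      if y ∈ G.neighborFinset x ∧ (x ∈ Λ ∨ y ∈ Λ) ∧ x ∉ Δ ∧ y ∉ Δ
        then W (η x) (η y) else 0 := by
    intro η
    simp only [← Finset.sum_sub_distrib]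
    refine Finset.sum_congr rfl fun x _ => Finset.sum_congr rfl fun y _ => ?_
    exact ite_and_or_sub_ite _ (@hΔ x) (@hΔ y) _
  have hW' : (∑ x ∈ closedNhd G Λ, ∑ y ∈ closedNhd G Λ,
      if y ∈ G.neighborFinset x ∧ (x ∈ Λ ∨ y ∈ Λ) ∧ x ∉ Δ ∧ y ∉ Δ
        then W (ω x) (ω y) else 0) = ∑ x ∈ closedNhd G Λ, ∑ y ∈ closedNhd G Λ,
      if y ∈ G.neighborFinset x ∧ (x ∈ Λ ∨ y ∈ Λ) ∧ x ∉ Δ ∧ y ∉ Δ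
        then W (ω' x) (ω' y) else 0 := by
    refine Finset.sum_congr rfl fun x _ => Finset.sum_congr rfl fun y _ => ?_
    split_ifs with hc
    · rw [h x hc.2.2.1, h y hc.2.2.2]
    · rfl
  have := hW ω
  have := hW ω'
  linarith

theorem continuous_ham (hWcont : Continuous (Function.uncurry W)) (hPcont : Continuous P)
    (Λ : Finset V) : Continuous (ham G W P Λ) := by
  have hW2 : ∀ x y : V, Continuous fun ω : V → ℝ => W (ω x) (ω y) := fun x y =>
    hWcont.comp (f := fun ω : V → ℝ => (ω x, ω y)) (by fun_prop)
  have hP1 : ∀ x : V, Continuous fun ω : V → ℝ => P (ω x) := fun x =>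
    hPcont.comp (continuous_apply x)
  have hWs : ∀ (x : V) (s : Finset V), Continuous fun ω : V → ℝ => ∑ y ∈ s, W (ω x) (ω y) :=
    fun x s => continuous_finsetSum _ fun y _ => hW2 x y
  exact (((continuous_finsetSum _ fun x _ => hWs x _).div_const 2).add
    (continuous_finsetSum _ fun x _ => hWs x _)).add (continuous_finsetSum _ fun x _ => hP1 x)

theorem neg_ham_le (hWsym : ∀ u v : ℝ, W u v = W v u) {IW JW r : ℝ} (hJW : 0 < JW)
    (hW : ∀ u v : ℝ, |W u v| ≤ (IW + JW * (|u| ^ r + |v| ^ r)) / 2)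
    {aV cV q : ℝ} (hP : ∀ u : ℝ, aV * |u| ^ q - cV ≤ P u) (Λ : Finset V) :
    ∃ K₀ K₁ : ℝ, 0 ≤ K₁ ∧ ∀ ω : V → ℝ, - ham G W P Λ ω ≤
      K₀ + K₁ * ∑ x ∈ closedNhd G Λ, |ω x| ^ r + ∑ x ∈ Λ, (cV - aV * |ω x| ^ q) := by
  set B := closedNhd G Λ with hB
  refine ⟨(B.card : ℝ) * B.card * IW / 4, B.card * JW / 2, by positivity, fun ω => ?_⟩
  rw [ham_eq_sum_pairs G W P hWsym (le_refl (closedNhd G Λ)), ← hB]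
  have h1 : - (∑ x ∈ B, ∑ y ∈ B,
      if y ∈ G.neighborFinset x ∧ (x ∈ Λ ∨ y ∈ Λ) then W (ω x) (ω y) else 0) ≤
      ∑ x ∈ B, ∑ y ∈ B, (IW + JW * (|ω x| ^ r + |ω y| ^ r)) / 2 := by
    simp only [← Finset.sum_neg_distrib]
    refine Finset.sum_le_sum fun x _ => Finset.sum_le_sum fun y _ => ?_
    have h := hW (ω x) (ω y)
    split_ifs
    · exact (neg_le_abs _).trans h
    · rw [neg_zero]; exact (abs_nonneg _).trans h
  have h2 : ∑ x ∈ B, ∑ y ∈ B, (IW + JW * (|ω x| ^ r + |ω y| ^ r)) / 2 =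
      (B.card : ℝ) * B.card * IW / 2 + B.card * JW * ∑ x ∈ B, |ω x| ^ r := by
    simp only [← Finset.sum_div, Finset.sum_add_distrib, ← Finset.mul_sum, Finset.sum_const,
      nsmul_eq_mul]
    ring
  have h3 : - ∑ x ∈ Λ, P (ω x) ≤ ∑ x ∈ Λ, (cV - aV * |ω x| ^ q) := by
    rw [← Finset.sum_neg_distrib]
    exact Finset.sum_le_sum fun x _ => by linarith [hP (ω x)]
  linarith

end Hamiltonian

/-- The growth and continuity assumptions on the pair potential `W` and the self-potential `P`. -/
structure StablePotential (W : ℝ → ℝ → ℝ) (P : ℝ → ℝ) (IW JW r aV cV q : ℝ) : Prop where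
  continuous_pair : Continuous (Function.uncurry W)
  symm : ∀ u v : ℝ, W u v = W v u
  pair_const_pos : 0 < IW
  pair_coeff_pos : 0 < JW
  pair_exponent_pos : 0 < r
  pair_bound : ∀ u v : ℝ, |W u v| ≤ (IW + JW * (|u| ^ r + |v| ^ r)) / 2
  continuous_self : Continuous P
  self_coeff_pos : 0 < aV
  exponent_lt : r < q
  self_bound : ∀ u : ℝ, aV * |u| ^ q - cV ≤ P u

section Kernel

variable {G : SimpleGraph V} [∀ v : V, Fintype (G.neighborSet v)] {W : ℝ → ℝ → ℝ} {P : ℝ → ℝ}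
  {IW JW r aV cV q : ℝ}

theorem comb_of_mem {Λ : Finset V} {x : V} (hx : x ∈ Λ) (σ : ↥Λ → ℝ) (ξ : V → ℝ) :
    comb Λ σ ξ x = σ ⟨x, hx⟩ := dif_pos hx

theorem comb_of_notMem {Λ : Finset V} {x : V} (hx : x ∉ Λ) (σ : ↥Λ → ℝ) (ξ : V → ℝ) :
    comb Λ σ ξ x = ξ x := dif_neg hx

theorem continuous_comb (Λ : Finset V) :
    Continuous fun z : (↥Λ → ℝ) × (V → ℝ) => comb Λ z.1 z.2 := by
  refine continuous_pi fun x => ?_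
  by_cases hx : x ∈ Λ
  · simp only [comb_of_mem hx]; fun_prop
  · simp only [comb_of_notMem hx]; fun_prop

theorem measurable_comb_left (Λ : Finset V) (ξ : V → ℝ) :
    Measurable fun σ : ↥Λ → ℝ => comb Λ σ ξ :=
  ((continuous_comb Λ).comp (by fun_prop : Continuous fun σ : ↥Λ → ℝ => (σ, ξ))).measurable

theorem StablePotential.exists_integrable_dominating (h : StablePotential W P IW JW r aV cV q)
    (Λ : Finset V) {p t M : ℝ} (hp : 0 < p) (hpq : p < q) (ht : 0 ≤ t) (hM : 0 ≤ M) :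
    ∃ g : (↥Λ → ℝ) → ℝ, Integrable g ∧ ∀ ξ : V → ℝ, (∀ y ∈ closedNhd G Λ, |ξ y| ≤ M) →
      ∀ σ, Real.exp (t * ∑ x ∈ Λ, |comb Λ σ ξ x| ^ p - ham G W P Λ (comb Λ σ ξ)) ≤ g σ := by
  obtain ⟨K₀, K₁, hK₁, hK⟩ := neg_ham_le G W P h.symm h.pair_coeff_pos h.pair_bound h.self_bound Λ
  have hr := h.pair_exponent_pos
  have hprod : Integrable (fun σ : ↥Λ → ℝ =>
      ∏ x, Real.exp (K₁ * |σ x| ^ r + t * |σ x| ^ p - aV * |σ x| ^ q)) :=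
    Integrable.fintype_prod (f := fun _ u => Real.exp (K₁ * |u| ^ r + t * |u| ^ p - aV * |u| ^ q))
      fun _ => integrable_exp_rpow_add_rpow_sub_rpow hr hp h.exponent_lt hpq h.self_coeff_pos hK₁ ht
  refine ⟨_, hprod.const_mul
    (Real.exp (K₀ + K₁ * ((closedNhd G Λ).card * M ^ r) + Λ.card * cV)), fun ξ hξ σ => ?_⟩
  rw [← Real.exp_sum, ← Real.exp_add, Real.exp_le_exp]
  have hsum : ∑ x : ↥Λ, (K₁ * |σ x| ^ r + t * |σ x| ^ p - aV * |σ x| ^ q) =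
      ∑ x ∈ Λ, (K₁ * |comb Λ σ ξ x| ^ r + t * |comb Λ σ ξ x| ^ p -
        aV * |comb Λ σ ξ x| ^ q) := by
    rw [← Finset.sum_coe_sort Λ fun x => K₁ * |comb Λ σ ξ x| ^ r + t * |comb Λ σ ξ x| ^ p -
      aV * |comb Λ σ ξ x| ^ q]
    exact Finset.sum_congr rfl fun x _ => by rw [comb_of_mem x.2]
  have hout : ∑ x ∈ closedNhd G Λ \ Λ, |comb Λ σ ξ x| ^ r ≤ (closedNhd G Λ).card * M ^ r := by
    calc ∑ x ∈ closedNhd G Λ \ Λ, |comb Λ σ ξ x| ^ r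
        ≤ ∑ x ∈ closedNhd G Λ \ Λ, M ^ r := Finset.sum_le_sum fun x hx => by
          rw [Finset.mem_sdiff] at hx
          rw [comb_of_notMem hx.2]
          exact Real.rpow_le_rpow (abs_nonneg _) (hξ x hx.1) hr.le
      _ ≤ _ := by
          rw [Finset.sum_const, nsmul_eq_mul]
          gcongr
          exact Finset.sdiff_subset
  have hsplit := Finset.sum_sdiff (f := fun x => |comb Λ σ ξ x| ^ r) (subset_closedNhd G Λ)
  have hKω := hK (comb Λ σ ξ)
  rw [hsum]
  simp only [Finset.sum_add_distrib, Finset.sum_sub_distrib, ← Finset.mul_sum, Finset.sum_const,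
    nsmul_eq_mul] at hKω ⊢
  have := mul_le_mul_of_nonneg_left hout hK₁
  rw [← hsplit] at hKω
  linarith

theorem StablePotential.continuous_ham (h : StablePotential W P IW JW r aV cV q) (Λ : Finset V) :
    Continuous (ham G W P Λ) :=
  _root_.continuous_ham G W P h.continuous_pair h.continuous_self Λ

theorem StablePotential.continuous_exp_neg_ham_comb (h : StablePotential W P IW JW r aV cV q)
    (Λ : Finset V) : Continuous fun z : (↥Λ → ℝ) × (V → ℝ) =>
      Real.exp (- ham G W P Λ (comb Λ z.1 z.2)) :=
  Real.continuous_exp.comp (((h.continuous_ham Λ).comp (continuous_comb Λ)).neg)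

theorem StablePotential.integrable_exp (h : StablePotential W P IW JW r aV cV q)
    (Λ : Finset V) (ξ : V → ℝ) {p t : ℝ} (hp : 0 < p) (hpq : p < q) (ht : 0 ≤ t) :
    Integrable fun σ : ↥Λ → ℝ =>
      Real.exp (t * ∑ x ∈ Λ, |comb Λ σ ξ x| ^ p - ham G W P Λ (comb Λ σ ξ)) := by
  obtain ⟨g, hg, hgξ⟩ := h.exists_integrable_dominating (G := G) Λ hp hpq ht
    (M := ∑ y ∈ closedNhd G Λ, |ξ y|) (by positivity)
  have hcomb : Continuous fun σ : ↥Λ → ℝ => comb Λ σ ξ :=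
    (continuous_comb Λ).comp (by fun_prop : Continuous fun σ : ↥Λ → ℝ => (σ, ξ))
  refine hg.mono' ?_ (Eventually.of_forall fun σ => ?_)
  · refine (Real.continuous_exp.comp ((continuous_const.mul
      (continuous_finsetSum _ fun x _ => ?_)).sub
        ((h.continuous_ham Λ).comp hcomb))).aestronglyMeasurable
    exact ((continuous_apply x).comp hcomb).abs.rpow_const fun _ => Or.inr hp.le
  · rw [Real.norm_eq_abs, abs_of_pos (Real.exp_pos _)]
    exact hgξ ξ (fun y hy => Finset.single_le_sum (f := fun y => |ξ y|)
      (fun _ _ => abs_nonneg _) hy) σ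

theorem StablePotential.integrable_exp_neg_ham (h : StablePotential W P IW JW r aV cV q)
    (Λ : Finset V) (ξ : V → ℝ) :
    Integrable fun σ : ↥Λ → ℝ => Real.exp (- ham G W P Λ (comb Λ σ ξ)) := by
  simpa using h.integrable_exp (G := G) Λ ξ h.pair_exponent_pos h.exponent_lt le_rfl

theorem StablePotential.partZ_pos (h : StablePotential W P IW JW r aV cV q)
    (Λ : Finset V) (ξ : V → ℝ) : 0 < partZ G W P Λ ξ :=
  integral_exp_pos (h.integrable_exp_neg_ham Λ ξ)

variable (G W P) in
/-- The Boltzmann factor of the local Hamiltonian. -/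
def boltzmann (Λ : Finset V) (ω : V → ℝ) : ENNReal := ENNReal.ofReal (Real.exp (- ham G W P Λ ω))

theorem StablePotential.measurable_boltzmann (h : StablePotential W P IW JW r aV cV q)
    (Λ : Finset V) : Measurable (boltzmann G W P Λ) :=
  (Real.continuous_exp.comp (h.continuous_ham Λ).neg).measurable.ennreal_ofReal

theorem StablePotential.ofReal_partZ (h : StablePotential W P IW JW r aV cV q)
    (Λ : Finset V) (ξ : V → ℝ) :
    ENNReal.ofReal (partZ G W P Λ ξ) = (∫⋯∫⁻_Λ, boltzmann G W P Λ ∂fun _ => volume) ξ :=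
  ofReal_integral_eq_lintegral_ofReal (h.integrable_exp_neg_ham Λ ξ)
    (Eventually.of_forall fun _ => (Real.exp_pos _).le)

theorem StablePotential.lintegral_gibbsKer (h : StablePotential W P IW JW r aV cV q)
    (Λ : Finset V) (ξ : V → ℝ) {f : (V → ℝ) → ENNReal} (hf : Measurable f) :
    ∫⁻ ω, f ω ∂gibbsKer G W P Λ ξ =
      (ENNReal.ofReal (partZ G W P Λ ξ))⁻¹ *
        (∫⋯∫⁻_Λ, boltzmann G W P Λ * f ∂fun _ => volume) ξ := by
  have hmul := lintegral_withDensity_eq_lintegral_mul volume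
    ((h.measurable_boltzmann (G := G) Λ).comp (measurable_comb_left Λ ξ))
    (hf.comp (measurable_comb_left Λ ξ))
  rw [gibbsKer, lintegral_smul_measure, lintegral_map hf (measurable_comb_left Λ ξ), smul_eq_mul]
  exact congrArg _ hmul

theorem StablePotential.measurable_gibbsKer (h : StablePotential W P IW JW r aV cV q)
    (Λ : Finset V) : Measurable (gibbsKer G W P Λ) := by
  refine Measure.measurable_of_measurable_coe _ fun s hs => ?_
  have hm : Measurable (s.indicator (1 : (V → ℝ) → ENNReal)) := measurable_one.indicator hs
  simp_rw [← lintegral_indicator_one hs, h.lintegral_gibbsKer Λ _ hm, h.ofReal_partZ]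
  exact ((h.measurable_boltzmann Λ).lmarginal _).inv.mul
    (((h.measurable_boltzmann Λ).mul hm).lmarginal _)

theorem StablePotential.isProbabilityMeasure_gibbsKer
    (h : StablePotential W P IW JW r aV cV q) (Λ : Finset V) (ξ : V → ℝ) :
    IsProbabilityMeasure (gibbsKer G W P Λ ξ) := by
  constructor
  have := h.lintegral_gibbsKer (G := G) Λ ξ (measurable_one (α := ENNReal))
  rw [mul_one, ← h.ofReal_partZ, ENNReal.inv_mul_cancel _ ENNReal.ofReal_ne_top] at this
  · simpa using this
  · simpa using h.partZ_pos Λ ξ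

theorem ae_gibbsKer_eq_boundary (Λ : Finset V) (ξ : V → ℝ) {y : V} (hy : y ∉ Λ) :
    ∀ᵐ ω ∂gibbsKer G W P Λ ξ, ω y = ξ y := by
  refine Measure.ae_smul_measure ?_ _
  rw [ae_map_iff (measurable_comb_left Λ ξ).aemeasurable
    (measurableSet_eq_fun (measurable_pi_apply y) measurable_const)]
  exact Eventually.of_forall fun σ => comb_of_notMem hy σ ξ

theorem lmarginal_mul_left_of_invariant (Λ : Finset V) {f g : (V → ℝ) → ENNReal}
    (hg : Measurable g) (hf : ∀ ω ω' : V → ℝ, (∀ x ∉ Λ, ω x = ω' x) → f ω = f ω') :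
    ∫⋯∫⁻_Λ, f * g ∂(fun _ => volume) = f * ∫⋯∫⁻_Λ, g ∂(fun _ => volume) := by
  ext ξ
  have hfξ : ∀ σ, f (Function.updateFinset ξ Λ σ) = f ξ := fun σ =>
    hf _ _ fun x hx => by simp [Function.updateFinset, hx]
  simp only [lmarginal, Pi.mul_apply, hfξ]
  exact lintegral_const_mul _ (hg.comp measurable_updateFinset)

/-- Consistency of the local Gibbs specification. -/
theorem StablePotential.lintegral_gibbsKer_gibbsKer (h : StablePotential W P IW JW r aV cV q)
    {Δ Λ : Finset V} (hΔ : Δ ⊆ Λ) (ξ : V → ℝ) {f : (V → ℝ) → ENNReal} (hf : Measurable f) :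
    ∫⁻ η, ∫⁻ ω, f ω ∂gibbsKer G W P Δ η ∂gibbsKer G W P Λ ξ = ∫⁻ ω, f ω ∂gibbsKer G W P Λ ξ := by
  have hm : Measurable fun η => ∫⁻ ω, f ω ∂gibbsKer G W P Δ η :=
    (Measure.measurable_lintegral hf).comp (h.measurable_gibbsKer Δ)
  rw [h.lintegral_gibbsKer Λ ξ hm, h.lintegral_gibbsKer Λ ξ hf]
  congr 1
  refine congrFun (lmarginal_eq_of_subset hΔ ((h.measurable_boltzmann Λ).mul hm)
    ((h.measurable_boltzmann Λ).mul hf) ?_) ξ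
  set R : (V → ℝ) → ENNReal := fun ω =>
    ENNReal.ofReal (Real.exp (-(ham G W P Λ ω - ham G W P Δ ω))) with hR
  have hΛ : boltzmann G W P Λ = R * boltzmann G W P Δ := by
    ext ω
    rw [Pi.mul_apply, hR, boltzmann, boltzmann, ← ENNReal.ofReal_mul (Real.exp_pos _).le,
      ← Real.exp_add]
    congr 2
    ring
  have hRinv : ∀ ω ω' : V → ℝ, (∀ x ∉ Δ, ω x = ω' x) → R ω = R ω' := fun ω ω' hω => by
    simp only [hR, ham_sub_ham_congr G W P h.symm hΔ hω]
  have hFinv : ∀ ω ω' : V → ℝ, (∀ x ∉ Δ, ω x = ω' x) →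
      (∫⁻ η, f η ∂gibbsKer G W P Δ ω) = ∫⁻ η, f η ∂gibbsKer G W P Δ ω' := fun ω ω' hω => by
    rw [h.lintegral_gibbsKer Δ _ hf, h.lintegral_gibbsKer Δ _ hf, h.ofReal_partZ, h.ofReal_partZ,
      lmarginal_congr _ _ hω, lmarginal_congr _ _ hω]
  rw [hΛ, mul_assoc, mul_assoc,
    lmarginal_mul_left_of_invariant Δ ((h.measurable_boltzmann Δ).mul hm) hRinv,
    lmarginal_mul_left_of_invariant Δ ((h.measurable_boltzmann Δ).mul hf) hRinv,
    mul_comm (boltzmann G W P Δ) (fun η => ∫⁻ ω, f ω ∂gibbsKer G W P Δ η),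
    lmarginal_mul_left_of_invariant Δ (h.measurable_boltzmann Δ) hFinv]
  congr 1
  ext η
  rw [Pi.mul_apply, h.lintegral_gibbsKer Δ _ hf, ← h.ofReal_partZ, mul_comm, ← mul_assoc,
    ENNReal.mul_inv_cancel _ ENNReal.ofReal_ne_top, one_mul]
  simpa using h.partZ_pos Δ η

end Kernel

section Feller

variable {G : SimpleGraph V} [∀ v : V, Fintype (G.neighborSet v)] {W : ℝ → ℝ → ℝ} {P : ℝ → ℝ}
  {IW JW r aV cV q : ℝ}

open scoped NNReal BoundedContinuousFunction

/-- A continuous `ℝ≥0`-valued function with an upper bound, as a bounded continuous function. -/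
def nnrealBoundedContinuous {X : Type*} [TopologicalSpace X] {f : X → ℝ≥0} (hf : Continuous f)
    {b : ℝ≥0} (hb : ∀ x, f x ≤ b) : X →ᵇ ℝ≥0 :=
  BoundedContinuousFunction.mkOfBound ⟨f, hf⟩ b fun x y => by
    rw [NNReal.dist_eq]
    exact abs_sub_le_of_nonneg_of_le (f x).2 (hb x) (f y).2 (hb y)

theorem StablePotential.continuous_integral_mul_exp_neg_ham
    (h : StablePotential W P IW JW r aV cV q) (Λ : Finset V) {f : (V → ℝ) → ℝ}
    (hf : Continuous f) {b : ℝ} (hb : ∀ ω, |f ω| ≤ b) :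
    Continuous fun ξ => ∫ σ : ↥Λ → ℝ, f (comb Λ σ ξ) * Real.exp (- ham G W P Λ (comb Λ σ ξ)) := by
  refine continuous_iff_continuousAt.2 fun ξ₀ => ?_
  set M : ℝ := ∑ y ∈ closedNhd G Λ, (|ξ₀ y| + 1)
  have hM : 0 ≤ M := by positivity
  obtain ⟨g, hg, hgξ⟩ := h.exists_integrable_dominating (G := G) Λ h.pair_exponent_pos
    h.exponent_lt le_rfl hM
  have hjoint : Continuous fun z : (↥Λ → ℝ) × (V → ℝ) =>
      f (comb Λ z.1 z.2) * Real.exp (- ham G W P Λ (comb Λ z.1 z.2)) :=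
    (hf.comp (continuous_comb Λ)).mul (h.continuous_exp_neg_ham_comb Λ)
  have hU : ∀ᶠ ξ in nhds ξ₀, ∀ y ∈ closedNhd G Λ, |ξ y| ≤ M := by
    refine (Filter.eventually_all_finset _).2 fun y hy => ?_
    have hlt : |ξ₀ y| < M := lt_of_lt_of_le (lt_add_one _)
      (Finset.single_le_sum (f := fun y => |ξ₀ y| + 1) (fun _ _ => by positivity) hy)
    exact ((continuous_apply y).abs.tendsto ξ₀).eventually_le_const hlt
  refine continuousAt_of_dominated (bound := fun σ => b * g σ)
    (Eventually.of_forall fun ξ => (hjoint.comp (by fun_prop :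
      Continuous fun σ : ↥Λ → ℝ => (σ, ξ))).aestronglyMeasurable) ?_ (hg.const_mul b)
    (Eventually.of_forall fun σ => (hjoint.comp (by fun_prop :
      Continuous fun ξ : V → ℝ => (σ, ξ))).continuousAt)
  filter_upwards [hU] with ξ hξ
  refine Eventually.of_forall fun σ => ?_
  have := hgξ ξ hξ σ
  rw [zero_mul, zero_sub] at this
  rw [norm_mul, Real.norm_eq_abs, Real.norm_eq_abs, abs_of_pos (Real.exp_pos _)]
  exact mul_le_mul (hb _) this (Real.exp_pos _).le ((abs_nonneg _).trans (hb 0))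

/-- The Feller property of the local Gibbs specification. -/
theorem StablePotential.exists_boundedContinuous_lintegral_gibbsKer
    (h : StablePotential W P IW JW r aV cV q) (Λ : Finset V) (f : (V → ℝ) →ᵇ ℝ≥0) :
    ∃ g : (V → ℝ) →ᵇ ℝ≥0, ∀ ξ, (g ξ : ENNReal) = ∫⁻ ω, f ω ∂gibbsKer G W P Λ ξ := by
  have hprob := h.isProbabilityMeasure_gibbsKer (G := G) Λ
  obtain ⟨b, hb⟩ := f.isBounded_range.bddAbove
  have hfb : ∀ ω, f ω ≤ b := fun ω => hb ⟨ω, rfl⟩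
  have hfb' : ∀ ω, |(f ω : ℝ)| ≤ b := fun ω =>
    (abs_of_nonneg (f ω).coe_nonneg).trans_le (NNReal.coe_le_coe.2 (hfb ω))
  have hfc : Continuous fun ω => (f ω : ℝ) := NNReal.continuous_coe.comp f.continuous
  have hle : ∀ ξ, ∫⁻ ω, f ω ∂gibbsKer G W P Λ ξ ≤ b := fun ξ => by
    calc ∫⁻ ω, f ω ∂gibbsKer G W P Λ ξ ≤ ∫⁻ _, (b : ENNReal) ∂gibbsKer G W P Λ ξ :=
          lintegral_mono fun ω => ENNReal.coe_le_coe.2 (hfb ω)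
      _ = b := by simp
  have hpart : Continuous (partZ G W P Λ) := by
    change Continuous fun ξ => partZ G W P Λ ξ
    simpa only [partZ, one_mul] using h.continuous_integral_mul_exp_neg_ham (G := G) Λ
      (f := fun _ => 1) continuous_const (b := 1) (fun _ => by simp)
  have heq : ∀ ξ, (∫⁻ ω, f ω ∂gibbsKer G W P Λ ξ) = ENNReal.ofReal ((partZ G W P Λ ξ)⁻¹ *
      ∫ σ : ↥Λ → ℝ, (f (comb Λ σ ξ) : ℝ) * Real.exp (- ham G W P Λ (comb Λ σ ξ))) := by
    intro ξ
    have hcomb : Continuous fun σ : ↥Λ → ℝ => comb Λ σ ξ :=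
      (continuous_comb Λ).comp (by fun_prop : Continuous fun σ : ↥Λ → ℝ => (σ, ξ))
    have hint : Integrable fun σ : ↥Λ → ℝ =>
        (f (comb Λ σ ξ) : ℝ) * Real.exp (- ham G W P Λ (comb Λ σ ξ)) :=
      (h.integrable_exp_neg_ham (G := G) Λ ξ).bdd_mul
        (hfc.comp hcomb).aestronglyMeasurable (Eventually.of_forall fun σ => hfb' _)
    rw [h.lintegral_gibbsKer Λ ξ (by fun_prop), ENNReal.ofReal_mul (by
      exact (inv_pos.2 (h.partZ_pos Λ ξ)).le), ENNReal.ofReal_inv_of_pos (h.partZ_pos Λ ξ),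
      ofReal_integral_eq_lintegral_ofReal hint
        (Eventually.of_forall fun σ => mul_nonneg (f _).2 (Real.exp_pos _).le)]
    congr 1
    refine lintegral_congr fun σ => ?_
    rw [ENNReal.ofReal_mul (f _).coe_nonneg, ENNReal.ofReal_coe_nnreal, mul_comm]
    rfl
  have hcont : Continuous fun ξ => (∫⁻ ω, f ω ∂gibbsKer G W P Λ ξ).toNNReal := by
    simp only [heq, ENNReal.ofReal, ENNReal.toNNReal_coe]
    exact continuous_real_toNNReal.comp ((hpart.inv₀ fun ξ => (h.partZ_pos Λ ξ).ne').mul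
      (h.continuous_integral_mul_exp_neg_ham Λ hfc hfb'))
  exact ⟨nnrealBoundedContinuous hcont fun ξ => ENNReal.toNNReal_mono ENNReal.coe_ne_top (hle ξ),
    fun ξ => ENNReal.coe_toNNReal ((hle ξ).trans_lt ENNReal.coe_lt_top).ne⟩

end Feller

section SingleSite

variable {G : SimpleGraph V} [∀ v : V, Fintype (G.neighborSet v)] {W : ℝ → ℝ → ℝ} {P : ℝ → ℝ}
  {IW JW r aV cV q : ℝ}

variable (G) in
/-- The vertex weight `m_θ(x) = Σ_{y∼x} [n(x)n(y)]^θ`. -/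
def degreeWeight (θ : ℝ) (x : V) : ℝ :=
  ∑ y ∈ G.neighborFinset x, ((G.degree x : ℝ) * (G.degree y : ℝ)) ^ θ

theorem one_le_degree_of_mem_neighborFinset {x y : V} (hy : y ∈ G.neighborFinset x) :
    (1 : ℝ) ≤ G.degree x := by
  rw [Nat.one_le_cast, ← G.card_neighborFinset_eq_degree]
  exact Finset.card_pos.2 ⟨y, hy⟩

theorem one_le_degree_of_mem_neighborFinset' {x y : V} (hy : y ∈ G.neighborFinset x) :
    (1 : ℝ) ≤ G.degree y :=
  one_le_degree_of_mem_neighborFinset ((mem_neighborFinset_symm G).1 hy)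

theorem one_le_degree_mul_degree {x y : V} (hy : y ∈ G.neighborFinset x) :
    (1 : ℝ) ≤ (G.degree x : ℝ) * G.degree y :=
  one_le_mul_of_one_le_of_one_le (one_le_degree_of_mem_neighborFinset hy)
    (one_le_degree_of_mem_neighborFinset' hy)

theorem degree_mul_rpow_le_degreeWeight {θ : ℝ} (hθ : 0 ≤ θ) (x : V) :
    (G.degree x : ℝ) * (G.degree x : ℝ) ^ θ ≤ degreeWeight G θ x := by
  have : (G.degree x : ℝ) * (G.degree x : ℝ) ^ θ =
      ∑ y ∈ G.neighborFinset x, (G.degree x : ℝ) ^ θ := by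
    rw [Finset.sum_const, nsmul_eq_mul, G.card_neighborFinset_eq_degree]
  rw [this]
  refine Finset.sum_le_sum fun y hy => Real.rpow_le_rpow (by positivity) ?_ hθ
  exact le_mul_of_one_le_right (by positivity) (one_le_degree_of_mem_neighborFinset' hy)

theorem degreeWeight_nonneg (θ : ℝ) (x : V) : 0 ≤ degreeWeight G θ x :=
  Finset.sum_nonneg fun _ _ => by positivity

theorem degree_le_degreeWeight {θ : ℝ} (hθ : 0 ≤ θ) (x : V) :
    (G.degree x : ℝ) ≤ degreeWeight G θ x := by
  rcases Nat.eq_zero_or_pos (G.degree x) with h0 | hpos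
  · rw [h0, Nat.cast_zero]
    exact degreeWeight_nonneg θ x
  · exact (le_mul_of_one_le_right (by positivity)
      (Real.one_le_rpow (by exact_mod_cast hpos) hθ)).trans (degree_mul_rpow_le_degreeWeight hθ x)

theorem ham_singleton_update (W : ℝ → ℝ → ℝ) (P : ℝ → ℝ) (x : V) (ξ : V → ℝ) (u : ℝ) :
    ham G W P {x} (Function.update ξ x u) = ∑ y ∈ G.neighborFinset x, W u (ξ y) + P u := by
  have hx : x ∉ G.neighborFinset x := by simp
  have hy : ∀ y ∈ G.neighborFinset x, y ≠ x := fun y hy h => hx (h ▸ hy)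
  have h1 : G.neighborFinset x ∩ {x} = ∅ := Finset.inter_singleton_of_notMem hx
  have h2 : G.neighborFinset x \ {x} = G.neighborFinset x := by
    rw [Finset.sdiff_singleton_eq_erase, Finset.erase_eq_of_notMem hx]
  simp only [ham, Finset.sum_singleton, h1, h2, Finset.sum_empty, Function.update_self]
  rw [zero_div, zero_add]
  congr 1
  exact Finset.sum_congr rfl fun y h => by rw [Function.update_of_ne (hy y h)]

theorem StablePotential.exists_singleSite_bound (h : StablePotential W P IW JW r aV cV q)
    {θ p t ε : ℝ} (hθ : 0 < θ) (hp : r + r / θ ≤ p) (hpq : p < q) (ht : 0 ≤ t) (hε : 0 < ε) :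
    ∃ L D : ℝ, 0 ≤ L ∧ 0 ≤ D ∧ ∀ (x : V) (ξ : V → ℝ),
      ∫⁻ ω, ENNReal.ofReal (Real.exp (t * |ω x| ^ p)) ∂gibbsKer G W P {x} ξ ≤
        ENNReal.ofReal (Real.exp (L + D * degreeWeight G θ x +
          ∑ y ∈ G.neighborFinset x, ε / ((G.degree x : ℝ) * G.degree y) * |ξ y| ^ p)) := by
  have hr := h.pair_exponent_pos
  have hI := h.pair_const_pos
  have hJ := h.pair_coeff_pos
  have hrp : 0 < p - r := by have := div_pos hr hθ; linarith
  have hp0 : 0 < p := by linarith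
  set e : ℝ := r / (p - r) with he
  have heθ : e ≤ θ := by
    rw [he, div_le_iff₀ hrp]
    have : r / θ * θ ≤ (p - r) * θ := by gcongr; linarith
    rwa [div_mul_cancel₀ _ hθ.ne', mul_comm] at this
  have hint := integrable_exp_rpow_add_rpow_sub_rpow hr hp0 h.exponent_lt hpq h.self_coeff_pos
    le_rfl (add_nonneg ht (half_pos hJ).le)
  set K : ℝ := ∫ u : ℝ, Real.exp (0 * |u| ^ r + (t + JW / 2) * |u| ^ p - aV * |u| ^ q) with hK
  have hKpos : 0 < K := integral_exp_pos hint
  obtain ⟨B, hB⟩ := (isCompact_Icc.image h.continuous_self :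
    IsCompact (P '' Set.Icc (0 : ℝ) 1)).bddAbove
  refine ⟨|cV + B + Real.log K|, IW + JW + JW * (JW / ε) ^ e, abs_nonneg _, by positivity,
    fun x ξ => ?_⟩
  set n : ℝ := (G.degree x : ℝ) with hn
  set m : ℝ := degreeWeight G θ x with hm
  set S : ℝ := ∑ y ∈ G.neighborFinset x, |ξ y| ^ r with hS
  have hn0 : 0 ≤ n := by positivity
  have hnm : n ≤ m := degree_le_degreeWeight hθ.le x
  have hcard : ((G.neighborFinset x).card : ℝ) = n := by rw [G.card_neighborFinset_eq_degree]
  have hsumW : ∀ u, |∑ y ∈ G.neighborFinset x, W u (ξ y)| ≤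
      n * IW / 2 + JW / 2 * (n * |u| ^ r) + JW / 2 * S := fun u => by
    calc _ ≤ ∑ y ∈ G.neighborFinset x, |W u (ξ y)| := Finset.abs_sum_le_sum_abs _ _
      _ ≤ ∑ y ∈ G.neighborFinset x, (IW + JW * (|u| ^ r + |ξ y| ^ r)) / 2 :=
          Finset.sum_le_sum fun y _ => h.pair_bound _ _
      _ = _ := by
          rw [← Finset.sum_div, Finset.sum_add_distrib, ← Finset.mul_sum, Finset.sum_add_distrib]
          simp only [Finset.sum_const, nsmul_eq_mul, hcard, ← hS]
          ring
  have hnu : ∀ u : ℝ, n * |u| ^ r ≤ |u| ^ p + m := fun u => by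
    have h1 := mul_rpow_le_add_of_lt (v := |u|) hr (sub_pos.1 hrp) one_pos hn0 (abs_nonneg u)
    have h2 : n * (n / 1) ^ e ≤ m := by
      rw [div_one]
      rcases Nat.eq_zero_or_pos (G.degree x) with h0 | hpos
      · have : n = 0 := by rw [hn, h0, Nat.cast_zero]
        rw [this, zero_mul]
        exact degreeWeight_nonneg θ x
      · refine le_trans ?_ (degree_mul_rpow_le_degreeWeight hθ.le x)
        exact mul_le_mul_of_nonneg_left
          (Real.rpow_le_rpow_of_exponent_le (Nat.one_le_cast.2 hpos) heθ) hn0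
    linarith
  have hSle : JW * S ≤ ∑ y ∈ G.neighborFinset x, ε / (n * G.degree y) * |ξ y| ^ p +
      JW * (JW / ε) ^ e * m := by
    rw [hS, hm, degreeWeight, Finset.mul_sum, Finset.mul_sum, ← Finset.sum_add_distrib]
    refine Finset.sum_le_sum fun y hy => ?_
    have hk := one_le_degree_mul_degree hy
    rw [← hn] at hk ⊢
    set k : ℝ := n * G.degree y
    have hk0 : 0 < k := by linarith
    have h1 := mul_rpow_le_add_of_lt hr (sub_pos.1 hrp) (div_pos hε hk0) hJ.le (abs_nonneg (ξ y))
    have h2 : (JW / (ε / k)) ^ (r / (p - r)) ≤ (JW / ε) ^ e * k ^ θ := by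
      rw [show JW / (ε / k) = JW / ε * k by field_simp, Real.mul_rpow (by positivity) hk0.le]
      gcongr
    have := mul_le_mul_of_nonneg_left h2 hJ.le
    linarith
  have hfm : Measurable fun ω : V → ℝ => ENNReal.ofReal (Real.exp (t * |ω x| ^ p)) := by
    fun_prop
  rw [h.lintegral_gibbsKer _ _ hfm, h.ofReal_partZ, lmarginal_singleton, lmarginal_singleton]
  have hZ : ENNReal.ofReal (Real.exp (-(n * IW / 2 + JW / 2 * n + JW / 2 * S + B))) ≤
      ∫⁻ u, boltzmann G W P {x} (Function.update ξ x u) := by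
    calc _ = ∫⁻ _ in Set.Icc (0 : ℝ) 1,
          ENNReal.ofReal (Real.exp (-(n * IW / 2 + JW / 2 * n + JW / 2 * S + B))) := by
          simp
      _ ≤ ∫⁻ u in Set.Icc (0 : ℝ) 1, boltzmann G W P {x} (Function.update ξ x u) := by
          refine setLIntegral_mono' measurableSet_Icc fun u hu => ENNReal.ofReal_le_ofReal ?_
          rw [Real.exp_le_exp, ham_singleton_update]
          have h1 := hB ⟨u, hu, rfl⟩
          have h2 := (abs_le.1 (hsumW u)).2
          have h3 : |u| ^ r ≤ 1 := Real.rpow_le_one (abs_nonneg _)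
            (abs_le.2 ⟨by linarith [hu.1], hu.2⟩) hr.le
          have h4 : JW / 2 * (n * |u| ^ r) ≤ JW / 2 * (n * 1) := by gcongr
          linarith
      _ ≤ _ := setLIntegral_le_lintegral _ _
  have hN : ∫⁻ u, (boltzmann G W P {x} * fun ω : V → ℝ =>
      ENNReal.ofReal (Real.exp (t * |ω x| ^ p))) (Function.update ξ x u) ≤
      ENNReal.ofReal (Real.exp (n * IW / 2 + JW / 2 * m + JW / 2 * S + cV + Real.log K)) := by
    rw [Real.exp_add _ (Real.log K), Real.exp_log hKpos, ENNReal.ofReal_mul (Real.exp_pos _).le,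
      hK, ofReal_integral_eq_lintegral_ofReal hint
        (Eventually.of_forall fun _ => (Real.exp_pos _).le),
      ← lintegral_const_mul' _ _ ENNReal.ofReal_ne_top]
    refine lintegral_mono fun u => ?_
    rw [Pi.mul_apply, boltzmann, ← ENNReal.ofReal_mul (Real.exp_pos _).le, ← Real.exp_add,
      ← ENNReal.ofReal_mul (Real.exp_pos _).le, ← Real.exp_add, ham_singleton_update,
      Function.update_self]
    refine ENNReal.ofReal_le_ofReal (Real.exp_le_exp.2 ?_)
    have h1 := (abs_le.1 (hsumW u)).1
    have h2 := h.self_bound u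
    have h3 := mul_le_mul_of_nonneg_left (hnu u) (half_pos hJ).le
    linarith
  have hZtop : ∫⁻ u, boltzmann G W P {x} (Function.update ξ x u) ≠ ⊤ := by
    have := h.ofReal_partZ (G := G) {x} ξ
    rw [lmarginal_singleton] at this
    exact this.symm.trans_ne ENNReal.ofReal_ne_top
  have hZ0 : ∫⁻ u, boltzmann G W P {x} (Function.update ξ x u) ≠ 0 :=
    ((ENNReal.ofReal_pos.2 (Real.exp_pos _)).trans_le hZ).ne'
  rw [ENNReal.inv_mul_le_iff hZ0 hZtop]
  refine (hN.trans ?_).trans (mul_le_mul_left hZ _)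
  rw [← ENNReal.ofReal_mul (Real.exp_pos _).le, ← Real.exp_add]
  refine ENNReal.ofReal_le_ofReal (Real.exp_le_exp.2 ?_)
  have h1 := le_abs_self (cV + B + Real.log K)
  have h2 := mul_le_mul_of_nonneg_left hnm hI.le
  have h3 := mul_le_mul_of_nonneg_left hnm hJ.le
  linarith

end SingleSite

section Holder

/-- Hölder's inequality for exponential moments. -/
theorem lintegral_exp_sum_le {Ω ι : Type*} [MeasurableSpace Ω] (ν : Measure Ω)
    [IsProbabilityMeasure ν] (s : Finset ι) {t n : ι → ℝ} {g : ι → Ω → ℝ}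
    (hg : ∀ i ∈ s, Measurable (g i)) (ht : ∀ i ∈ s, 0 ≤ t i) (hsum : ∑ i ∈ s, t i ≤ 1)
    (hn : ∀ i ∈ s, ∫⁻ ω, ENNReal.ofReal (Real.exp (g i ω)) ∂ν ≤
      ENNReal.ofReal (Real.exp (n i))) :
    ∫⁻ ω, ENNReal.ofReal (Real.exp (∑ i ∈ s, t i * g i ω)) ∂ν ≤
      ENNReal.ofReal (Real.exp (∑ i ∈ s, t i * n i)) := by
  have hrpow : ∀ a b : ℝ, ENNReal.ofReal (Real.exp (a * b)) =
      ENNReal.ofReal (Real.exp b) ^ a := fun a b => by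
    rw [ENNReal.ofReal_rpow_of_pos (Real.exp_pos _), ← Real.exp_mul, mul_comm]
  have hprod : ∀ b : ι → ℝ, ENNReal.ofReal (Real.exp (∑ i ∈ s, t i * b i)) =
      ∏ i ∈ s, ENNReal.ofReal (Real.exp (b i)) ^ t i := fun b => by
    rw [Real.exp_sum, ENNReal.ofReal_prod_of_nonneg fun _ _ => (Real.exp_pos _).le]
    exact Finset.prod_congr rfl fun i _ => hrpow _ _
  have key := ENNReal.lintegral_mul_prod_norm_pow_le (μ := ν) s (g := 1)
    (f := fun i ω => ENNReal.ofReal (Real.exp (g i ω))) aemeasurable_one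
    (fun i hi => (hg i hi).exp.ennreal_ofReal.aemeasurable) (q := 1 - ∑ i ∈ s, t i) (p := t)
    (by ring) (by linarith) ht
  simp only [hprod]
  simp only [Pi.one_apply, ENNReal.one_rpow, one_mul, lintegral_const, measure_univ] at key
  exact key.trans (Finset.prod_le_prod' fun i hi => ENNReal.rpow_le_rpow (hn i hi) (ht i hi))

end Holder

section VolumeBound

variable {G : SimpleGraph V} [∀ v : V, Fintype (G.neighborSet v)] {W : ℝ → ℝ → ℝ} {P : ℝ → ℝ}
  {IW JW r aV cV q : ℝ}

theorem sum_inv_degree_mul_degree_le_one (x : V) :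
    ∑ y ∈ G.neighborFinset x, ((G.degree x : ℝ) * G.degree y)⁻¹ ≤ 1 := by
  calc ∑ y ∈ G.neighborFinset x, ((G.degree x : ℝ) * G.degree y)⁻¹
      ≤ ∑ y ∈ G.neighborFinset x, (G.degree x : ℝ)⁻¹ := Finset.sum_le_sum fun y hy => by
        have h1 := one_le_degree_of_mem_neighborFinset hy
        exact inv_anti₀ (by linarith) (le_mul_of_one_le_right (by linarith)
          (one_le_degree_of_mem_neighborFinset' hy))
    _ ≤ 1 := by
        rw [Finset.sum_const, nsmul_eq_mul, G.card_neighborFinset_eq_degree]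
        exact mul_inv_le_one

theorem sum_sum_neighborFinset_le (Λ : Finset V) {f : V → V → ℝ} (hf : ∀ x y, 0 ≤ f x y) :
    ∑ x ∈ Λ, ∑ y ∈ G.neighborFinset x, f x y ≤
      ∑ y ∈ closedNhd G Λ, ∑ x ∈ G.neighborFinset y, f x y := by
  rw [Finset.sum_comm' (s' := fun y => Λ ∩ G.neighborFinset y) (t' := closedNhd G Λ)]
  · exact Finset.sum_le_sum fun y _ => Finset.sum_le_sum_of_subset_of_nonneg
      Finset.inter_subset_right fun x _ _ => hf x y
  · intro x y
    rw [Finset.mem_inter, mem_neighborFinset_symm]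
    exact ⟨fun hxy => ⟨hxy, mem_closedNhd_of_mem_neighborFinset G hxy.1
      ((mem_neighborFinset_symm G).1 hxy.2)⟩, fun hxy => hxy.1⟩

theorem StablePotential.lintegral_exp_rpow_gibbsKer_ne_top
    (h : StablePotential W P IW JW r aV cV q) {Λ : Finset V} (ξ : V → ℝ) {p t : ℝ} (hp : 0 < p)
    (hpq : p < q) (ht : 0 ≤ t) {x : V} (hx : x ∈ Λ) :
    ∫⁻ ω, ENNReal.ofReal (Real.exp (t * |ω x| ^ p)) ∂gibbsKer G W P Λ ξ ≠ ⊤ := by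
  rw [h.lintegral_gibbsKer Λ ξ (by fun_prop)]
  refine ENNReal.mul_ne_top (ENNReal.inv_ne_top.2 ?_) (ne_top_of_le_ne_top
    (h.integrable_exp (G := G) Λ ξ hp hpq ht).lintegral_lt_top.ne (lintegral_mono fun σ => ?_))
  · simpa using h.partZ_pos Λ ξ
  · rw [Pi.mul_apply, boltzmann, ← ENNReal.ofReal_mul (Real.exp_pos _).le, ← Real.exp_add]
    refine ENNReal.ofReal_le_ofReal (Real.exp_le_exp.2 ?_)
    have := mul_le_mul_of_nonneg_left (Finset.single_le_sum
      (f := fun y => |comb Λ σ ξ y| ^ p) (fun _ _ => by positivity) hx) ht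
    change -ham G W P Λ (comb Λ σ ξ) + t * |comb Λ σ ξ x| ^ p ≤ _
    linarith

theorem StablePotential.exists_log_moment (h : StablePotential W P IW JW r aV cV q)
    (Λ : Finset V) (ξ : V → ℝ) {p t : ℝ} (hp : 0 < p) (hpq : p < q) (ht : 0 ≤ t) :
    ∃ n : V → ℝ, (∀ x, 0 ≤ n x) ∧ (∀ x ∉ Λ, n x = t * |ξ x| ^ p) ∧
      ∀ x, ∫⁻ ω, ENNReal.ofReal (Real.exp (t * |ω x| ^ p)) ∂gibbsKer G W P Λ ξ =
        ENNReal.ofReal (Real.exp (n x)) := by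
  have hprob := h.isProbabilityMeasure_gibbsKer (G := G) Λ ξ
  have hx : ∀ x, ∃ a : ℝ, 0 ≤ a ∧ (x ∉ Λ → a = t * |ξ x| ^ p) ∧
      ∫⁻ ω, ENNReal.ofReal (Real.exp (t * |ω x| ^ p)) ∂gibbsKer G W P Λ ξ =
        ENNReal.ofReal (Real.exp a) := fun x => by
    by_cases hx : x ∈ Λ
    · have htop := h.lintegral_exp_rpow_gibbsKer_ne_top (G := G) ξ hp hpq ht hx
      set I := ∫⁻ ω, ENNReal.ofReal (Real.exp (t * |ω x| ^ p)) ∂gibbsKer G W P Λ ξ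
      have hone : 1 ≤ I := by
        calc (1 : ENNReal) = ∫⁻ _, 1 ∂gibbsKer G W P Λ ξ := by simp
          _ ≤ I := lintegral_mono fun ω => ENNReal.one_le_ofReal.2
            (Real.one_le_exp (by positivity))
      have hone' : 1 ≤ I.toReal := by
        simpa using ENNReal.toReal_mono htop hone
      refine ⟨Real.log I.toReal, Real.log_nonneg hone', fun hx' => absurd hx hx', ?_⟩
      rw [Real.exp_log (by linarith), ENNReal.ofReal_toReal htop]
    · refine ⟨t * |ξ x| ^ p, by positivity, fun _ => rfl, ?_⟩
      have : ∫⁻ ω, ENNReal.ofReal (Real.exp (t * |ω x| ^ p)) ∂gibbsKer G W P Λ ξ =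
          ∫⁻ _, ENNReal.ofReal (Real.exp (t * |ξ x| ^ p)) ∂gibbsKer G W P Λ ξ :=
        lintegral_congr_ae ((ae_gibbsKer_eq_boundary Λ ξ hx).mono fun ω hω => by
          simp only [hω])
      rw [this, lintegral_const, measure_univ, mul_one]
  choose n hn using hx
  exact ⟨n, fun x => (hn x).1, fun x => (hn x).2.1, fun x => (hn x).2.2⟩

/-- Exponential moments of the local Gibbs specification, uniformly in the volume. -/
theorem StablePotential.exists_volume_bound (h : StablePotential W P IW JW r aV cV q)
    {θ p lam E : ℝ} (hθ : 0 < θ) (hp : r + r / θ ≤ p) (hpq : p < q) (hlam : 0 < lam)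
    {w : V → ℝ} [Nonempty V] (hw : ∀ x, 0 < w x) (hE : 1 ≤ E)
    (hwE : ∀ x, ∀ y ∈ G.neighborFinset x, w x ≤ E * w y) (hsum : Summable w)
    (hsumm : Summable fun x => degreeWeight G θ x * w x) :
    ∃ C : ℝ, 0 ≤ C ∧ ∀ (Λ : Finset V) (ξ : V → ℝ), ∀ F ⊆ Λ,
      ∫⁻ ω, ENNReal.ofReal (Real.exp (lam * ∑ x ∈ F, |ω x| ^ p * w x)) ∂gibbsKer G W P Λ ξ ≤
        ENNReal.ofReal
          (Real.exp (C + lam * ∑ y ∈ closedNhd G Λ \ Λ, |ξ y| ^ p * w y)) := by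
  have hr := h.pair_exponent_pos
  have hp0 : 0 < p := by have := div_pos hr hθ; linarith
  have hE0 : 0 < E := by linarith
  set S : ℝ := ∑' x, w x
  have hS0 : 0 < S := hsum.tsum_pos (fun x => (hw x).le) (Classical.arbitrary V) (hw _)
  set t : ℝ := lam * S with ht
  have ht0 : 0 < t := mul_pos hlam hS0
  obtain ⟨L, D, hL, hD, hsite⟩ := h.exists_singleSite_bound (G := G) hθ hp hpq ht0.le
    (show 0 < t / (2 * E) by positivity)
  set M : ℝ := ∑' x, degreeWeight G θ x * w x
  have hM0 : 0 ≤ M := tsum_nonneg fun x => mul_nonneg (degreeWeight_nonneg θ x) (hw x).le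
  refine ⟨2 * (L * S + D * M) / S, by positivity, fun Λ ξ F hF => ?_⟩
  have hprob := h.isProbabilityMeasure_gibbsKer (G := G) Λ ξ
  obtain ⟨n, hn0, hnout, hn⟩ := h.exists_log_moment (G := G) Λ ξ hp0 hpq ht0.le
  have hstep : ∀ x ∈ Λ, n x ≤ L + D * degreeWeight G θ x +
      ∑ y ∈ G.neighborFinset x, (2 * E)⁻¹ * ((G.degree x : ℝ) * G.degree y)⁻¹ * n y := by
    intro x hx
    have hfm : Measurable fun ω : V → ℝ => ENNReal.ofReal (Real.exp (t * |ω x| ^ p)) := by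
      fun_prop
    have hholder := lintegral_exp_sum_le (gibbsKer G W P Λ ξ) (G.neighborFinset x)
      (t := fun y => (2 * E)⁻¹ * ((G.degree x : ℝ) * G.degree y)⁻¹) (n := n)
      (g := fun y ω => t * |ω y| ^ p) (fun y _ => by fun_prop) (fun y _ => by positivity)
      (by
        rw [← Finset.mul_sum]
        exact mul_le_one₀ (inv_le_one_of_one_le₀ (by linarith))
          (Finset.sum_nonneg fun _ _ => by positivity) (sum_inv_degree_mul_degree_le_one x))
      (fun y _ => (hn y).le)
    have hle : ENNReal.ofReal (Real.exp (n x)) ≤ ENNReal.ofReal (Real.exp (L +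
        D * degreeWeight G θ x + ∑ y ∈ G.neighborFinset x,
          (2 * E)⁻¹ * ((G.degree x : ℝ) * G.degree y)⁻¹ * n y)) := by
      rw [← hn x, ← h.lintegral_gibbsKer_gibbsKer (Finset.singleton_subset_iff.2 hx) ξ hfm,
        Real.exp_add, ENNReal.ofReal_mul (Real.exp_pos _).le]
      refine (lintegral_mono fun η => hsite x η).trans ?_
      simp only [Real.exp_add (L + D * degreeWeight G θ x), ENNReal.ofReal_mul (Real.exp_pos _).le]
      rw [lintegral_const_mul' _ _ ENNReal.ofReal_ne_top]
      refine mul_le_mul_right (le_trans (le_of_eq ?_) hholder) _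
      refine lintegral_congr fun η => ?_
      congr 2
      refine Finset.sum_congr rfl fun y _ => ?_
      rw [div_eq_mul_inv, div_eq_mul_inv]
      ring
    rwa [ENNReal.ofReal_le_ofReal_iff (Real.exp_pos _).le, Real.exp_le_exp] at hle
  have hdouble : ∑ x ∈ Λ, ∑ y ∈ G.neighborFinset x,
      w x * ((2 * E)⁻¹ * ((G.degree x : ℝ) * G.degree y)⁻¹ * n y) ≤
        2⁻¹ * ∑ y ∈ closedNhd G Λ, w y * n y := by
    calc _ ≤ ∑ x ∈ Λ, ∑ y ∈ G.neighborFinset x,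
          2⁻¹ * (w y * n y) * ((G.degree y : ℝ) * G.degree x)⁻¹ := by
          refine Finset.sum_le_sum fun x _ => Finset.sum_le_sum fun y hy => ?_
          have h1 : w x * (E⁻¹ * (2⁻¹ * n y * ((G.degree y : ℝ) * G.degree x)⁻¹)) ≤
              E * w y * (E⁻¹ * (2⁻¹ * n y * ((G.degree y : ℝ) * G.degree x)⁻¹)) := by
            have := hn0 y
            exact mul_le_mul_of_nonneg_right (hwE x y hy) (by positivity)
          calc _ = w x * (E⁻¹ * (2⁻¹ * n y * ((G.degree y : ℝ) * G.degree x)⁻¹)) := by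
                rw [mul_inv, mul_comm (G.degree x : ℝ)]; ring
            _ ≤ _ := h1
            _ = _ := by field_simp
      _ ≤ ∑ y ∈ closedNhd G Λ, ∑ x ∈ G.neighborFinset y,
          2⁻¹ * (w y * n y) * ((G.degree y : ℝ) * G.degree x)⁻¹ :=
          sum_sum_neighborFinset_le Λ fun x y => by
            have := hn0 y
            have := hw y
            positivity
      _ ≤ _ := by
          rw [Finset.mul_sum]
          refine Finset.sum_le_sum fun y _ => ?_
          rw [← Finset.mul_sum]
          exact mul_le_of_le_one_right
            (mul_nonneg (by norm_num) (mul_nonneg (hw y).le (hn0 y)))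
            (sum_inv_degree_mul_degree_le_one y)
  have htotal : ∑ x ∈ Λ, w x * n x ≤ 2 * (L * S + D * M) +
      t * ∑ y ∈ closedNhd G Λ \ Λ, |ξ y| ^ p * w y := by
    have h1 : ∑ x ∈ Λ, w x * n x ≤ L * ∑ x ∈ Λ, w x + D * ∑ x ∈ Λ, degreeWeight G θ x * w x +
        ∑ x ∈ Λ, ∑ y ∈ G.neighborFinset x,
          w x * ((2 * E)⁻¹ * ((G.degree x : ℝ) * G.degree y)⁻¹ * n y) := by
      rw [Finset.mul_sum, Finset.mul_sum, ← Finset.sum_add_distrib, ← Finset.sum_add_distrib]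
      refine Finset.sum_le_sum fun x hx => ?_
      rw [← Finset.mul_sum]
      refine (mul_le_mul_of_nonneg_left (hstep x hx) (hw x).le).trans (le_of_eq ?_)
      ring
    have h2 : ∑ x ∈ Λ, w x ≤ S := hsum.sum_le_tsum _ fun x _ => (hw x).le
    have h3 : ∑ x ∈ Λ, degreeWeight G θ x * w x ≤ M := hsumm.sum_le_tsum _ fun x _ =>
      mul_nonneg (degreeWeight_nonneg θ x) (hw x).le
    have h4 := Finset.sum_sdiff (f := fun y => w y * n y) (subset_closedNhd G Λ)
    have h5 : ∑ y ∈ closedNhd G Λ \ Λ, w y * n y =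
        t * ∑ y ∈ closedNhd G Λ \ Λ, |ξ y| ^ p * w y := by
      rw [Finset.mul_sum]
      refine Finset.sum_congr rfl fun y hy => ?_
      rw [hnout y (Finset.mem_sdiff.1 hy).2]
      ring
    have h6 := mul_le_mul_of_nonneg_left h2 hL
    have h7 := mul_le_mul_of_nonneg_left h3 hD
    linarith
  have hfinal := lintegral_exp_sum_le (gibbsKer G W P Λ ξ) F (t := fun x => w x / S) (n := n)
      (g := fun y ω => t * |ω y| ^ p) (fun y _ => by fun_prop)
      (fun y _ => div_nonneg (hw y).le hS0.le)
      (by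
        rw [← Finset.sum_div, div_le_one hS0]
        exact hsum.sum_le_tsum _ fun x _ => (hw x).le)
      (fun y _ => (hn y).le)
  refine le_trans (le_of_eq ?_) (hfinal.trans (ENNReal.ofReal_le_ofReal (Real.exp_le_exp.2 ?_)))
  · refine lintegral_congr fun ω => ?_
    rw [Finset.mul_sum]
    congr 2
    refine Finset.sum_congr rfl fun x _ => ?_
    rw [ht]
    field_simp
  · calc ∑ x ∈ F, w x / S * n x = (∑ x ∈ F, w x * n x) / S := by
          rw [Finset.sum_div]
          exact Finset.sum_congr rfl fun x _ => by ring
      _ ≤ (∑ x ∈ Λ, w x * n x) / S := by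
          refine div_le_div_of_nonneg_right ?_ hS0.le
          exact Finset.sum_le_sum_of_subset_of_nonneg hF
            fun x _ _ => mul_nonneg (hw x).le (hn0 x)
      _ ≤ (2 * (L * S + D * M) + t * ∑ y ∈ closedNhd G Λ \ Λ, |ξ y| ^ p * w y) / S := by
          gcongr
      _ = _ := by
          rw [ht, add_div]
          congr 1
          field_simp

end VolumeBound

section InfiniteVolume

open scoped ENNReal Topology

variable {G : SimpleGraph V} [∀ v : V, Fintype (G.neighborSet v)] {W : ℝ → ℝ → ℝ} {P : ℝ → ℝ}
  {IW JW r aV cV q : ℝ}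

theorem lintegral_le_of_tendsto {Ω ι : Type*} [MeasurableSpace Ω] {μ : Measure Ω} {u : Filter ι}
    [u.NeBot] [u.IsCountablyGenerated] {F : ι → Ω → ℝ≥0∞} {f : Ω → ℝ≥0∞} {C : ℝ≥0∞}
    (hF : ∀ i, Measurable (F i)) (hlim : ∀ᵐ ω ∂μ, Tendsto (fun i => F i ω) u (𝓝 (f ω)))
    (hC : ∀ᶠ i in u, ∫⁻ ω, F i ω ∂μ ≤ C) : ∫⁻ ω, f ω ∂μ ≤ C := by
  calc ∫⁻ ω, f ω ∂μ = ∫⁻ ω, liminf (fun i => F i ω) u ∂μ :=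
        lintegral_congr_ae (hlim.mono fun ω hω => hω.liminf_eq.symm)
    _ ≤ liminf (fun i => ∫⁻ ω, F i ω ∂μ) u := lintegral_liminf_le hF
    _ ≤ C := liminf_le_of_frequently_le' hC.frequently

theorem IsGibbsMeasure.lintegral_eq {μ : Measure (V → ℝ)} (hμ : IsGibbsMeasure G W P μ)
    (h : StablePotential W P IW JW r aV cV q) (Λ : Finset V) {f : (V → ℝ) → ℝ≥0∞}
    (hf : Measurable f) :
    ∫⁻ ω, f ω ∂μ = ∫⁻ ξ, ∫⁻ ω, f ω ∂gibbsKer G W P Λ ξ ∂μ := by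
  have hm := (h.measurable_gibbsKer (G := G) Λ).aemeasurable (μ := μ)
  have : μ = μ.bind (gibbsKer G W P Λ) := Measure.ext fun A hA => by
    rw [Measure.bind_apply hA hm]
    exact hμ.2 Λ A hA
  conv_lhs => rw [this]
  exact Measure.lintegral_bind hm hf.aemeasurable

/-- The exponential of `lam` times the weighted `p`-norm (to the power `p`) restricted to `F`. -/
def expEnergy (w : V → ℝ) (p lam : ℝ) (F : Finset V) (ω : V → ℝ) : ℝ≥0∞ :=
  ENNReal.ofReal (Real.exp (lam * ∑ x ∈ F, |ω x| ^ p * w x))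

theorem continuous_expEnergy (w : V → ℝ) {p : ℝ} (hp : 0 ≤ p) (lam : ℝ) (F : Finset V) :
    Continuous (expEnergy w p lam F) := by
  refine ENNReal.continuous_ofReal.comp (Real.continuous_exp.comp (continuous_const.mul
    (continuous_finsetSum _ fun x _ => ?_)))
  exact ((continuous_apply x).abs.rpow_const fun _ => Or.inr hp).mul continuous_const

theorem tendsto_sum_closedNhd_sdiff {f : V → ℝ} (hf : Summable f) :
    Tendsto (fun Λ => ∑ y ∈ closedNhd G Λ \ Λ, f y) atTop (𝓝 0) := by
  have hcl : Tendsto (closedNhd G) atTop atTop :=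
    tendsto_atTop_mono (subset_closedNhd G) tendsto_id
  have := (hf.hasSum.comp hcl).sub hf.hasSum
  rw [sub_self] at this
  refine this.congr fun Λ => ?_
  simp only [Function.comp_apply]
  rw [← Finset.sum_sdiff (subset_closedNhd G Λ), add_sub_cancel_right]

/-- Passing from the volume bound for the specification to tempered Gibbs measures. -/
theorem IsGibbsMeasure.lintegral_expEnergy_le {μ : Measure (V → ℝ)}
    (hμ : IsGibbsMeasure G W P μ) (h : StablePotential W P IW JW r aV cV q) {w : V → ℝ}
    {p lam C : ℝ} (hp : 0 ≤ p)
    (hvol : ∀ (Λ : Finset V) (ξ : V → ℝ), ∀ F ⊆ Λ,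
      ∫⁻ ω, expEnergy w p lam F ω ∂gibbsKer G W P Λ ξ ≤
        ENNReal.ofReal (Real.exp (C + lam * ∑ y ∈ closedNhd G Λ \ Λ, |ξ y| ^ p * w y)))
    (htemp : ∀ᵐ ω ∂μ, Summable fun x => |ω x| ^ p * w x) (F : Finset V) :
    ∫⁻ ω, expEnergy w p lam F ω ∂μ ≤ ENNReal.ofReal (Real.exp C) := by
  have hprob := hμ.1
  have hm := (continuous_expEnergy w hp lam F).measurable
  have htail : ∀ Λ : Finset V, Measurable fun ξ : V → ℝ =>
      ENNReal.ofReal (Real.exp (C + lam * ∑ y ∈ closedNhd G Λ \ Λ, |ξ y| ^ p * w y)) := by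
    fun_prop
  have htrunc : ∀ N : ℕ, ∫⁻ ω, min (expEnergy w p lam F ω) N ∂μ ≤
      ENNReal.ofReal (Real.exp C) := fun N => by
    have hlim : Tendsto (fun Λ : Finset V => ∫⁻ ξ, min (ENNReal.ofReal (Real.exp
        (C + lam * ∑ y ∈ closedNhd G Λ \ Λ, |ξ y| ^ p * w y))) (N : ℝ≥0∞) ∂μ) atTop
        (𝓝 (∫⁻ _, min (ENNReal.ofReal (Real.exp C)) (N : ℝ≥0∞) ∂μ)) := by
      refine tendsto_lintegral_filter_of_dominated_convergence (fun _ => (N : ℝ≥0∞))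
        (Eventually.of_forall fun Λ => (htail Λ).min measurable_const)
        (Eventually.of_forall fun Λ => Eventually.of_forall fun ξ => min_le_right _ _)
        (by simp) (htemp.mono fun ξ hξ => ?_)
      refine Tendsto.min
        ((ENNReal.continuous_ofReal.comp Real.continuous_exp).continuousAt.tendsto.comp ?_)
        tendsto_const_nhds
      simpa using ((tendsto_sum_closedNhd_sdiff (G := G) hξ).const_mul lam).const_add C
    refine (ge_of_tendsto hlim ?_).trans (by simp)
    filter_upwards [eventually_ge_atTop F] with Λ hΛ
    rw [hμ.lintegral_eq h Λ (hm.min measurable_const)]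
    refine lintegral_mono fun ξ => le_min ?_ ?_
    · exact (lintegral_mono fun ω => min_le_left _ _).trans (hvol Λ ξ F hΛ)
    · have := h.isProbabilityMeasure_gibbsKer (G := G) Λ ξ
      exact (lintegral_mono fun ω => min_le_right _ _).trans (by simp)
  refine lintegral_le_of_tendsto (u := atTop) (fun N : ℕ => hm.min measurable_const)
    (Eventually.of_forall fun ω => ?_) (Eventually.of_forall htrunc)
  simpa using (tendsto_const_nhds (x := expEnergy w p lam F ω)).min ENNReal.tendsto_nat_nhds_top

theorem lintegral_exp_tsum_le {μ : Measure (V → ℝ)} {w : V → ℝ} {p lam : ℝ} {C : ℝ≥0∞}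
    (hp : 0 ≤ p) (hF : ∀ F, ∫⁻ ω, expEnergy w p lam F ω ∂μ ≤ C)
    (htemp : ∀ᵐ ω ∂μ, Summable fun x => |ω x| ^ p * w x) :
    ∫⁻ ω, ENNReal.ofReal (Real.exp (lam * ∑' x, |ω x| ^ p * w x)) ∂μ ≤ C := by
  refine lintegral_le_of_tendsto (u := (atTop : Filter (Finset V)))
    (fun F => (continuous_expEnergy w hp lam F).measurable)
    (htemp.mono fun ω hω => ?_) (Eventually.of_forall hF)
  exact (ENNReal.continuous_ofReal.comp
    (Real.continuous_exp.comp (continuous_const.mul continuous_id))).continuousAt.tendsto.comp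
    hω.hasSum

theorem lintegral_tsum_le_of_lintegral_expEnergy_le {μ : Measure (V → ℝ)} {w : V → ℝ}
    (hw : ∀ x, 0 ≤ w x) {p lam : ℝ} (hlam : 0 ≤ lam) {C : ℝ≥0∞}
    (hF : ∀ F, ∫⁻ ω, expEnergy w p lam F ω ∂μ ≤ C) :
    ∫⁻ ω, ∑' x, ENNReal.ofReal (lam * (|ω x| ^ p * w x)) ∂μ ≤ C := by
  have hm : ∀ x, Measurable fun ω : V → ℝ => ENNReal.ofReal (lam * (|ω x| ^ p * w x)) := by
    fun_prop
  rw [lintegral_tsum fun x => (hm x).aemeasurable]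
  refine ENNReal.summable.tsum_le_of_sum_le fun F => ?_
  rw [← lintegral_finsetSum _ fun x _ => hm x]
  refine (lintegral_mono fun ω => ?_).trans (hF F)
  rw [← ENNReal.ofReal_sum_of_nonneg fun x _ => mul_nonneg hlam
    (mul_nonneg (by positivity) (hw x)), ← Finset.mul_sum]
  exact ENNReal.ofReal_le_ofReal ((lt_add_one _).le.trans (Real.add_one_le_exp _))

theorem ae_summable_of_lintegral_expEnergy_le {μ : Measure (V → ℝ)} {w : V → ℝ}
    (hw : ∀ x, 0 ≤ w x) {p lam : ℝ} (hlam : 0 < lam) {C : ℝ≥0∞} (hC : C ≠ ⊤)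
    (hF : ∀ F, ∫⁻ ω, expEnergy w p lam F ω ∂μ ≤ C) :
    ∀ᵐ ω ∂μ, Summable fun x => |ω x| ^ p * w x := by
  have hm : ∀ x, Measurable fun ω : V → ℝ => ENNReal.ofReal (lam * (|ω x| ^ p * w x)) := by
    fun_prop
  filter_upwards [ae_lt_top (Measurable.tsum hm) (ne_top_of_le_ne_top hC
    (lintegral_tsum_le_of_lintegral_expEnergy_le hw hlam.le hF))] with ω hω
  have := ENNReal.summable_toReal hω.ne
  have hnn : ∀ x, 0 ≤ lam * (|ω x| ^ p * w x) := fun x =>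
    mul_nonneg hlam.le (mul_nonneg (by positivity) (hw x))
  simp only [ENNReal.toReal_ofReal (hnn _)] at this
  exact (summable_mul_left_iff hlam.ne').1 this

end InfiniteVolume

section WeakTopology

open scoped ENNReal NNReal Topology BoundedContinuousFunction

variable {G : SimpleGraph V} [∀ v : V, Fintype (G.neighborSet v)] {W : ℝ → ℝ → ℝ} {P : ℝ → ℝ}
  {IW JW r aV cV q : ℝ}

theorem continuous_lintegral_boundedContinuous {X : Type*} [MeasurableSpace X]
    [TopologicalSpace X] [OpensMeasurableSpace X] (f : X →ᵇ ℝ≥0) :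
    Continuous fun ν : ProbabilityMeasure X => ∫⁻ x, f x ∂(ν : Measure X) :=
  continuous_iff_continuousAt.2 fun _ =>
    ProbabilityMeasure.tendsto_iff_forall_lintegral_tendsto.1 tendsto_id f

theorem isClosed_setOf_lintegral_le {X : Type*} [MeasurableSpace X]
    [TopologicalSpace X] [OpensMeasurableSpace X] {f : X → ℝ≥0∞} (hf : Continuous f)
    (C : ℝ≥0∞) : IsClosed {ν : ProbabilityMeasure X | ∫⁻ x, f x ∂(ν : Measure X) ≤ C} := by
  have hne : ∀ (N : ℕ) x, min (f x) N ≠ ⊤ := fun N x =>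
    ((min_le_right _ _).trans_lt (ENNReal.natCast_lt_top N)).ne
  have hcont : ∀ N : ℕ, Continuous fun x => (min (f x) N).toNNReal := fun N =>
    ENNReal.continuousOn_toNNReal.comp_continuous (hf.min continuous_const) (hne N)
  have heq : {ν : ProbabilityMeasure X | ∫⁻ x, f x ∂(ν : Measure X) ≤ C} =
      ⋂ N : ℕ, {ν : ProbabilityMeasure X | ∫⁻ x, nnrealBoundedContinuous (hcont N) (b := N)
        (fun x => ENNReal.toNNReal_mono (ENNReal.natCast_ne_top N) (min_le_right _ _)) x
          ∂(ν : Measure X) ≤ C} := by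
    ext ν
    have hcoe : ∀ (N : ℕ) x, (((min (f x) N).toNNReal : ℝ≥0) : ℝ≥0∞) = min (f x) N :=
      fun N x => ENNReal.coe_toNNReal (hne N x)
    simp only [Set.mem_iInter, Set.mem_ofPred_eq]
    change _ ↔ ∀ N : ℕ, ∫⁻ x, ((min (f x) N).toNNReal : ℝ≥0) ∂(ν : Measure X) ≤ C
    simp only [hcoe]
    refine ⟨fun h N => (lintegral_mono fun x => min_le_left _ _).trans h, fun h => ?_⟩
    refine lintegral_le_of_tendsto (u := atTop)
      (fun N : ℕ => (hf.min continuous_const).measurable)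
      (Eventually.of_forall fun x => ?_) (Eventually.of_forall h)
    simpa using (tendsto_const_nhds (x := f x)).min ENNReal.tendsto_nat_nhds_top
  rw [heq]
  exact isClosed_iInter fun N =>
    isClosed_le (continuous_lintegral_boundedContinuous _) continuous_const

/-- The probability measures whose exponential moments of the weighted norm are bounded by `C`. -/
def momentSet (w : V → ℝ) (p lam : ℝ) (C : ℝ≥0∞) : Set (ProbabilityMeasure (V → ℝ)) :=
  {ν | ∀ F, ∫⁻ ω, expEnergy w p lam F ω ∂(ν : Measure (V → ℝ)) ≤ C}

theorem isClosed_momentSet (w : V → ℝ) {p : ℝ} (hp : 0 ≤ p) (lam : ℝ) (C : ℝ≥0∞) :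
    IsClosed (momentSet w p lam C) := by
  rw [momentSet, Set.ofPred_forall]
  exact isClosed_iInter fun F => isClosed_setOf_lintegral_le (continuous_expEnergy w hp lam F) C

theorem isTightMeasureSet_momentSet {w : V → ℝ} (hw : ∀ x, 0 < w x) {p lam : ℝ} (hp : 0 < p)
    (hlam : 0 < lam) {C : ℝ≥0∞} (hC : C ≠ ⊤) :
    IsTightMeasureSet {((ν : ProbabilityMeasure (V → ℝ)) : Measure (V → ℝ)) |
      ν ∈ momentSet w p lam C} := by
  refine isTightMeasureSet_iff_exists_isCompact_measure_compl_le.2 fun ε hε => ?_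
  rcases eq_or_ne ε ⊤ with rfl | hεtop
  · exact ⟨∅, isCompact_empty, fun _ _ => le_top⟩
  set M : ℝ := (C / ε).toReal + 1
  have hM0 : 0 < M := by positivity
  set b : V → ℝ := fun x => (M / (lam * w x)) ^ p⁻¹ with hb
  refine ⟨Set.univ.pi fun x => Set.Icc (-b x) (b x), isCompact_univ_pi fun x => isCompact_Icc, ?_⟩
  rintro _ ⟨ν, hν, rfl⟩
  have hm : Measurable fun ω : V → ℝ => ∑' x, ENNReal.ofReal (lam * (|ω x| ^ p * w x)) :=
    Measurable.tsum fun x => by fun_prop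
  have hsub : (Set.univ.pi fun x => Set.Icc (-b x) (b x))ᶜ ⊆
      {ω : V → ℝ | ENNReal.ofReal M ≤ ∑' x, ENNReal.ofReal (lam * (|ω x| ^ p * w x))} := by
    intro ω hω
    simp only [Set.mem_compl_iff, Set.mem_univ_pi, not_forall] at hω
    obtain ⟨x, hx⟩ := hω
    have hbx : b x < |ω x| := not_le.1 fun hle => hx (abs_le.1 hle)
    have hwx := mul_pos hlam (hw x)
    have h1 : M / (lam * w x) ≤ |ω x| ^ p := by
      have := Real.rpow_le_rpow (by positivity) hbx.le hp.le
      rwa [hb, ← Real.rpow_mul (by positivity), inv_mul_cancel₀ hp.ne', Real.rpow_one] at this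
    rw [div_le_iff₀ hwx] at h1
    refine (ENNReal.ofReal_le_ofReal ?_).trans (ENNReal.le_tsum x)
    linarith
  calc (ν : Measure (V → ℝ)) _ ≤ (ν : Measure (V → ℝ)) _ := measure_mono hsub
    _ ≤ (∫⁻ ω, ∑' x, ENNReal.ofReal (lam * (|ω x| ^ p * w x)) ∂(ν : Measure (V → ℝ))) /
        ENNReal.ofReal M := meas_ge_le_lintegral_div hm.aemeasurable
          (ENNReal.ofReal_pos.2 hM0).ne' ENNReal.ofReal_ne_top
    _ ≤ C / ENNReal.ofReal M := by
        gcongr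
        exact lintegral_tsum_le_of_lintegral_expEnergy_le (fun x => (hw x).le) hlam.le hν
    _ ≤ ε := by
        refine ENNReal.div_le_of_le_mul ?_
        rw [mul_comm, ← ENNReal.div_le_iff hε.ne' hεtop,
          ← ENNReal.ofReal_toReal (ENNReal.div_ne_top hC hε.ne')]
        exact ENNReal.ofReal_le_ofReal (lt_add_one _).le

theorem isCompact_momentSet {w : V → ℝ} (hw : ∀ x, 0 < w x) {p lam : ℝ} (hp : 0 < p)
    (hlam : 0 < lam) {C : ℝ≥0∞} (hC : C ≠ ⊤) : IsCompact (momentSet w p lam C) := by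
  rw [← (isClosed_momentSet w hp.le lam C).closure_eq]
  exact isCompact_closure_of_isTightMeasureSet (isTightMeasureSet_momentSet hw hp hlam hC)

theorem StablePotential.isGibbsMeasure_iff (h : StablePotential W P IW JW r aV cV q)
    (ν : ProbabilityMeasure (V → ℝ)) :
    IsGibbsMeasure G W P ν ↔ ∀ (Λ : Finset V) (f : (V → ℝ) →ᵇ ℝ≥0),
      ∫⁻ ω, f ω ∂(ν : Measure (V → ℝ)) =
        ∫⁻ ξ, ∫⁻ ω, f ω ∂gibbsKer G W P Λ ξ ∂(ν : Measure (V → ℝ)) := by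
  refine ⟨fun hν Λ f => hν.lintegral_eq h Λ f.measurable_coe_ennreal_comp,
    fun hν => ⟨inferInstance, fun Λ A hA => ?_⟩⟩
  have hm := h.measurable_gibbsKer (G := G) Λ
  have hprob := h.isProbabilityMeasure_gibbsKer (G := G) Λ
  have hbind : IsProbabilityMeasure ((ν : Measure (V → ℝ)).bind (gibbsKer G W P Λ)) :=
    isProbabilityMeasure_bind hm.aemeasurable (Eventually.of_forall hprob)
  have : (ν : Measure (V → ℝ)) = (ν : Measure (V → ℝ)).bind (gibbsKer G W P Λ) :=
    ext_of_forall_lintegral_eq_of_IsFiniteMeasure fun f => by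
      rw [hν Λ f, Measure.lintegral_bind hm.aemeasurable f.measurable_coe_ennreal_comp.aemeasurable]
  conv_lhs => rw [this]
  exact Measure.bind_apply hA hm.aemeasurable

theorem StablePotential.isClosed_setOf_isGibbsMeasure
    (h : StablePotential W P IW JW r aV cV q) :
    IsClosed {ν : ProbabilityMeasure (V → ℝ) | IsGibbsMeasure G W P ν} := by
  simp only [h.isGibbsMeasure_iff, Set.ofPred_forall]
  refine isClosed_iInter fun Λ => isClosed_iInter fun f => ?_
  obtain ⟨g, hg⟩ := h.exists_boundedContinuous_lintegral_gibbsKer (G := G) Λ f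
  simp only [← hg]
  exact isClosed_eq (continuous_lintegral_boundedContinuous f)
    (continuous_lintegral_boundedContinuous g)

/-- Existence of a Gibbs measure as a limit of the local Gibbs specification with zero boundary
condition. -/
theorem StablePotential.exists_isGibbsMeasure_mem_momentSet
    (h : StablePotential W P IW JW r aV cV q) {w : V → ℝ} (hw : ∀ x, 0 < w x) {p lam C : ℝ}
    (hp : 0 < p) (hlam : 0 < lam)
    (hvol : ∀ (Λ : Finset V) (ξ : V → ℝ), ∀ F ⊆ Λ,
      ∫⁻ ω, expEnergy w p lam F ω ∂gibbsKer G W P Λ ξ ≤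
        ENNReal.ofReal (Real.exp (C + lam * ∑ y ∈ closedNhd G Λ \ Λ, |ξ y| ^ p * w y))) :
    ∃ ν ∈ momentSet w p lam (ENNReal.ofReal (Real.exp C)), IsGibbsMeasure G W P ν := by
  set γ : Finset V → ProbabilityMeasure (V → ℝ) := fun Λ =>
    ⟨gibbsKer G W P Λ 0, h.isProbabilityMeasure_gibbsKer Λ 0⟩
  have hmem : ∀ Λ, γ Λ ∈ momentSet w p lam (ENNReal.ofReal (Real.exp C)) := fun Λ F => by
    have hout : ∀ᵐ ω ∂gibbsKer G W P Λ 0, ∀ x ∉ Λ, ω x = 0 := by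
      refine ae_all_iff.2 fun x => ?_
      by_cases hx : x ∈ Λ
      · exact Eventually.of_forall fun ω hx' => absurd hx hx'
      · exact (ae_gibbsKer_eq_boundary Λ 0 hx).mono fun ω hω _ => hω
    have hle := hvol Λ 0 (F ∩ Λ) Finset.inter_subset_right
    have h0 : ∑ y ∈ closedNhd G Λ \ Λ, |(0 : V → ℝ) y| ^ p * w y = 0 :=
      Finset.sum_eq_zero fun y _ => by simp [Real.zero_rpow hp.ne']
    rw [h0, mul_zero, add_zero] at hle
    refine le_trans (le_of_eq (lintegral_congr_ae (hout.mono fun ω hω => ?_))) hle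
    simp only [expEnergy]
    congr 3
    refine (Finset.sum_subset Finset.inter_subset_left fun x hxF hx => ?_).symm
    rw [hω x fun hxΛ => hx (Finset.mem_inter.2 ⟨hxF, hxΛ⟩), abs_zero, Real.zero_rpow hp.ne',
      zero_mul]
  set U : Ultrafilter (Finset V) := Ultrafilter.of atTop
  have hUle : (U : Filter (Finset V)) ≤ atTop := Ultrafilter.of_le atTop
  obtain ⟨ν, hν, hlim⟩ := (isCompact_momentSet hw hp hlam ENNReal.ofReal_ne_top).ultrafilter_le_nhds
    (U.map γ) (tendsto_principal.2 (Eventually.of_forall hmem))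
  have htendsto : Tendsto γ U (𝓝 ν) := hlim
  refine ⟨ν, hν, (h.isGibbsMeasure_iff ν).2 fun Δ f => ?_⟩
  obtain ⟨g, hg⟩ := h.exists_boundedContinuous_lintegral_gibbsKer (G := G) Δ f
  have hf := (continuous_lintegral_boundedContinuous f).continuousAt.tendsto.comp htendsto
  have hg' := (continuous_lintegral_boundedContinuous g).continuousAt.tendsto.comp htendsto
  simp only [← hg]
  refine tendsto_nhds_unique hf (hg'.congr' (hUle ?_))
  filter_upwards [eventually_ge_atTop Δ] with Λ hΛ
  simp only [Function.comp_apply, hg]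
  exact h.lintegral_gibbsKer_gibbsKer hΛ 0 f.measurable_coe_ennreal_comp

end WeakTopology

section Weight

variable {G : SimpleGraph V}

theorem wgt_pos (G : SimpleGraph V) (o : V) (α : ℝ) (x : V) : 0 < wgt G o α x := Real.exp_pos _

theorem wgt_le_exp_mul (hconn : G.Connected) (o : V) (α : ℝ) {x y : V} (hxy : G.Adj x y) :
    wgt G o α x ≤ Real.exp |α| * wgt G o α y := by
  have hyx : G.dist y x = 1 := SimpleGraph.dist_eq_one_iff_adj.2 hxy.symm
  have hxy' : G.dist x y = 1 := SimpleGraph.dist_eq_one_iff_adj.2 hxy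
  have h1 : (G.dist o x : ℝ) ≤ G.dist o y + 1 := by
    exact_mod_cast hyx ▸ hconn.dist_triangle (u := o) (v := y) (w := x)
  have h2 : (G.dist o y : ℝ) ≤ G.dist o x + 1 := by
    exact_mod_cast hxy' ▸ hconn.dist_triangle (u := o) (v := x) (w := y)
  rw [wgt, wgt, ← Real.exp_add, Real.exp_le_exp]
  have habs : |(G.dist o y : ℝ) - G.dist o x| ≤ 1 := abs_le.2 ⟨by linarith, by linarith⟩
  have := (le_abs_self _).trans ((abs_mul α (G.dist o y - G.dist o x : ℝ)).trans_le
    (mul_le_of_le_one_right (abs_nonneg α) habs))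
  linarith

theorem ThetaFin.summable_wgt [∀ v : V, Fintype (G.neighborSet v)] {o : V} {α θ : ℝ}
    (h : ThetaFin G o α θ) (hconn : G.Connected) (hθ : 0 ≤ θ) : Summable (wgt G o α) := by
  rcases subsingleton_or_nontrivial V with hV | hV
  · exact Summable.of_finite
  · refine Summable.of_nonneg_of_le (fun x => (wgt_pos G o α x).le) (fun x => ?_) h
    have hdeg : (1 : ℝ) ≤ G.degree x := by
      exact_mod_cast hconn.preconnected.degree_pos_of_nontrivial x
    exact le_mul_of_one_le_left (wgt_pos G o α x).le (hdeg.trans (degree_le_degreeWeight hθ x))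

theorem measurableSet_tempered (G : SimpleGraph V) (o : V) (p α : ℝ) :
    MeasurableSet (tempered G o p α) := by
  have hm : Measurable fun ω : V → ℝ => ∑' x, ENNReal.ofReal (|ω x| ^ p * wgt G o α x) :=
    Measurable.tsum fun x => by fun_prop
  convert (measurableSet_singleton ⊤).compl.preimage hm using 1
  ext ω
  have hnn : ∀ x, 0 ≤ |ω x| ^ p * wgt G o α x := fun x =>
    mul_nonneg (by positivity) (wgt_pos G o α x).le
  refine ⟨fun hω => hω.tsum_ofReal_ne_top, fun hω => ?_⟩
  exact (ENNReal.summable_toReal hω).congr fun x => ENNReal.toReal_ofReal (hnn x)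

theorem measure_tempered_eq_one_iff {o : V} {p α : ℝ} (μ : Measure (V → ℝ))
    [IsProbabilityMeasure μ] :
    μ (tempered G o p α) = 1 ↔ ∀ᵐ ω ∂μ, Summable fun x => |ω x| ^ p * wgt G o α x :=
  (mem_ae_iff_prob_eq_one (measurableSet_tempered G o p α)).symm

end Weight

/-- **Extended theorem (Theorem 3).** For every `α ∈ (α_, ᾱ]` and `p ∈ [p₀, q)`
(where `p₀ = r + r/θ`, `α_ = inf{α : Θ(α,θ) < ∞}` and `Θ(α,θ) < ∞` on `(α_, ᾱ]`):
(i) `𝒢_{p,α}` is non-empty and weakly compact;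
(ii) for every `λ > 0` and `x ∈ V` there is `C(p,α;λ,x) > 0` with
`∫ exp(λ|ω(x)|^p) dμ ≤ C(p,α;λ,x)` for all `μ ∈ 𝒢_{p,α}`;
(iii) for every `λ > 0` there is `C(p,α;λ) > 0` with
`∫ exp(λ‖ω‖_{p,α}^p) dμ ≤ C(p,α;λ)` for all `μ ∈ 𝒢_{p,α}`. -/
theorem extended_theorem_tempered_gibbs_fields
    (G : SimpleGraph V) [∀ v : V, Fintype (G.neighborSet v)] (hconn : G.Connected)
    (o : V) (θ : ℝ) (hθ : 0 < θ)
    (αlow αbar : ℝ) (hαlow : αlow = sInf {α : ℝ | ThetaFin G o α θ})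
    (hbar : αlow < αbar) (hΘ : ∀ α ∈ Set.Ioc αlow αbar, ThetaFin G o α θ)
    (W : ℝ → ℝ → ℝ) (hWcont : Continuous (Function.uncurry W))
    (hWsym : ∀ u v : ℝ, W u v = W v u)
    (IW JW r : ℝ) (hIW : 0 < IW) (hJW : 0 < JW) (hr : 0 < r)
    (hW : ∀ u v : ℝ, |W u v| ≤ (IW + JW * (|u| ^ r + |v| ^ r)) / 2)
    (P : ℝ → ℝ) (hPcont : Continuous P)
    (aV cV q : ℝ) (haV : 0 < aV) (hcV : 0 < cV) (hq : r + r / θ < q)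
    (hP : ∀ u : ℝ, aV * |u| ^ q - cV ≤ P u)
    (p0 : ℝ) (hp0 : p0 = r + r / θ) :
    ∀ α ∈ Set.Ioc αlow αbar, ∀ p ∈ Set.Ico p0 q,
    (Set.Nonempty {ν : ProbabilityMeasure (V → ℝ) |
        IsGibbsMeasure G W P ν.toMeasure ∧ ν.toMeasure (tempered G o p α) = 1}) ∧
    IsCompact {ν : ProbabilityMeasure (V → ℝ) |
        IsGibbsMeasure G W P ν.toMeasure ∧ ν.toMeasure (tempered G o p α) = 1} ∧
    (∀ lam : ℝ, 0 < lam → ∀ x : V, ∃ C : ℝ, 0 < C ∧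
      ∀ μ : Measure (V → ℝ), IsGibbsMeasure G W P μ → μ (tempered G o p α) = 1 →
        ∫⁻ ω, ENNReal.ofReal (Real.exp (lam * |ω x| ^ p)) ∂μ ≤ ENNReal.ofReal C) ∧
    (∀ lam : ℝ, 0 < lam → ∃ C : ℝ, 0 < C ∧
      ∀ μ : Measure (V → ℝ), IsGibbsMeasure G W P μ → μ (tempered G o p α) = 1 →
        ∫⁻ ω, ENNReal.ofReal (Real.exp (lam * sNorm G o p α ω)) ∂μ ≤ ENNReal.ofReal C) := by
  subst hp0
  rintro α hα p ⟨hp0, hpq⟩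
  have hrθ : 0 < r / θ := by positivity
  have hp : 0 < p := by linarith
  have hstable : StablePotential W P IW JW r aV cV q :=
    ⟨hWcont, hWsym, hIW, hJW, hr, hW, hPcont, haV, by linarith, hP⟩
  have hsumm := hΘ α hα
  have hw := wgt_pos G o α
  have hvol : ∀ lam : ℝ, 0 < lam → ∃ C : ℝ, ∀ (Λ : Finset V) (ξ : V → ℝ), ∀ F ⊆ Λ,
      ∫⁻ ω, expEnergy (wgt G o α) p lam F ω ∂gibbsKer G W P Λ ξ ≤
        ENNReal.ofReal (Real.exp (C + lam * ∑ y ∈ closedNhd G Λ \ Λ, |ξ y| ^ p * wgt G o α y)) := by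
    intro lam hlam
    have : Nonempty V := ⟨o⟩
    obtain ⟨C, -, hC⟩ := hstable.exists_volume_bound hθ hp0 hpq hlam hw
      (Real.one_le_exp (abs_nonneg α)) (fun x y hy => wgt_le_exp_mul hconn o α <|
        (G.mem_neighborFinset x y).1 hy) (hsumm.summable_wgt hconn hθ.le) hsumm
    exact ⟨C, hC⟩
  have hnorm : ∀ lam : ℝ, 0 < lam → ∃ C : ℝ, 0 < C ∧
      ∀ μ : Measure (V → ℝ), IsGibbsMeasure G W P μ → μ (tempered G o p α) = 1 →
        ∫⁻ ω, ENNReal.ofReal (Real.exp (lam * sNorm G o p α ω)) ∂μ ≤ ENNReal.ofReal C := by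
    intro lam hlam
    obtain ⟨C, hC⟩ := hvol lam hlam
    refine ⟨Real.exp C, Real.exp_pos C, fun μ hμ hμ1 => ?_⟩
    have := hμ.1
    have htemp := (measure_tempered_eq_one_iff μ).1 hμ1
    exact lintegral_exp_tsum_le hp.le
      (hμ.lintegral_expEnergy_le hstable hp.le hC htemp) htemp
  have hset : ∀ C : ℝ, (∀ (Λ : Finset V) (ξ : V → ℝ), ∀ F ⊆ Λ,
      ∫⁻ ω, expEnergy (wgt G o α) p 1 F ω ∂gibbsKer G W P Λ ξ ≤
        ENNReal.ofReal (Real.exp (C + 1 * ∑ y ∈ closedNhd G Λ \ Λ, |ξ y| ^ p * wgt G o α y))) →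
      {ν : ProbabilityMeasure (V → ℝ) |
        IsGibbsMeasure G W P ν.toMeasure ∧ ν.toMeasure (tempered G o p α) = 1} =
      momentSet (wgt G o α) p 1 (ENNReal.ofReal (Real.exp C)) ∩
        {ν : ProbabilityMeasure (V → ℝ) | IsGibbsMeasure G W P ν} := by
    intro C hC
    ext ν
    refine ⟨fun hν => ⟨fun F => ?_, hν.1⟩, fun hν => ⟨hν.2, ?_⟩⟩
    · exact hν.1.lintegral_expEnergy_le hstable hp.le hC
        ((measure_tempered_eq_one_iff _).1 hν.2) F
    · exact (measure_tempered_eq_one_iff _).2 <|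
        ae_summable_of_lintegral_expEnergy_le (fun x => (hw x).le) one_pos
          ENNReal.ofReal_ne_top hν.1
  obtain ⟨C, hC⟩ := hvol 1 one_pos
  refine ⟨?_, ?_, fun lam hlam x => ?_, hnorm⟩
  · rw [hset C hC]
    exact hstable.exists_isGibbsMeasure_mem_momentSet hw hp one_pos hC
  · rw [hset C hC]
    exact (isCompact_momentSet hw hp one_pos ENNReal.ofReal_ne_top).inter_right
      hstable.isClosed_setOf_isGibbsMeasure
  · obtain ⟨K, hK, hbound⟩ := hnorm (lam / wgt G o α x) (div_pos hlam (hw x))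
    refine ⟨K, hK, fun μ hμ hμ1 => (lintegral_mono_ae ?_).trans (hbound μ hμ hμ1)⟩
    have := hμ.1
    filter_upwards [(measure_tempered_eq_one_iff μ).1 hμ1] with ω hω
    refine ENNReal.ofReal_le_ofReal (Real.exp_le_exp.2 ?_)
    have hx : |ω x| ^ p * wgt G o α x ≤ sNorm G o p α ω :=
      hω.le_tsum x fun y _ => mul_nonneg (by positivity) (hw y).le
    calc lam * |ω x| ^ p = lam / wgt G o α x * (|ω x| ^ p * wgt G o α x) := by
          field_simp [(hw x).ne']
      _ ≤ _ := mul_le_mul_of_nonneg_left hx (div_pos hlam (hw x)).le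
end
end
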